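/- PN Coherence: the functor G from PN to Br is faithful; that is, for all arrow terms f, g : A ⊢ B of PN, if Gf = Gg in Br then f = g in PN. -/

import Mathlib

/-! ### The category Br of Brauerian split equivalences of finite ordinals

An arrow `m ⊢ n` of `Br` is represented as a relation on `ℕ ⊕ ℕ`, where
`Sum.inl i` (with `i < m`) is the source copy `i_s` and `Sum.inr j`
(with `j < n`) is the target copy `j_t`. -/

abbrev GRel : Type := (ℕ ⊕ ℕ) → (ℕ ⊕ ℕ) → Prop

/-- The identity arrow of `Br` on `n`: transversals `{i_s, i_t}` for `i < n`. -/
def gId (n : ℕ) : GRel := fun u v =>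
  ∃ i, i < n ∧ (u = Sum.inl i ∨ u = Sum.inr i) ∧ (v = Sum.inl i ∨ v = Sum.inr i)

/-- The Brauerian split equivalence whose transversals are `{i_s, (φ i)_t}` for `i < m`. -/
def gFun (m : ℕ) (φ : ℕ → ℕ) : GRel := fun u v =>
  ∃ i, i < m ∧ (u = Sum.inl i ∨ u = Sum.inr (φ i)) ∧ (v = Sum.inl i ∨ v = Sum.inr (φ i))

/-- The block transposition exchanging the first `a` and the last `b` elements. -/
def gSwap (a b : ℕ) : GRel :=
  gFun (a + b) (fun i => if i < a then i + b else i - a)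

/-- `G Δ̂∧_{B,A}` with `a = GA`, `b = GB`: identity transversals on the stem `A`
together with caps joining the two copies of each letter occurrence of `B` in
the crown `¬B ∨ B` of the target. -/
def gDelta (a b : ℕ) : GRel := fun u v =>
  (∃ i, i < a ∧ (u = Sum.inl i ∨ u = Sum.inr i) ∧ (v = Sum.inl i ∨ v = Sum.inr i)) ∨
  (∃ j, j < b ∧ (u = Sum.inr (a + j) ∨ u = Sum.inr (a + b + j)) ∧
                (v = Sum.inr (a + j) ∨ v = Sum.inr (a + b + j)))

/-- `G Σ̂∨_{B,A}` with `a = GA`, `b = GB`: identity transversals on the stem `A`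
together with cups joining the two copies of each letter occurrence of `B` in
the crown `B ∧ ¬B` of the source. -/
def gSigma (a b : ℕ) : GRel := fun u v =>
  (∃ i, i < a ∧ (u = Sum.inl (2*b + i) ∨ u = Sum.inr i) ∧
                (v = Sum.inl (2*b + i) ∨ v = Sum.inr i)) ∨
  (∃ j, j < b ∧ (u = Sum.inl j ∨ u = Sum.inl (b + j)) ∧
                (v = Sum.inl j ∨ v = Sum.inl (b + j)))

/-- Composition `P ∗ R` in `Br`: glue along the middle copy and take the
transitive closure, restricted to the outer copies. -/
def gComp (Pr R : GRel) : GRel := fun u v =>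
  Relation.TransGen
    (fun x y : ℕ ⊕ ℕ ⊕ ℕ =>
      (∃ x' y', Sum.map id Sum.inl x' = x ∧ Sum.map id Sum.inl y' = y ∧ R x' y') ∨
      (∃ x' y', Sum.inr x' = x ∧ Sum.inr y' = y ∧ Pr x' y'))
    (Sum.map id Sum.inr u) (Sum.map id Sum.inr v)

/-- Shift a split relation by `a` on the source side and by `d` on the target side. -/
def gShift (a d : ℕ) (R : GRel) : GRel := fun u v =>
  ∃ u' v', R u' v' ∧ u = Sum.map (· + a) (· + d) u' ∧ v = Sum.map (· + a) (· + d) v'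

/-- Disjoint union of split relations: `G(f ξ g) = Gf ∪ Gg_{+GD}^{+GA}`. -/
def gPar (a d : ℕ) (R S : GRel) : GRel := fun u v => R u v ∨ gShift a d S u v
/-! ### The language L∧,∨^{¬p} generated from `P ∪ P¬` (negation applied only to letters) -/

inductive Form (P : Type) : Type
  | pos : P → Form P
  | natom : P → Form P
  | conj : Form P → Form P → Form P
  | disj : Form P → Form P → Form P

infixr:70 " ⋏ " => Form.conj
infixr:66 " ⋎ " => Form.disj

/-- The number of occurrences of letters (elements of `P ∪ P¬`) in a formula. -/
def Form.size {P : Type} : Form P → ℕ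
  | .pos _ => 1
  | .natom _ => 1
  | .conj A B => A.size + B.size
  | .disj A B => A.size + B.size
/-! ### Arrow terms of the category PN -/

inductive Term (P : Type) : Form P → Form P → Type
  | id (A : Form P) : Term P A A
  | comp {A B C : Form P} : Term P B C → Term P A B → Term P A C
  | conj {A B D E : Form P} : Term P A D → Term P B E → Term P (A ⋏ B) (D ⋏ E)
  | disj {A B D E : Form P} : Term P A D → Term P B E → Term P (A ⋎ B) (D ⋎ E)
  | bConjTo (A B C : Form P) : Term P (A ⋏ (B ⋏ C)) ((A ⋏ B) ⋏ C)
  | bConjFrom (A B C : Form P) : Term P ((A ⋏ B) ⋏ C) (A ⋏ (B ⋏ C))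
  | bDisjTo (A B C : Form P) : Term P (A ⋎ (B ⋎ C)) ((A ⋎ B) ⋎ C)
  | bDisjFrom (A B C : Form P) : Term P ((A ⋎ B) ⋎ C) (A ⋎ (B ⋎ C))
  | cConj (A B : Form P) : Term P (A ⋏ B) (B ⋏ A)
  | cDisj (A B : Form P) : Term P (B ⋎ A) (A ⋎ B)
  | d (A B C : Form P) : Term P (A ⋏ (B ⋎ C)) ((A ⋏ B) ⋎ C)
  | delta (p : P) (A : Form P) : Term P A (A ⋏ (Form.natom p ⋎ Form.pos p))
  | sigma (p : P) (A : Form P) : Term P ((Form.pos p ⋏ Form.natom p) ⋎ A) A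

infixr:80 " ⬝ " => Term.comp
infixr:70 " ⊼ " => Term.conj
infixr:66 " ⊽ " => Term.disj

/-- The arrow `d^R_{C,B,A} : (C∨B)∧A ⊢ C∨(B∧A)`. -/
def dR {P : Type} (C B A : Form P) : Term P ((C ⋎ B) ⋏ A) (C ⋎ (B ⋏ A)) :=
  Term.cDisj C (B ⋏ A) ⬝ ((Term.cConj A B ⊽ Term.id C) ⬝
    (Term.d A B C ⬝ ((Term.id A ⊼ Term.cDisj B C) ⬝ Term.cConj (C ⋎ B) A)))

/-- `Σ̂∧_{p,A} = ĉ∧ ∘ Δ̂∧_{p,A} : A ⊢ (¬p∨p)∧A`. -/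
def sigmaConj {P : Type} (p : P) (A : Form P) :
    Term P A ((Form.natom p ⋎ Form.pos p) ⋏ A) :=
  Term.cConj A (Form.natom p ⋎ Form.pos p) ⬝ Term.delta p A

/-- `Δ̂∨_{p,A} = Σ̂∨_{p,A} ∘ ĉ∨ : A∨(p∧¬p) ⊢ A`. -/
def deltaDisj {P : Type} (p : P) (A : Form P) :
    Term P (A ⋎ (Form.pos p ⋏ Form.natom p)) A :=
  Term.sigma p A ⬝ Term.cDisj (Form.pos p ⋏ Form.natom p) A

/-- `Δ̂∧′_{p,A} = (1_A ∧ ĉ∨) ∘ Δ̂∧_{p,A} : A ⊢ A∧(p∨¬p)`. -/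
def delta' {P : Type} (p : P) (A : Form P) :
    Term P A (A ⋏ (Form.pos p ⋎ Form.natom p)) :=
  (Term.id A ⊼ Term.cDisj (Form.pos p) (Form.natom p)) ⬝ Term.delta p A

/-- `Σ̂∨′_{p,A} = Σ̂∨_{p,A} ∘ (ĉ∧ ∨ 1_A) : (¬p∧p)∨A ⊢ A`. -/
def sigma' {P : Type} (p : P) (A : Form P) :
    Term P ((Form.natom p ⋏ Form.pos p) ⋎ A) A :=
  Term.sigma p A ⬝ (Term.cConj (Form.natom p) (Form.pos p) ⊽ Term.id A)

/-- `Σ̂∧′_{p,A} = ĉ∧ ∘ Δ̂∧′_{p,A} : A ⊢ (p∨¬p)∧A`. -/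
def sigmaConj' {P : Type} (p : P) (A : Form P) :
    Term P A ((Form.pos p ⋎ Form.natom p) ⋏ A) :=
  Term.cConj A (Form.pos p ⋎ Form.natom p) ⬝ delta' p A

/-- `Δ̂∨′_{p,A} = Σ̂∨′_{p,A} ∘ ĉ∨ : A∨(¬p∧p) ⊢ A`. -/
def deltaDisj' {P : Type} (p : P) (A : Form P) :
    Term P (A ⋎ (Form.natom p ⋏ Form.pos p)) A :=
  sigma' p A ⬝ Term.cDisj (Form.natom p ⋏ Form.pos p) A
/-! ### The equations of DS, imposed on arrow terms -/

inductive Eqv {P : Type} : ∀ {A B : Form P}, Term P A B → Term P A B → Prop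
  -- equivalence and congruence
  | refl {A B : Form P} (f : Term P A B) : Eqv f f
  | symm {A B : Form P} {f g : Term P A B} : Eqv f g → Eqv g f
  | trans {A B : Form P} {f g h : Term P A B} : Eqv f g → Eqv g h → Eqv f h
  | congComp {A B C : Form P} {g g' : Term P B C} {f f' : Term P A B} :
      Eqv g g' → Eqv f f' → Eqv (g ⬝ f) (g' ⬝ f')
  | congConj {A B D E : Form P} {f f' : Term P A D} {g g' : Term P B E} :
      Eqv f f' → Eqv g g' → Eqv (f ⊼ g) (f' ⊼ g')
  | congDisj {A B D E : Form P} {f f' : Term P A D} {g g' : Term P B E} :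
      Eqv f f' → Eqv g g' → Eqv (f ⊽ g) (f' ⊽ g')
  -- (cat 1), (cat 2)
  | catIdR {A B : Form P} (f : Term P A B) : Eqv (f ⬝ Term.id A) f
  | catIdL {A B : Form P} (f : Term P A B) : Eqv (Term.id B ⬝ f) f
  | catAssoc {A B C D : Form P} (f : Term P A B) (g : Term P B C) (h : Term P C D) :
      Eqv (h ⬝ (g ⬝ f)) ((h ⬝ g) ⬝ f)
  -- bifunctorial equations (ξ 1), (ξ 2)
  | conjOne (A B : Form P) : Eqv (Term.id A ⊼ Term.id B) (Term.id (A ⋏ B))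
  | disjOne (A B : Form P) : Eqv (Term.id A ⊽ Term.id B) (Term.id (A ⋎ B))
  | conjTwo {A₁ B₁ C₁ A₂ B₂ C₂ : Form P} (g₁ : Term P B₁ C₁) (f₁ : Term P A₁ B₁)
      (g₂ : Term P B₂ C₂) (f₂ : Term P A₂ B₂) :
      Eqv ((g₁ ⬝ f₁) ⊼ (g₂ ⬝ f₂)) ((g₁ ⊼ g₂) ⬝ (f₁ ⊼ f₂))
  | disjTwo {A₁ B₁ C₁ A₂ B₂ C₂ : Form P} (g₁ : Term P B₁ C₁) (f₁ : Term P A₁ B₁)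
      (g₂ : Term P B₂ C₂) (f₂ : Term P A₂ B₂) :
      Eqv ((g₁ ⬝ f₁) ⊽ (g₂ ⬝ f₂)) ((g₁ ⊽ g₂) ⬝ (f₁ ⊽ f₂))
  -- naturality equations
  | bConjNat {A B C D E F : Form P} (f : Term P A D) (g : Term P B E) (h : Term P C F) :
      Eqv (((f ⊼ g) ⊼ h) ⬝ Term.bConjTo A B C) (Term.bConjTo D E F ⬝ (f ⊼ (g ⊼ h)))
  | bDisjNat {A B C D E F : Form P} (f : Term P A D) (g : Term P B E) (h : Term P C F) :
      Eqv (((f ⊽ g) ⊽ h) ⬝ Term.bDisjTo A B C) (Term.bDisjTo D E F ⬝ (f ⊽ (g ⊽ h)))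
  | cConjNat {A B D E : Form P} (f : Term P A D) (g : Term P B E) :
      Eqv ((g ⊼ f) ⬝ Term.cConj A B) (Term.cConj D E ⬝ (f ⊼ g))
  | cDisjNat {A B D E : Form P} (f : Term P A D) (g : Term P B E) :
      Eqv ((g ⊽ f) ⬝ Term.cDisj B A) (Term.cDisj E D ⬝ (f ⊽ g))
  | dNat {A B C D E F : Form P} (f : Term P A D) (g : Term P B E) (h : Term P C F) :
      Eqv (((f ⊼ g) ⊽ h) ⬝ Term.d A B C) (Term.d D E F ⬝ (f ⊼ (g ⊽ h)))
  -- (b̂ξ b̂ξ)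
  | bConjIso₁ (A B C : Form P) :
      Eqv (Term.bConjFrom A B C ⬝ Term.bConjTo A B C) (Term.id (A ⋏ (B ⋏ C)))
  | bConjIso₂ (A B C : Form P) :
      Eqv (Term.bConjTo A B C ⬝ Term.bConjFrom A B C) (Term.id ((A ⋏ B) ⋏ C))
  | bDisjIso₁ (A B C : Form P) :
      Eqv (Term.bDisjFrom A B C ⬝ Term.bDisjTo A B C) (Term.id (A ⋎ (B ⋎ C)))
  | bDisjIso₂ (A B C : Form P) :
      Eqv (Term.bDisjTo A B C ⬝ Term.bDisjFrom A B C) (Term.id ((A ⋎ B) ⋎ C))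
  -- (b̂ξ 5)
  | bConjPent (A B C D : Form P) :
      Eqv (Term.bConjFrom A B (C ⋏ D) ⬝ Term.bConjFrom (A ⋏ B) C D)
        ((Term.id A ⊼ Term.bConjFrom B C D) ⬝
          (Term.bConjFrom A (B ⋏ C) D ⬝ (Term.bConjFrom A B C ⊼ Term.id D)))
  | bDisjPent (A B C D : Form P) :
      Eqv (Term.bDisjFrom A B (C ⋎ D) ⬝ Term.bDisjFrom (A ⋎ B) C D)
        ((Term.id A ⊽ Term.bDisjFrom B C D) ⬝
          (Term.bDisjFrom A (B ⋎ C) D ⬝ (Term.bDisjFrom A B C ⊽ Term.id D)))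
  -- (ĉ∧ ĉ∧), (ĉ∨ ĉ∨)
  | cConjIso (A B : Form P) : Eqv (Term.cConj B A ⬝ Term.cConj A B) (Term.id (A ⋏ B))
  | cDisjIso (A B : Form P) : Eqv (Term.cDisj A B ⬝ Term.cDisj B A) (Term.id (A ⋎ B))
  -- (b̂∧ ĉ∧), (b̂∨ ĉ∨)
  | bcConj (A B C : Form P) :
      Eqv ((Term.id B ⊼ Term.cConj C A) ⬝ (Term.bConjFrom B C A ⬝
            (Term.cConj A (B ⋏ C) ⬝ (Term.bConjFrom A B C ⬝ (Term.cConj B A ⊼ Term.id C)))))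
        (Term.bConjFrom B A C)
  | bcDisj (A B C : Form P) :
      Eqv ((Term.id B ⊽ Term.cDisj A C) ⬝ (Term.bDisjFrom B C A ⬝
            (Term.cDisj (B ⋎ C) A ⬝ (Term.bDisjFrom A B C ⬝ (Term.cDisj A B ⊽ Term.id C)))))
        (Term.bDisjFrom B A C)
  -- (d ∧), (d ∨)
  | dConj (A B C D : Form P) :
      Eqv ((Term.bConjFrom A B C ⊽ Term.id D) ⬝ Term.d (A ⋏ B) C D)
        (Term.d A (B ⋏ C) D ⬝ ((Term.id A ⊼ Term.d B C D) ⬝ Term.bConjFrom A B (C ⋎ D)))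
  | dDisj (D C B A : Form P) :
      Eqv (Term.d D C (B ⋎ A) ⬝ (Term.id D ⊼ Term.bDisjFrom C B A))
        (Term.bDisjFrom (D ⋏ C) B A ⬝ ((Term.d D C B ⊽ Term.id A) ⬝ Term.d D (C ⋎ B) A))
  -- (d b̂∧), (d b̂∨)
  | dBConj (A B C D : Form P) :
      Eqv (dR (A ⋏ B) C D ⬝ (Term.d A B C ⊼ Term.id D))
        (Term.d A B (C ⋏ D) ⬝ ((Term.id A ⊼ dR B C D) ⬝ Term.bConjFrom A (B ⋎ C) D))
  | dBDisj (D C B A : Form P) :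
      Eqv ((Term.id D ⊽ Term.d C B A) ⬝ dR D C (B ⋎ A))
        (Term.bDisjFrom D (C ⋏ B) A ⬝ ((dR D C B ⊽ Term.id A) ⬝ Term.d (D ⋎ C) B A))
  -- (Δ̂∧ nat)
  | deltaNat {A D : Form P} (p : P) (f : Term P A D) :
      Eqv ((f ⊼ Term.id (Form.natom p ⋎ Form.pos p)) ⬝ Term.delta p A) (Term.delta p D ⬝ f)
  -- (Σ̂∨ nat)
  | sigmaNat {A D : Form P} (p : P) (f : Term P A D) :
      Eqv (f ⬝ Term.sigma p A) (Term.sigma p D ⬝ (Term.id (Form.pos p ⋏ Form.natom p) ⊽ f))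
  -- (b̂∧ Δ̂∧)
  | bDelta (A B : Form P) (p : P) :
      Eqv (Term.bConjFrom A B (Form.natom p ⋎ Form.pos p) ⬝ Term.delta p (A ⋏ B))
        (Term.id A ⊼ Term.delta p B)
  -- (b̂∨ Σ̂∨)
  | bSigma (p : P) (B A : Form P) :
      Eqv (Term.sigma p (B ⋎ A) ⬝ Term.bDisjFrom (Form.pos p ⋏ Form.natom p) B A)
        (Term.sigma p B ⊽ Term.id A)
  -- (d Σ̂∧)
  | dSigmaConj (p : P) (B C : Form P) :
      Eqv (Term.d (Form.natom p ⋎ Form.pos p) B C ⬝ sigmaConj p (B ⋎ C))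
        (sigmaConj p B ⊽ Term.id C)
  -- (d Δ̂∨)
  | dDeltaDisj (p : P) (C B : Form P) :
      Eqv (deltaDisj p (C ⋏ B) ⬝ Term.d C B (Form.pos p ⋏ Form.natom p))
        (Term.id C ⊼ deltaDisj p B)
  -- (Σ̂∨ Δ̂∧)
  | sigmaDelta (p : P) :
      Eqv (Term.sigma p (Form.pos p) ⬝
            (Term.d (Form.pos p) (Form.natom p) (Form.pos p) ⬝ Term.delta p (Form.pos p)))
        (Term.id (Form.pos p))
  -- (Σ̂∨′ Δ̂∧′)
  | sigmaDelta' (p : P) :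
      Eqv (sigma' p (Form.natom p) ⬝
            (Term.d (Form.natom p) (Form.pos p) (Form.natom p) ⬝ delta' p (Form.natom p)))
        (Term.id (Form.natom p))
/-- The functor `G` from DS to Br on arrow terms. -/
def Term.G {P : Type} : ∀ {A B : Form P}, Term P A B → GRel
  | _, _, .id A => gId A.size
  | _, _, .comp g f => gComp (Term.G g) (Term.G f)
  | _, _, @Term.conj _ A _ D _ f g => gPar A.size D.size (Term.G f) (Term.G g)
  | _, _, @Term.disj _ A _ D _ f g => gPar A.size D.size (Term.G f) (Term.G g)
  | _, _, .bConjTo A B C => gId (A.size + (B.size + C.size))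
  | _, _, .bConjFrom A B C => gId (A.size + B.size + C.size)
  | _, _, .bDisjTo A B C => gId (A.size + (B.size + C.size))
  | _, _, .bDisjFrom A B C => gId (A.size + B.size + C.size)
  | _, _, .cConj A B => gSwap A.size B.size
  | _, _, .cDisj A B => gSwap B.size A.size
  | _, _, .d A B C => gId (A.size + (B.size + C.size))
  | _, _, .delta _ A => gDelta A.size 1
  | _, _, .sigma _ A => gSigma A.size 1


open CategoryTheory

namespace PNC

/-! ## Symmetric semigroupal structures -/

structure SS (C : Type) [Category.{0} C] where
  t : C → C → C
  m : ∀ {A A' B B' : C}, (A ⟶ A') → (B ⟶ B') → (t A B ⟶ t A' B')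
  a : ∀ A B D : C, t (t A B) D ⟶ t A (t B D)
  ai : ∀ A B D : C, t A (t B D) ⟶ t (t A B) D
  c : ∀ A B : C, t A B ⟶ t B A
  m_id : ∀ A B : C, m (𝟙 A) (𝟙 B) = 𝟙 (t A B)
  m_comp : ∀ {A A' A'' B B' B'' : C} (f : A ⟶ A') (f' : A' ⟶ A'') (g : B ⟶ B') (g' : B' ⟶ B''),
    m (f ≫ f') (g ≫ g') = m f g ≫ m f' g'
  a_nat : ∀ {A A' B B' D D' : C} (f : A ⟶ A') (g : B ⟶ B') (h : D ⟶ D'),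
    m (m f g) h ≫ a A' B' D' = a A B D ≫ m f (m g h)
  c_nat : ∀ {A A' B B' : C} (f : A ⟶ A') (g : B ⟶ B'), m f g ≫ c A' B' = c A B ≫ m g f
  a_ai : ∀ A B D : C, a A B D ≫ ai A B D = 𝟙 _
  ai_a : ∀ A B D : C, ai A B D ≫ a A B D = 𝟙 _
  c_c : ∀ A B : C, c A B ≫ c B A = 𝟙 _
  pent : ∀ A B D E : C, a (t A B) D E ≫ a A B (t D E) =
    m (a A B D) (𝟙 E) ≫ a A (t B D) E ≫ m (𝟙 A) (a B D E)
  hex0 : ∀ A B D : C, m (c B A) (𝟙 D) ≫ a A B D ≫ c A (t B D) ≫ a B D A ≫ m (𝟙 B) (c D A)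
    = a B A D

namespace SS
variable {C : Type} [Category.{0} C] (S : SS C)

theorem a_ai' (A B D : C) {Z : C} (h : S.t (S.t A B) D ⟶ Z) : S.a A B D ≫ S.ai A B D ≫ h = h := by
  rw [← Category.assoc, S.a_ai, Category.id_comp]
theorem ai_a' (A B D : C) {Z : C} (h : S.t A (S.t B D) ⟶ Z) : S.ai A B D ≫ S.a A B D ≫ h = h := by
  rw [← Category.assoc, S.ai_a, Category.id_comp]
theorem c_c' (A B : C) {Z : C} (h : S.t A B ⟶ Z) : S.c A B ≫ S.c B A ≫ h = h := by
  rw [← Category.assoc, S.c_c, Category.id_comp]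

theorem ai_nat {A A' B B' D D' : C} (f : A ⟶ A') (g : B ⟶ B') (h : D ⟶ D') :
    S.m f (S.m g h) ≫ S.ai A' B' D' = S.ai A B D ≫ S.m (S.m f g) h := by
  have : S.ai A B D ≫ (S.m (S.m f g) h ≫ S.a A' B' D') ≫ S.ai A' B' D' =
    S.ai A B D ≫ (S.a A B D ≫ S.m f (S.m g h)) ≫ S.ai A' B' D' := by rw [S.a_nat]
  simp only [Category.assoc, S.a_ai, Category.comp_id, S.ai_a'] at this
  exact this.symm

/-- the symmetric inverse hexagon -/
theorem hex (A B D : C) : S.a A B D ≫ S.c A (S.t B D) ≫ S.a B D A =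
    S.m (S.c A B) (𝟙 D) ≫ S.a B A D ≫ S.m (𝟙 B) (S.c A D) := by
  rw [← S.hex0 A B D]
  simp only [Category.assoc]
  rw [← S.m_comp (𝟙 B), S.c_c, Category.id_comp, S.m_id, Category.comp_id,
    ← Category.assoc (S.m _ _), ← S.m_comp, S.c_c, Category.id_comp, S.m_id, Category.id_comp]

theorem m_comp_id {A A' A'' B : C} (f : A ⟶ A') (f' : A' ⟶ A'') :
    S.m (f ≫ f') (𝟙 B) = S.m f (𝟙 B) ≫ S.m f' (𝟙 B) := by
  rw [← S.m_comp, Category.id_comp]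
theorem m_id_comp {A A' A'' B : C} (f : A ⟶ A') (f' : A' ⟶ A'') :
    S.m (𝟙 B) (f ≫ f') = S.m (𝟙 B) f ≫ S.m (𝟙 B) f' := by
  rw [← S.m_comp, Category.id_comp]
theorem m_exch {A A' B B' : C} (f : A ⟶ A') (g : B ⟶ B') :
    S.m f (𝟙 B) ≫ S.m (𝟙 A') g = S.m (𝟙 A) g ≫ S.m f (𝟙 B') := by
  rw [← S.m_comp, ← S.m_comp, Category.id_comp, Category.comp_id, Category.id_comp, Category.comp_id]

instance m_iso {A A' B B' : C} (f : A ⟶ A') (g : B ⟶ B') [IsIso f] [IsIso g] : IsIso (S.m f g) :=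
  ⟨⟨S.m (inv f) (inv g), by rw [← S.m_comp]; simp [S.m_id], by rw [← S.m_comp]; simp [S.m_id]⟩⟩
instance a_iso (A B D : C) : IsIso (S.a A B D) := ⟨⟨S.ai A B D, S.a_ai _ _ _, S.ai_a _ _ _⟩⟩
instance ai_iso (A B D : C) : IsIso (S.ai A B D) := ⟨⟨S.a A B D, S.ai_a _ _ _, S.a_ai _ _ _⟩⟩
instance c_iso (A B : C) : IsIso (S.c A B) := ⟨⟨S.c B A, S.c_c _ _, S.c_c _ _⟩⟩

/-- Structural maps. -/
inductive AC : ∀ {A B : C}, (A ⟶ B) → Prop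
  | a (A B D : C) : AC (S.a A B D)
  | ai (A B D : C) : AC (S.ai A B D)
  | c (A B : C) : AC (S.c A B)
  | id (A : C) : AC (𝟙 A)
  | m {A A' B B' : C} {f : A ⟶ A'} {g : B ⟶ B'} : AC f → AC g → AC (S.m f g)
  | comp {A B D : C} {f : A ⟶ B} {g : B ⟶ D} : AC f → AC g → AC (f ≫ g)

theorem AC.inv_ex {A B : C} {f : A ⟶ B} (h : S.AC f) : ∃ g : B ⟶ A, S.AC g ∧ f ≫ g = 𝟙 _ ∧ g ≫ f = 𝟙 _ := by
  induction h with
  | a A B D => exact ⟨_, .ai _ _ _, S.a_ai _ _ _, S.ai_a _ _ _⟩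
  | ai A B D => exact ⟨_, .a _ _ _, S.ai_a _ _ _, S.a_ai _ _ _⟩
  | c A B => exact ⟨_, .c _ _, S.c_c _ _, S.c_c _ _⟩
  | id A => exact ⟨_, .id _, by simp, by simp⟩
  | m _ _ ih1 ih2 =>
    obtain ⟨g1, h1, a1, b1⟩ := ih1
    obtain ⟨g2, h2, a2, b2⟩ := ih2
    exact ⟨_, .m h1 h2, by rw [← S.m_comp, a1, a2, S.m_id], by rw [← S.m_comp, b1, b2, S.m_id]⟩
  | comp _ _ ih1 ih2 =>
    obtain ⟨g1, h1, a1, b1⟩ := ih1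
    obtain ⟨g2, h2, a2, b2⟩ := ih2
    refine ⟨_, .comp h2 h1, ?_, ?_⟩
    · rw [Category.assoc, ← Category.assoc _ g2, a2, Category.id_comp, a1]
    · rw [Category.assoc, ← Category.assoc g1, b1, Category.id_comp, b2]

theorem AC.isIso {A B : C} {f : A ⟶ B} (h : S.AC f) : IsIso f := by
  obtain ⟨g, _, h1, h2⟩ := h.inv_ex
  exact ⟨⟨g, h1, h2⟩⟩

theorem AC.inv {A B : C} {f : A ⟶ B} [IsIso f] (h : S.AC f) : S.AC (inv f) := by
  obtain ⟨g, h0, h1, h2⟩ := h.inv_ex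
  rwa [IsIso.inv_eq_of_hom_inv_id h1]

/-- Optional contexts -/
@[reducible] def plug : Option C → C → C
  | none, y => y
  | some M, y => S.t y M

def plugMap : ∀ (K : Option C) {y z : C}, (y ⟶ z) → (S.plug K y ⟶ S.plug K z)
  | none, _, _, f => f
  | some M, _, _, f => S.m f (𝟙 M)

@[simp] theorem plugMap_id (K : Option C) (y : C) : S.plugMap K (𝟙 y) = 𝟙 _ := by
  cases K <;> simp [plugMap, m_id]
theorem plugMap_comp (K : Option C) {y z w : C} (f : y ⟶ z) (g : z ⟶ w) :
    S.plugMap K (f ≫ g) = S.plugMap K f ≫ S.plugMap K g := by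
  cases K <;> simp [plugMap, m_comp_id]
instance plugMap_iso (K : Option C) {y z : C} (f : y ⟶ z) [IsIso f] : IsIso (S.plugMap K f) := by
  cases K
  · exact ‹IsIso f›
  · exact S.m_iso f (𝟙 _)

inductive OAC : (K K' : Option C) → ((y : C) → S.plug K y ⟶ S.plug K' y) → Prop
  | none : OAC none none (fun y => 𝟙 y)
  | some {M M' : C} {k : M ⟶ M'} (h : S.AC k) : OAC (some M) (some M') (fun y => S.m (𝟙 y) k)

theorem OAC.id (K : Option C) : S.OAC K K (fun y => 𝟙 _) := by
  cases K with
  | none => exact .none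
  | some M => simpa only [S.m_id] using OAC.some (S := S) (.id M)

theorem OAC.comp {K L M : Option C} {f g} (h : S.OAC K L f) (h' : S.OAC L M g) :
    S.OAC K M (fun y => f y ≫ g y) := by
  cases h with
  | none => cases h'; simpa using OAC.none (S := S)
  | some h => cases h' with
    | some h' => simpa only [S.m_id_comp] using OAC.some (S := S) (h.comp h')

theorem OAC.nat {K L : Option C} {f} (h : S.OAC K L f) {y z : C} (u : y ⟶ z) :
    S.plugMap K u ≫ f z = f y ≫ S.plugMap L u := by
  cases h with
  | none => simp [plugMap]
  | some h => exact S.m_exch _ _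

theorem OAC.ac {K L : Option C} {f} (h : S.OAC K L f) (y : C) : S.AC (f y) := by
  cases h with
  | none => exact .id _
  | some h => exact .m (.id _) h

/-- One-hole contexts -/
inductive VC (C : Type) : Type
  | hole : VC C
  | left : VC C → C → VC C
  | right : C → VC C → VC C

@[reducible] def fill : VC C → C → C
  | .hole, y => y
  | .left V R, y => S.t (fill V y) R
  | .right R V, y => S.t R (fill V y)

def fillMap : ∀ (V : VC C) {y z : C}, (y ⟶ z) → (S.fill V y ⟶ S.fill V z)
  | .hole, _, _, f => f
  | .left V R, _, _, f => S.m (fillMap V f) (𝟙 R)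
  | .right R V, _, _, f => S.m (𝟙 R) (fillMap V f)

@[reducible] def addR : Option C → C → C
  | none, R => R
  | some M, R => S.t M R

@[reducible] def del : VC C → Option C
  | .hole => none
  | .left V R => some (S.addR (del V) R)
  | .right R V => some (S.addR (del V) R)

def addIso : ∀ (K : Option C) (R x : C), S.t (S.plug K x) R ⟶ S.t x (S.addR K R)
  | none, _, _ => 𝟙 _
  | some M, R, x => S.a x M R

theorem addIso_ac (K : Option C) (R x : C) : S.AC (S.addIso K R x) := by
  cases K with
  | none => exact .id _
  | some M => exact .a _ _ _

theorem addIso_nat (K : Option C) {R x x' : C} (f : x ⟶ x') :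
    S.m (S.plugMap K f) (𝟙 R) ≫ S.addIso K R x' = S.addIso K R x ≫ S.m f (𝟙 _) := by
  cases K with
  | none => simp [addIso, plugMap]
  | some M => simp only [addIso, plugMap]; rw [S.a_nat, S.m_id]

def ext : ∀ (V : VC C) (y : C), S.fill V y ⟶ S.plug (S.del V) y
  | .hole, y => 𝟙 y
  | .left V R, y => S.m (ext V y) (𝟙 R) ≫ S.addIso (S.del V) R y
  | .right R V, y => S.c _ _ ≫ S.m (ext V y) (𝟙 R) ≫ S.addIso (S.del V) R y

theorem ext_ac (V : VC C) (y : C) : S.AC (S.ext V y) := by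
  induction V with
  | hole => exact .id _
  | left V R ih => exact .comp (.m ih (.id _)) (S.addIso_ac _ _ _)
  | right R V ih => exact .comp (.c _ _) (.comp (.m ih (.id _)) (S.addIso_ac _ _ _))

theorem ext_nat (V : VC C) {y z : C} (u : y ⟶ z) :
    S.fillMap V u ≫ S.ext V z = S.ext V y ≫ S.plugMap (S.del V) u := by
  induction V with
  | hole => simp [fillMap, ext, plugMap, del]
  | left V R ih =>
    simp only [fillMap, ext, del, plugMap]
    rw [← Category.assoc, ← S.m_comp_id, ih, S.m_comp_id, Category.assoc, Category.assoc,
      S.addIso_nat]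
  | right R V ih =>
    simp only [fillMap, ext, del, plugMap]
    rw [← Category.assoc, S.c_nat, Category.assoc, ← Category.assoc (S.m (S.fillMap V u) (𝟙 R)),
      ← S.m_comp_id, ih, S.m_comp_id, Category.assoc, Category.assoc, Category.assoc,
      S.addIso_nat]

instance ext_iso (V : VC C) (y : C) : IsIso (S.ext V y) := (S.ext_ac V y).isIso
end SS
end PNC

open CategoryTheory

namespace PNC
namespace SS
variable {C : Type} [Category.{0} C] (S : SS C)

def IsAtom (x : C) : Prop := ∀ A B, x ≠ S.t A B

structure Free : Prop where
  inj : ∀ {A B A' B' : C}, S.t A B = S.t A' B' → A = A' ∧ B = B'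

/-- traced structural map -/
def Traced (x : C) (V' V : VC C) (e : S.fill V' x ⟶ S.fill V x) : Prop :=
  ∃ κ, S.OAC (S.del V') (S.del V) κ ∧ e ≫ S.ext V x = S.ext V' x ≫ κ x

/-- the map on a deleted context for `left` -/
theorem addK {K K' : Option C} {R R' : C} {κ} (h : S.OAC K K' κ) {r : R ⟶ R'} (hr : S.AC r) :
    ∃ k : S.addR K R ⟶ S.addR K' R', S.AC k ∧
      ∀ x, S.m (κ x) r ≫ S.addIso K' R' x = S.addIso K R x ≫ S.m (𝟙 x) k := by
  cases h with
  | none => exact ⟨r, hr, fun x => by simp [addIso]⟩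
  | some h => exact ⟨_, .m h hr, fun x => by simp only [addIso]; rw [S.a_nat]⟩

theorem traced_left {x : C} {V' V : VC C} {e : S.fill V' x ⟶ S.fill V x} (h : S.Traced x V' V e)
    {R R' : C} {r : R ⟶ R'} (hr : S.AC r) : S.Traced x (.left V' R) (.left V R') (S.m e r) := by
  obtain ⟨κ, h1, h2⟩ := h
  obtain ⟨k, hk, hk2⟩ := S.addK h1 hr
  refine ⟨_, .some hk, ?_⟩
  simp only [ext]
  rw [Category.assoc, ← hk2, ← Category.assoc, ← Category.assoc, ← S.m_comp, ← S.m_comp, h2]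
  simp

theorem traced_right {x : C} {V' V : VC C} {e : S.fill V' x ⟶ S.fill V x} (h : S.Traced x V' V e)
    {R R' : C} {r : R ⟶ R'} (hr : S.AC r) : S.Traced x (.right R V') (.right R' V) (S.m r e) := by
  obtain ⟨κ, h1, h2⟩ := S.traced_left h hr
  refine ⟨κ, h1, ?_⟩
  simp only [ext] at h2 ⊢
  rw [← Category.assoc, S.c_nat, Category.assoc, h2]
  simp only [Category.assoc]

theorem traced_c1 (x : C) (V : VC C) (R : C) : S.Traced x (.right R V) (.left V R) (S.c _ _) :=
  ⟨_, .id _ _, by simp only [ext]; simp⟩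
theorem traced_c2 (x : C) (V : VC C) (R : C) : S.Traced x (.left V R) (.right R V) (S.c _ _) :=
  ⟨_, .id _ _, by simp only [ext]; rw [S.c_c']; simp⟩
theorem traced_comp {x : C} {U V W : VC C} {e : S.fill U x ⟶ S.fill V x} {f : S.fill V x ⟶ S.fill W x}
    (h : S.Traced x U V e) (h' : S.Traced x V W f) : S.Traced x U W (e ≫ f) := by
  obtain ⟨κ, h1, h2⟩ := h
  obtain ⟨κ', h1', h2'⟩ := h'
  exact ⟨_, h1.comp _ h1', by rw [Category.assoc, h2', ← Category.assoc, h2, Category.assoc]⟩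
theorem oac_inv {K L : Option C} {κ} (h1 : S.OAC K L κ) :
    ∃ κ', S.OAC L K κ' ∧ ∀ y, κ y ≫ κ' y = 𝟙 _ := by
  cases h1 with
  | none => exact ⟨_, .none, fun y => by simp⟩
  | some h =>
    obtain ⟨g, hg, h1, h2⟩ := h.inv_ex
    exact ⟨_, .some hg, fun y => by rw [← S.m_comp, h1]; simp [S.m_id]⟩
theorem traced_inv {x : C} {U V : VC C} {e : S.fill U x ⟶ S.fill V x} {f : S.fill V x ⟶ S.fill U x}
    (h : S.Traced x U V e) (hf : f ≫ e = 𝟙 _) : S.Traced x V U f := by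
  obtain ⟨κ, h1, h2⟩ := h
  obtain ⟨κ', h3, h4⟩ := S.oac_inv h1
  refine ⟨κ', h3, ?_⟩
  have : f ≫ e ≫ S.ext V x ≫ κ' x = f ≫ S.ext U x := by
    rw [← Category.assoc e, h2, Category.assoc, h4, Category.comp_id]
  rw [← this, ← Category.assoc, hf, Category.id_comp]

theorem traced_id (x : C) (V : VC C) : S.Traced x V V (𝟙 _) := ⟨_, .id _ _, by simp⟩

/-- position 1 -/
theorem traced_a1 (x : C) (V : VC C) (B D : C) :
    S.Traced x (.left (.left V B) D) (.left V (S.t B D)) (S.a _ _ _) := by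
  have : ∃ k : S.t (S.addR (S.del V) B) D ⟶ S.addR (S.del V) (S.t B D), S.AC k ∧
      S.a _ _ _ ≫ S.addIso (S.del V) (S.t B D) x =
      S.m (S.addIso (S.del V) B x) (𝟙 D) ≫ S.a _ _ _ ≫ S.m (𝟙 x) k := by
    cases S.del V with
    | none => exact ⟨𝟙 _, .id _, by simp only [addIso, S.m_id]; simp⟩
    | some M => exact ⟨_, .a M B D, by simp only [addIso]; rw [S.pent]⟩
  obtain ⟨k, hk, h⟩ := this
  refine ⟨_, .some hk, ?_⟩
  simp only [ext]
  simp only [S.m_comp_id, Category.assoc, addIso] at h ⊢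
  rw [← h, ← Category.assoc, ← Category.assoc, S.a_nat, S.m_id]

theorem a_mirror (A B D : C) : S.a A B D = S.c (S.t A B) D ≫ S.m (𝟙 D) (S.c A B) ≫ S.ai D B A ≫
    S.m (S.c D B) (𝟙 A) ≫ S.c (S.t B D) A := by
  have h1 := S.hex A B D
  have h2 := S.hex D B A
  have h3 : S.a A B D = S.m (S.c A B) (𝟙 D) ≫ S.a B A D ≫ S.m (𝟙 B) (S.c A D) ≫ S.ai B D A ≫
      S.c (S.t B D) A := by
    have := congrArg (fun z => z ≫ S.ai B D A ≫ S.c (S.t B D) A) h1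
    simpa only [Category.assoc, S.a_ai', S.c_c, Category.comp_id] using this
  have h4 : S.ai D B A ≫ S.m (S.c D B) (𝟙 A) = S.c D (S.t B A) ≫ S.a B A D ≫ S.m (𝟙 B) (S.c A D) ≫
      S.ai B D A := by
    have := congrArg (fun z => S.ai D B A ≫ z ≫ S.m (𝟙 B) (S.c A D) ≫ S.ai B D A) h2
    simp only [Category.assoc, S.ai_a'] at this
    rw [this, ← Category.assoc (S.m (𝟙 B) (S.c D A)), ← S.m_comp, S.c_c]
    simp [S.m_id, S.a_ai]
  rw [← Category.assoc (S.ai D B A), h4, ← Category.assoc (S.m (𝟙 D) (S.c A B)),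
    ← Category.assoc (S.m (𝟙 D) (S.c A B)), S.c_nat]
  simp only [Category.assoc, S.c_c']
  rw [h3]

theorem traced_a3 (x : C) (V : VC C) (A B : C) :
    S.Traced x (.right (S.t A B) V) (.right A (.right B V)) (S.a _ _ _) := by
  have h1 : S.Traced x (.left V (S.t B A)) (.left (.left V B) A) (S.ai _ _ _) :=
    S.traced_inv (S.traced_a1 x V B A) (S.ai_a _ _ _)
  have h := S.traced_comp (S.traced_c1 x V (S.t A B)) <|
    S.traced_comp (S.traced_left (S.traced_id x V) (.c A B)) <|
    S.traced_comp h1 <|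
    S.traced_comp (S.traced_left (S.traced_c2 x V B) (.id A)) (S.traced_c2 x (.right B V) A)
  have e := S.a_mirror A B (S.fill V x)
  unfold fill at h
  rw [e]; exact h

theorem traced_a2 (x : C) (V : VC C) (A D : C) :
    S.Traced x (.left (.right A V) D) (.right A (.left V D)) (S.a _ _ _) := by
  have h := S.traced_comp (S.traced_left (S.traced_c1 x V A) (.id D)) <|
    S.traced_comp (S.traced_a1 x V A D) <|
    S.traced_comp (S.traced_c2 x V (S.t A D)) <|
    S.traced_comp (S.traced_a3 x V A D) (S.traced_right (S.traced_c1 x V D) (.id A))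
  have e := S.hex0 (S.fill V x) A D
  unfold Traced
  rw [← e]; exact h

/-- Trace lemma. -/
theorem trace (hS : S.Free) {x : C} (hx : S.IsAtom x) {F G : C} {e : F ⟶ G} (h : S.AC e) :
    ∀ V (hG : G = S.fill V x), ∃ V', ∃ hF : F = S.fill V' x,
      S.Traced x V' V (eqToHom hF.symm ≫ e ≫ eqToHom hG) := by
  have key : ∀ {F G : C} {e : F ⟶ G} (V V' : VC C) (hF : F = S.fill V' x) (hG : G = S.fill V x)
    (e' : S.fill V' x ⟶ S.fill V x), S.Traced x V' V e' → HEq e e' → ∃ V', ∃ hF : F = S.fill V' x,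
      S.Traced x V' V (eqToHom hF.symm ≫ e ≫ eqToHom hG) := by
    intro F G e V V' hF hG e' ht he
    subst hF hG
    cases he
    exact ⟨V', rfl, by simpa using ht⟩
  induction h with
  | a A B D =>
    intro V hG
    cases V with
    | hole => exact absurd hG.symm (hx _ _)
    | left V R =>
      obtain ⟨rfl, rfl⟩ := hS.inj hG
      exact key _ _ rfl rfl _ (S.traced_a1 x V B D) HEq.rfl
    | right R V =>
      obtain ⟨rfl, h2⟩ := hS.inj hG
      cases V with
      | hole => exact absurd h2.symm (hx _ _)
      | left V R =>
        obtain ⟨rfl, rfl⟩ := hS.inj h2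
        exact key _ _ rfl rfl _ (S.traced_a2 x V A D) HEq.rfl
      | right R V =>
        obtain ⟨rfl, rfl⟩ := hS.inj h2
        exact key _ _ rfl rfl _ (S.traced_a3 x V A B) HEq.rfl
  | ai A B D =>
    intro V hG
    cases V with
    | hole => exact absurd hG.symm (hx _ _)
    | right R V =>
      obtain ⟨rfl, rfl⟩ := hS.inj hG
      exact key _ _ rfl rfl _ (S.traced_inv (S.traced_a3 x V A B) (S.ai_a _ _ _)) HEq.rfl
    | left V R =>
      obtain ⟨h2, rfl⟩ := hS.inj hG
      cases V with
      | hole => exact absurd h2.symm (hx _ _)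
      | left V R =>
        obtain ⟨rfl, rfl⟩ := hS.inj h2
        exact key _ _ rfl rfl _ (S.traced_inv (S.traced_a1 x V B D) (S.ai_a _ _ _)) HEq.rfl
      | right R V =>
        obtain ⟨rfl, rfl⟩ := hS.inj h2
        exact key _ _ rfl rfl _ (S.traced_inv (S.traced_a2 x V A D) (S.ai_a _ _ _)) HEq.rfl
  | c A B =>
    intro V hG
    cases V with
    | hole => exact absurd hG.symm (hx _ _)
    | left V R =>
      obtain ⟨rfl, rfl⟩ := hS.inj hG
      exact key _ _ rfl rfl _ (S.traced_c1 x V A) HEq.rfl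
    | right R V =>
      obtain ⟨rfl, rfl⟩ := hS.inj hG
      exact key _ _ rfl rfl _ (S.traced_c2 x V B) HEq.rfl
  | id A =>
    intro V hG
    subst hG
    exact ⟨V, rfl, by simpa using S.traced_id x V⟩
  | @m A A' B B' f g hf hg ih1 ih2 =>
    intro V hG
    cases V with
    | hole => exact absurd hG.symm (hx _ _)
    | left V R =>
      obtain ⟨rfl, rfl⟩ := hS.inj hG
      obtain ⟨V', rfl, h⟩ := ih1 V rfl
      exact key _ _ rfl rfl _ (S.traced_left (by simpa using h) hg) HEq.rfl
    | right R V =>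
      obtain ⟨rfl, rfl⟩ := hS.inj hG
      obtain ⟨V', rfl, h⟩ := ih2 V rfl
      exact key _ _ rfl rfl _ (S.traced_right (by simpa using h) hf) HEq.rfl
  | comp _ _ ih1 ih2 =>
    intro V hG
    subst hG
    obtain ⟨V', rfl, h⟩ := ih2 V rfl
    obtain ⟨V'', rfl, h'⟩ := ih1 V' rfl
    refine ⟨V'', rfl, ?_⟩
    simp only [eqToHom_refl, Category.id_comp, Category.comp_id] at h h' ⊢
    exact S.traced_comp h' h

/-- leaves data -/
structure Lv where
  lv : C → Multiset C
  lv_t : ∀ A B, lv (S.t A B) = lv A + lv B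
  lv_atom : ∀ x, S.IsAtom x → lv x = {x}
  ind : ∀ (Q : C → Prop), (∀ x, S.IsAtom x → Q x) → (∀ A B, Q A → Q B → Q (S.t A B)) → ∀ x, Q x

variable {S}

theorem Lv.pos (L : S.Lv) (F : C) : L.lv F ≠ 0 := by
  refine L.ind (fun F => L.lv F ≠ 0) (fun x hx => ?_) (fun A B hA hB => ?_) F
  · rw [L.lv_atom x hx]; simp
  · rw [L.lv_t]; simp [hA]

theorem Lv.atom_of_mem (L : S.Lv) {F : C} : ∀ x ∈ L.lv F, S.IsAtom x := by
  refine L.ind (fun F => ∀ x ∈ L.lv F, S.IsAtom x) (fun x hx => ?_) (fun A B hA hB => ?_) F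
  · rw [L.lv_atom x hx]; simp [hx]
  · rw [L.lv_t]; intro x hx
    rcases Multiset.mem_add.1 hx with h | h
    · exact hA x h
    · exact hB x h

theorem Lv.fill (L : S.Lv) {x : C} (hx : S.IsAtom x) (V : VC C) : x ∈ L.lv (S.fill V x) := by
  induction V with
  | hole => simp [SS.fill, L.lv_atom x hx]
  | left V R ih => simp [SS.fill, L.lv_t, ih]
  | right V R ih => simp [SS.fill, L.lv_t, ih]

theorem Lv.ex_fill (L : S.Lv) (F : C) : ∀ x ∈ L.lv F, ∃ V, F = S.fill V x := by
  refine L.ind (fun F => ∀ x ∈ L.lv F, ∃ V, F = S.fill V x) (fun x hx => ?_) (fun A B hA hB => ?_) F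
  · rw [L.lv_atom x hx]; simp; exact ⟨.hole, rfl⟩
  · rw [L.lv_t]; intro x hx
    rcases Multiset.mem_add.1 hx with h | h
    · obtain ⟨V, rfl⟩ := hA x h; exact ⟨.left V B, rfl⟩
    · obtain ⟨V, rfl⟩ := hB x h; exact ⟨.right A V, rfl⟩

def Lv.olv (L : S.Lv) : Option C → Multiset C
  | none => 0
  | some M => L.lv M

theorem Lv.lv_addR (L : S.Lv) (K : Option C) (R : C) : L.lv (S.addR K R) = L.olv K + L.lv R := by
  cases K <;> simp [addR, olv, L.lv_t]

theorem Lv.lv_plug (L : S.Lv) (K : Option C) (y : C) : L.lv (S.plug K y) = L.lv y + L.olv K := by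
  cases K <;> simp [plug, olv, L.lv_t]

theorem Lv.lv_fill (L : S.Lv) (V : VC C) (y : C) : L.lv (S.fill V y) = L.lv y + L.olv (S.del V) := by
  induction V with
  | hole => simp [SS.fill, del, olv]
  | left V R ih => simp [SS.fill, del, olv, L.lv_t, ih, L.lv_addR, add_assoc]
  | right R V ih => simp [SS.fill, del, olv, L.lv_t, ih, L.lv_addR]; abel

theorem Lv.fill_inj (L : S.Lv) (hS : S.Free) {x : C} (hx : S.IsAtom x) (V W : VC C)
    (hn : (L.lv (S.fill V x)).Nodup) (h : S.fill V x = S.fill W x) : V = W := by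
  induction V generalizing W with
  | hole =>
    cases W with
    | hole => rfl
    | left => exact absurd h (hx _ _)
    | right => exact absurd h (hx _ _)
  | left V R ih =>
    have hn : (L.lv (S.t _ _)).Nodup := hn
    rw [L.lv_t] at hn
    cases W with
    | hole => exact absurd h.symm (hx _ _)
    | left W R' =>
      obtain ⟨h1, rfl⟩ := hS.inj h
      rw [ih W (Multiset.nodup_add.1 hn).1 h1]
    | right R' W =>
      obtain ⟨h1, h2⟩ := hS.inj h
      exact absurd (h2 ▸ L.fill hx W)
        (Multiset.disjoint_left.1 (Multiset.nodup_add.1 hn).2.2 (L.fill hx V))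
  | right R V ih =>
    have hn : (L.lv (S.t _ _)).Nodup := hn
    rw [L.lv_t] at hn
    cases W with
    | hole => exact absurd h.symm (hx _ _)
    | right R' W =>
      obtain ⟨rfl, h1⟩ := hS.inj h
      rw [ih W (Multiset.nodup_add.1 hn).2.1 h1]
    | left W R' =>
      obtain ⟨h1, h2⟩ := hS.inj h
      exact absurd (h1 ▸ L.fill hx W)
        (Multiset.disjoint_right.1 (Multiset.nodup_add.1 hn).2.2 (L.fill hx V))

theorem AC.lv_eq (L : S.Lv) {F G : C} {e : F ⟶ G} (h : S.AC e) : L.lv F = L.lv G := by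
  induction h with
  | a => simp [L.lv_t, add_assoc]
  | ai => simp [L.lv_t, add_assoc]
  | c => simp [L.lv_t, add_comm]
  | id => rfl
  | m _ _ h1 h2 => simp [L.lv_t, h1, h2]
  | comp _ _ h1 h2 => rw [h1, h2]

/-- Coherence -/
theorem AC.coh (L : S.Lv) (hS : S.Free) : ∀ {F G : C} {e e' : F ⟶ G}, S.AC e → S.AC e' →
    (L.lv F).Nodup → e = e' := by
  suffices H : ∀ n, ∀ {F G : C} {e e' : F ⟶ G}, (L.lv F).card = n → S.AC e → S.AC e' →
    (L.lv F).Nodup → e = e' from fun {F G e e'} h h' hn => H _ rfl h h' hn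
  intro n
  induction n using Nat.strong_induction_on with
  | _ n ih =>
  intro F G e e' hc h h' hn
  obtain ⟨x, hx⟩ := Multiset.exists_mem_of_ne_zero (L.pos G)
  have hxa := L.atom_of_mem x hx
  obtain ⟨V, rfl⟩ := L.ex_fill G x hx
  obtain ⟨V', rfl, κ, h1, h2⟩ := S.trace hS hxa h V rfl
  obtain ⟨V'', h3, κ', h1', h2'⟩ := S.trace hS hxa h' V rfl
  obtain rfl := L.fill_inj hS hxa V' V'' hn h3
  simp only [eqToHom_refl, Category.id_comp, Category.comp_id] at h2 h2'
  rw [← cancel_mono (S.ext V x), h2, h2']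
  congr 1
  rw [L.lv_fill, L.lv_atom x hxa] at hc hn
  clear h2 h2'
  revert h1 h1' hc hn κ κ'
  generalize S.del V = K
  generalize S.del V' = K'
  intro hc hn κ h1 κ' h1'
  cases h1 with
  | none => cases h1'; rfl
  | some k =>
    cases h1' with
    | some k' =>
      simp only [Lv.olv] at hc hn
      rw [ih _ (by rw [← hc]; simp) rfl k k' (Multiset.nodup_add.1 hn).2.1]

/-- Existence -/
theorem AC.exist (L : S.Lv) : ∀ {F G : C}, L.lv F = L.lv G → ∃ e : F ⟶ G, S.AC e := by
  suffices H : ∀ n, ∀ {F G : C}, (L.lv F).card = n → L.lv F = L.lv G → ∃ e : F ⟶ G, S.AC e from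
    fun {F G} h => H _ rfl h
  intro n
  induction n using Nat.strong_induction_on with
  | _ n ih =>
  intro F G hc h
  obtain ⟨x, hx⟩ := Multiset.exists_mem_of_ne_zero (L.pos G)
  have hxa := L.atom_of_mem x hx
  obtain ⟨V', rfl⟩ := L.ex_fill F x (h ▸ hx)
  obtain ⟨V, rfl⟩ := L.ex_fill G x hx
  have : ∃ k : S.plug (S.del V') x ⟶ S.plug (S.del V) x, S.AC k := by
    simp only [L.lv_fill, L.lv_atom x hxa] at hc h
    revert hc h
    generalize S.del V = K
    generalize S.del V' = K'
    intro hc h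
    have h' := add_left_cancel h
    cases K <;> cases K'
    · exact ⟨_, .id _⟩
    · exact absurd h' (L.pos _)
    · exact absurd h'.symm (L.pos _)
    · obtain ⟨k, hk⟩ := ih _ (by rw [← hc]; simp [Lv.olv]) rfl h'
      exact ⟨_, .m (.id _) hk⟩
  obtain ⟨k, hk⟩ := this
  exact ⟨_, .comp (S.ext_ac V' x) (.comp hk (S.ext_ac V x).inv)⟩

end SS
end PNC

open CategoryTheory

namespace PNC

/-! ## Reflection of structural equations -/

inductive Tr : Type
  | lf : ℕ → Tr
  | nd : Tr → Tr → Tr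

namespace SS
variable {C : Type} [Category.{0} C] (S : SS C)

@[reducible] def rho (x0 x1 x2 x3 x4 x5 : C) : ℕ → C
  | 0 => x0
  | 1 => x1
  | 2 => x2
  | 3 => x3
  | 4 => x4
  | _ => x5

@[reducible] def ev (ρ : ℕ → C) : Tr → C
  | .lf i => ρ i
  | .nd A B => S.t (ev ρ A) (ev ρ B)

inductive Str (ρ : ℕ → C) : ∀ T T' : Tr, (S.ev ρ T ⟶ S.ev ρ T') → Prop
  | a (A B D : Tr) : Str ρ (.nd (.nd A B) D) (.nd A (.nd B D)) (S.a _ _ _)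
  | ai (A B D : Tr) : Str ρ (.nd A (.nd B D)) (.nd (.nd A B) D) (S.ai _ _ _)
  | c (A B : Tr) : Str ρ (.nd A B) (.nd B A) (S.c _ _)
  | id (A : Tr) : Str ρ A A (𝟙 _)
  | m {A A' B B' : Tr} {f g} : Str ρ A A' f → Str ρ B B' g → Str ρ (.nd A B) (.nd A' B') (S.m f g)
  | comp {A B D : Tr} {f g} : Str ρ A B f → Str ρ B D g → Str ρ A D (f ≫ g)

def TrC (_S : SS C) (_ρ : ℕ → C) : Type := Tr

instance (ρ : ℕ → C) : Category.{0} (TrC S ρ) where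
  Hom T T' := S.ev ρ T ⟶ S.ev ρ T'
  id T := 𝟙 (S.ev ρ T)
  comp f g := CategoryStruct.comp (obj := C) f g
  id_comp f := Category.id_comp (obj := C) f
  comp_id f := Category.comp_id (obj := C) f
  assoc f g h := Category.assoc (obj := C) f g h

def TrS (ρ : ℕ → C) : SS (TrC S ρ) where
  t := Tr.nd
  m f g := S.m f g
  a A B D := S.a (S.ev ρ A) (S.ev ρ B) (S.ev ρ D)
  ai A B D := S.ai (S.ev ρ A) (S.ev ρ B) (S.ev ρ D)
  c A B := S.c (S.ev ρ A) (S.ev ρ B)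
  m_id _ _ := S.m_id _ _
  m_comp _ _ _ _ := S.m_comp _ _ _ _
  a_nat _ _ _ := S.a_nat _ _ _
  c_nat _ _ := S.c_nat _ _
  a_ai _ _ _ := S.a_ai _ _ _
  ai_a _ _ _ := S.ai_a _ _ _
  c_c _ _ := S.c_c _ _
  pent _ _ _ _ := S.pent _ _ _ _
  hex0 _ _ _ := S.hex0 _ _ _

def trlv : Tr → Multiset Tr
  | .lf i => {.lf i}
  | .nd A B => trlv A + trlv B

def trli : Tr → List ℕ
  | .lf i => [i]
  | .nd A B => trli A ++ trli B

def TrL (ρ : ℕ → C) : (S.TrS ρ).Lv where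
  lv := trlv
  lv_t _ _ := rfl
  lv_atom x hx := by
    cases x with
    | lf i => rfl
    | nd A B => exact absurd rfl (hx A B)
  ind Q h1 h2 x := by
    induction x with
    | lf i => exact h1 _ (fun A B h => by cases h)
    | nd A B ha hb => exact h2 A B ha hb

theorem trlv_eq (T : Tr) : trlv T = ((trli T).map Tr.lf : List Tr) := by
  induction T with
  | lf i => rfl
  | nd A B ha hb => simp [trlv, trli, ha, hb]

theorem Str.toAC {ρ : ℕ → C} {T T' : Tr} {f} (h : S.Str ρ T T' f) :
    @SS.AC (TrC S ρ) _ (S.TrS ρ) T T' f := by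
  induction h with
  | a A B D => exact AC.a (S := S.TrS ρ) A B D
  | ai A B D => exact AC.ai (S := S.TrS ρ) A B D
  | c A B => exact AC.c (S := S.TrS ρ) A B
  | id A => exact AC.id (S := S.TrS ρ) A
  | m _ _ h1 h2 => exact AC.m (S := S.TrS ρ) h1 h2
  | comp _ _ h1 h2 => exact AC.comp (S := S.TrS ρ) h1 h2

theorem coh (ρ : ℕ → C) (T T' : Tr) (hn : (trli T).Nodup) {f g : S.ev ρ T ⟶ S.ev ρ T'}
    (hf : S.Str ρ T T' f) (hg : S.Str ρ T T' g) : f = g := by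
  refine AC.coh (S := S.TrS ρ) (S.TrL ρ) ⟨fun {A B A' B'} h => ?_⟩ hf.toAC hg.toAC ?_
  · cases h; exact ⟨rfl, rfl⟩
  · show (trlv T).Nodup
    rw [trlv_eq]
    exact (List.Nodup.map (fun _ _ h => by cases h; rfl) hn)

inductive Mv : Tr → Tr → Type
  | a (A B D : Tr) : Mv (.nd (.nd A B) D) (.nd A (.nd B D))
  | ai (A B D : Tr) : Mv (.nd A (.nd B D)) (.nd (.nd A B) D)
  | c (A B : Tr) : Mv (.nd A B) (.nd B A)
  | id (A : Tr) : Mv A A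
  | m {A A' B B' : Tr} : Mv A A' → Mv B B' → Mv (.nd A B) (.nd A' B')
  | comp {A B D : Tr} : Mv A B → Mv B D → Mv A D

@[reducible] def Mv.den (ρ : ℕ → C) : ∀ {T T' : Tr}, Mv T T' → (S.ev ρ T ⟶ S.ev ρ T')
  | _, _, .a _ _ _ => S.a _ _ _
  | _, _, .ai _ _ _ => S.ai _ _ _
  | _, _, .c _ _ => S.c _ _
  | _, _, .id _ => 𝟙 _
  | _, _, .m f g => S.m (f.den ρ) (g.den ρ)
  | _, _, .comp f g => f.den ρ ≫ g.den ρ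

theorem Mv.str (ρ : ℕ → C) {T T' : Tr} (f : Mv T T') : S.Str ρ T T' (f.den S ρ) := by
  induction f with
  | a A B D => exact .a _ _ _
  | ai A B D => exact .ai _ _ _
  | c A B => exact .c _ _
  | id A => exact .id _
  | m _ _ h1 h2 => exact .m h1 h2
  | comp _ _ h1 h2 => exact .comp h1 h2

theorem mcoh (ρ : ℕ → C) (T T' : Tr) (hn : (trli T).Nodup) (f g : Mv T T') :
    f.den S ρ = g.den S ρ := S.coh ρ T T' hn (f.str S ρ) (g.str S ρ)

end SS

/-! ## The category of formulae -/

variable {P : Type}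

def setd (A B : Form P) : Setoid (Term P A B) := ⟨Eqv, .refl, .symm, .trans⟩

def Hm (A B : Form P) : Type := Quotient (setd A B)

def mk {A B : Form P} (f : Term P A B) : Hm A B := Quotient.mk (setd A B) f

theorem mk_eq {A B : Form P} {f g : Term P A B} (h : Eqv f g) : mk f = mk g := Quotient.sound h
theorem eqv_of_mk {A B : Form P} {f g : Term P A B} (h : mk f = mk g) : Eqv f g := Quotient.exact h

instance : Category.{0} (Form P) where
  Hom A B := Hm A B
  id A := mk (.id A)
  comp f g := Quotient.map₂ (sa := setd _ _) (sb := setd _ _) (sc := setd _ _) (fun f g => g ⬝ f)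
    (fun _ _ h _ _ h' => Eqv.congComp h' h) f g
  id_comp f := by induction f using Quotient.inductionOn; exact mk_eq (.catIdR _)
  comp_id f := by induction f using Quotient.inductionOn; exact mk_eq (.catIdL _)
  assoc f g h := by
    induction f using Quotient.inductionOn
    induction g using Quotient.inductionOn
    induction h using Quotient.inductionOn
    exact mk_eq (.catAssoc _ _ _)

/-- arrow of a term -/
def ar {A B : Form P} (f : Term P A B) : A ⟶ B := mk f

theorem ar_ind {A B : Form P} {Q : (A ⟶ B) → Prop} (h : ∀ f, Q (ar f)) (f : A ⟶ B) : Q f :=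
  Quotient.inductionOn f h

theorem ar_eq {A B : Form P} {f g : Term P A B} (h : Eqv f g) : ar f = ar g := mk_eq h
theorem ar_comp {A B C : Form P} (g : Term P B C) (f : Term P A B) : ar (g ⬝ f) = ar f ≫ ar g := rfl
theorem ar_id (A : Form P) : ar (.id A) = 𝟙 A := rfl

def cj {A B D E : Form P} (f : A ⟶ D) (g : B ⟶ E) : A ⋏ B ⟶ D ⋏ E :=
  Quotient.map₂ (sa := setd _ _) (sb := setd _ _) (sc := setd _ _) (fun f g => f ⊼ g)
    (fun _ _ h _ _ h' => Eqv.congConj h h') f g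
def dj {A B D E : Form P} (f : A ⟶ D) (g : B ⟶ E) : A ⋎ B ⟶ D ⋎ E :=
  Quotient.map₂ (sa := setd _ _) (sb := setd _ _) (sc := setd _ _) (fun f g => f ⊽ g)
    (fun _ _ h _ _ h' => Eqv.congDisj h h') f g

infixr:90 " ⟑ " => cj
infixr:90 " ⟇ " => dj

theorem ar_cj {A B D E : Form P} (f : Term P A D) (g : Term P B E) : ar (f ⊼ g) = ar f ⟑ ar g := rfl
theorem ar_dj {A B D E : Form P} (f : Term P A D) (g : Term P B E) : ar (f ⊽ g) = ar f ⟇ ar g := rfl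

def wa (A B C : Form P) : (A ⋏ B) ⋏ C ⟶ A ⋏ B ⋏ C := ar (.bConjFrom A B C)
def wai (A B C : Form P) : A ⋏ B ⋏ C ⟶ (A ⋏ B) ⋏ C := ar (.bConjTo A B C)
def wc (A B : Form P) : A ⋏ B ⟶ B ⋏ A := ar (.cConj A B)
def va (A B C : Form P) : (A ⋎ B) ⋎ C ⟶ A ⋎ B ⋎ C := ar (.bDisjFrom A B C)
def vai (A B C : Form P) : A ⋎ B ⋎ C ⟶ (A ⋎ B) ⋎ C := ar (.bDisjTo A B C)
def vc (A B : Form P) : A ⋎ B ⟶ B ⋎ A := ar (.cDisj B A)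
def dd (A B C : Form P) : A ⋏ (B ⋎ C) ⟶ (A ⋏ B) ⋎ C := ar (.d A B C)

/-- ∧ structure -/
@[reducible] def Ws : SS (Form P) where
  t := Form.conj
  m f g := f ⟑ g
  a := wa
  ai := wai
  c := wc
  m_id A B := ar_eq (.conjOne A B)
  m_comp f f' g g' := by
    induction f using ar_ind; induction f' using ar_ind; induction g using ar_ind
    induction g' using ar_ind
    exact ar_eq (.conjTwo _ _ _ _)
  a_nat {A A' B B' D D'} f g h := by
    induction f using ar_ind with | _ f
    induction g using ar_ind with | _ g
    induction h using ar_ind with | _ h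
    refine ar_eq (f := .bConjFrom _ _ _ ⬝ ((f ⊼ g) ⊼ h)) (g := (f ⊼ (g ⊼ h)) ⬝ .bConjFrom _ _ _) ?_
    refine .trans (.congComp (.refl _) (.trans (.symm (.catIdR _)) (.congComp (.refl _)
      (.symm (.bConjIso₂ _ _ _))))) ?_
    refine .trans (.congComp (.refl _) (.trans (.catAssoc _ _ _) (.congComp (.bConjNat _ _ _)
      (.refl _)))) ?_
    refine .trans (.congComp (.refl _) (.symm (.catAssoc _ _ _))) ?_
    refine .trans (.catAssoc _ _ _) ?_
    exact .trans (.congComp (.bConjIso₁ _ _ _) (.refl _)) (.catIdL _)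
  c_nat f g := by
    induction f using ar_ind; induction g using ar_ind
    exact ar_eq (.symm (.cConjNat _ _))
  a_ai A B D := ar_eq (.bConjIso₂ A B D)
  ai_a A B D := ar_eq (.bConjIso₁ A B D)
  c_c A B := ar_eq (.cConjIso A B)
  pent A B D E := by
    have := ar_eq (.bConjPent A B D E)
    simp only [ar_comp, ar_cj, ar_id, Category.assoc] at this
    exact this
  hex0 A B D := by
    have := ar_eq (.bcConj A B D)
    simp only [ar_comp, ar_cj, ar_id, Category.assoc] at this
    exact this

/-- ∨ structure -/
@[reducible] def Vs : SS (Form P) where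
  t := Form.disj
  m f g := f ⟇ g
  a := va
  ai := vai
  c := vc
  m_id A B := ar_eq (.disjOne A B)
  m_comp f f' g g' := by
    induction f using ar_ind; induction f' using ar_ind; induction g using ar_ind
    induction g' using ar_ind
    exact ar_eq (.disjTwo _ _ _ _)
  a_nat {A A' B B' D D'} f g h := by
    induction f using ar_ind with | _ f
    induction g using ar_ind with | _ g
    induction h using ar_ind with | _ h
    refine ar_eq (f := .bDisjFrom _ _ _ ⬝ ((f ⊽ g) ⊽ h)) (g := (f ⊽ (g ⊽ h)) ⬝ .bDisjFrom _ _ _) ?_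
    refine .trans (.congComp (.refl _) (.trans (.symm (.catIdR _)) (.congComp (.refl _)
      (.symm (.bDisjIso₂ _ _ _))))) ?_
    refine .trans (.congComp (.refl _) (.trans (.catAssoc _ _ _) (.congComp (.bDisjNat _ _ _)
      (.refl _)))) ?_
    refine .trans (.congComp (.refl _) (.symm (.catAssoc _ _ _))) ?_
    refine .trans (.catAssoc _ _ _) ?_
    exact .trans (.congComp (.bDisjIso₁ _ _ _) (.refl _)) (.catIdL _)
  c_nat f g := by
    induction f using ar_ind; induction g using ar_ind
    exact ar_eq (.symm (.cDisjNat _ _))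
  a_ai A B D := ar_eq (.bDisjIso₂ A B D)
  ai_a A B D := ar_eq (.bDisjIso₁ A B D)
  c_c A B := ar_eq (.cDisjIso A B)
  pent A B D E := by
    have := ar_eq (.bDisjPent A B D E)
    simp only [ar_comp, ar_dj, ar_id, Category.assoc] at this
    exact this
  hex0 A B D := by
    have := ar_eq (.bcDisj A B D)
    simp only [ar_comp, ar_dj, ar_id, Category.assoc] at this
    exact this

section
variable {C : Type} [Category.{0} C]
theorem as1 {A B D E : C} {f : A ⟶ B} {g : B ⟶ D} {k : A ⟶ D} (h : f ≫ g = k) (z : D ⟶ E) :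
    f ≫ g ≫ z = k ≫ z := by rw [← h, Category.assoc]
theorem as2 {A B D E F : C} {f : A ⟶ B} {g : B ⟶ D} {k : A ⟶ F} {l : F ⟶ D} (h : f ≫ g = k ≫ l) (z : D ⟶ E) :
    f ≫ g ≫ z = k ≫ l ≫ z := by rw [as1 h, Category.assoc]
end

theorem dj_id (A B : Form P) : (𝟙 A) ⟇ (𝟙 B) = 𝟙 (A ⋎ B) := Vs.m_id A B
theorem dj_comp {A A' A'' B B' B'' : Form P} (f : A ⟶ A') (f' : A' ⟶ A'') (g : B ⟶ B') (g' : B' ⟶ B'') :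
    (f ≫ f') ⟇ (g ≫ g') = f ⟇ g ≫ f' ⟇ g' := Vs.m_comp f f' g g'
theorem dj_comp1 {A A' A'' B : Form P} (f : A ⟶ A') (f' : A' ⟶ A'') :
    (f ≫ f') ⟇ 𝟙 B = f ⟇ 𝟙 B ≫ f' ⟇ 𝟙 B := Vs.m_comp_id f f'
theorem dj_comp2 {A A' A'' B : Form P} (f : A ⟶ A') (f' : A' ⟶ A'') :
    𝟙 B ⟇ (f ≫ f') = 𝟙 B ⟇ f ≫ 𝟙 B ⟇ f' := Vs.m_id_comp f f'
theorem dj_exch {A A' B B' : Form P} (f : A ⟶ A') (g : B ⟶ B') :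
    f ⟇ 𝟙 B ≫ 𝟙 A' ⟇ g = 𝟙 A ⟇ g ≫ f ⟇ 𝟙 B' := Vs.m_exch f g
theorem dj_split {A A' B B' : Form P} (f : A ⟶ A') (g : B ⟶ B') :
    f ⟇ g = f ⟇ 𝟙 B ≫ 𝟙 A' ⟇ g := by rw [← dj_comp, Category.comp_id, Category.id_comp]
theorem va_nat {A A' B B' D D' : Form P} (f : A ⟶ A') (g : B ⟶ B') (h : D ⟶ D') :
    (f ⟇ g) ⟇ h ≫ va A' B' D' = va A B D ≫ f ⟇ (g ⟇ h) := Vs.a_nat f g h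
theorem vai_nat {A A' B B' D D' : Form P} (f : A ⟶ A') (g : B ⟶ B') (h : D ⟶ D') :
    f ⟇ (g ⟇ h) ≫ vai A' B' D' = vai A B D ≫ (f ⟇ g) ⟇ h := Vs.ai_nat f g h
theorem vc_nat {A A' B B' : Form P} (f : A ⟶ A') (g : B ⟶ B') :
    f ⟇ g ≫ vc A' B' = vc A B ≫ g ⟇ f := Vs.c_nat f g
theorem va_vai (A B D : Form P) : va A B D ≫ vai A B D = 𝟙 _ := Vs.a_ai A B D
theorem vai_va (A B D : Form P) : vai A B D ≫ va A B D = 𝟙 _ := Vs.ai_a A B D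
theorem vc_vc (A B : Form P) : vc A B ≫ vc B A = 𝟙 _ := Vs.c_c A B
theorem va_vai' (A B D : Form P) {Z} (h : _ ⟶ Z) : va A B D ≫ vai A B D ≫ h = h := Vs.a_ai' A B D h
theorem vai_va' (A B D : Form P) {Z} (h : _ ⟶ Z) : vai A B D ≫ va A B D ≫ h = h := Vs.ai_a' A B D h
theorem vc_vc' (A B : Form P) {Z} (h : _ ⟶ Z) : vc A B ≫ vc B A ≫ h = h := Vs.c_c' A B h
instance dj_iso {A A' B B' : Form P} (f : A ⟶ A') (g : B ⟶ B') [IsIso f] [IsIso g] : IsIso (f ⟇ g) := Vs.m_iso f g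
instance va_iso (A B C : Form P) : IsIso (va A B C) := Vs.a_iso A B C
instance vai_iso (A B C : Form P) : IsIso (vai A B C) := Vs.ai_iso A B C
instance vc_iso (A B : Form P) : IsIso (vc A B) := Vs.c_iso A B

theorem cj_id (A B : Form P) : (𝟙 A) ⟑ (𝟙 B) = 𝟙 (A ⋏ B) := Ws.m_id A B
theorem cj_comp {A A' A'' B B' B'' : Form P} (f : A ⟶ A') (f' : A' ⟶ A'') (g : B ⟶ B') (g' : B' ⟶ B'') :
    (f ≫ f') ⟑ (g ≫ g') = f ⟑ g ≫ f' ⟑ g' := Ws.m_comp f f' g g'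
theorem cj_comp1 {A A' A'' B : Form P} (f : A ⟶ A') (f' : A' ⟶ A'') :
    (f ≫ f') ⟑ 𝟙 B = f ⟑ 𝟙 B ≫ f' ⟑ 𝟙 B := Ws.m_comp_id f f'
theorem cj_comp2 {A A' A'' B : Form P} (f : A ⟶ A') (f' : A' ⟶ A'') :
    𝟙 B ⟑ (f ≫ f') = 𝟙 B ⟑ f ≫ 𝟙 B ⟑ f' := Ws.m_id_comp f f'
theorem cj_exch {A A' B B' : Form P} (f : A ⟶ A') (g : B ⟶ B') :
    f ⟑ 𝟙 B ≫ 𝟙 A' ⟑ g = 𝟙 A ⟑ g ≫ f ⟑ 𝟙 B' := Ws.m_exch f g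
theorem cj_split {A A' B B' : Form P} (f : A ⟶ A') (g : B ⟶ B') :
    f ⟑ g = f ⟑ 𝟙 B ≫ 𝟙 A' ⟑ g := by rw [← cj_comp, Category.comp_id, Category.id_comp]
theorem wa_nat {A A' B B' D D' : Form P} (f : A ⟶ A') (g : B ⟶ B') (h : D ⟶ D') :
    (f ⟑ g) ⟑ h ≫ wa A' B' D' = wa A B D ≫ f ⟑ (g ⟑ h) := Ws.a_nat f g h
theorem wai_nat {A A' B B' D D' : Form P} (f : A ⟶ A') (g : B ⟶ B') (h : D ⟶ D') :
    f ⟑ (g ⟑ h) ≫ wai A' B' D' = wai A B D ≫ (f ⟑ g) ⟑ h := Ws.ai_nat f g h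
theorem wc_nat {A A' B B' : Form P} (f : A ⟶ A') (g : B ⟶ B') :
    f ⟑ g ≫ wc A' B' = wc A B ≫ g ⟑ f := Ws.c_nat f g
theorem wa_wai (A B D : Form P) : wa A B D ≫ wai A B D = 𝟙 _ := Ws.a_ai A B D
theorem wai_wa (A B D : Form P) : wai A B D ≫ wa A B D = 𝟙 _ := Ws.ai_a A B D
theorem wc_wc (A B : Form P) : wc A B ≫ wc B A = 𝟙 _ := Ws.c_c A B
theorem wa_wai' (A B D : Form P) {Z} (h : _ ⟶ Z) : wa A B D ≫ wai A B D ≫ h = h := Ws.a_ai' A B D h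
theorem wai_wa' (A B D : Form P) {Z} (h : _ ⟶ Z) : wai A B D ≫ wa A B D ≫ h = h := Ws.ai_a' A B D h
theorem wc_wc' (A B : Form P) {Z} (h : _ ⟶ Z) : wc A B ≫ wc B A ≫ h = h := Ws.c_c' A B h
instance cj_iso {A A' B B' : Form P} (f : A ⟶ A') (g : B ⟶ B') [IsIso f] [IsIso g] : IsIso (f ⟑ g) := Ws.m_iso f g
instance wa_iso (A B C : Form P) : IsIso (wa A B C) := Ws.a_iso A B C
instance wai_iso (A B C : Form P) : IsIso (wai A B C) := Ws.ai_iso A B C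
instance wc_iso (A B : Form P) : IsIso (wc A B) := Ws.c_iso A B


theorem dd_nat {A A' B B' D D' : Form P} (f : A ⟶ A') (g : B ⟶ B') (h : D ⟶ D') :
    f ⟑ (g ⟇ h) ≫ dd A' B' D' = dd A B D ≫ (f ⟑ g) ⟇ h := by
  induction f using ar_ind; induction g using ar_ind; induction h using ar_ind
  exact ar_eq (.symm (.dNat _ _ _))

theorem dd_conj (A B C D : Form P) : dd (A ⋏ B) C D ≫ wa A B C ⟇ 𝟙 D =
    wa A B (C ⋎ D) ≫ 𝟙 A ⟑ dd B C D ≫ dd A (B ⋏ C) D := by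
  have := ar_eq (.dConj A B C D)
  simp only [ar_comp, ar_cj, ar_dj, ar_id, Category.assoc] at this
  exact this

theorem dd_disj (D C B A : Form P) : 𝟙 D ⟑ va C B A ≫ dd D C (B ⋎ A) =
    dd D (C ⋎ B) A ≫ dd D C B ⟇ 𝟙 A ≫ va (D ⋏ C) B A := by
  have := ar_eq (.dDisj D C B A)
  simp only [ar_comp, ar_cj, ar_dj, ar_id, Category.assoc] at this
  exact this

/-- mirrored dissociativity -/
def dr (A C S : Form P) : (A ⋎ C) ⋏ S ⟶ (A ⋏ S) ⋎ C := wc _ _ ≫ dd S A C ≫ wc S A ⟇ 𝟙 C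

def sw (Z C D : Form P) : (Z ⋎ C) ⋎ D ⟶ (Z ⋎ D) ⋎ C := va Z C D ≫ 𝟙 Z ⟇ vc C D ≫ vai Z D C

theorem sw_ac (Z C D : Form P) : Vs.AC (sw Z C D) :=
  .comp (.a _ _ _) (.comp (.m (.id _) (.c _ _)) (.ai _ _ _))

theorem dr_nat {A A' C C' S S' : Form P} (f : A ⟶ A') (g : C ⟶ C') (h : S ⟶ S') :
    (f ⟇ g) ⟑ h ≫ dr A' C' S' = dr A C S ≫ (f ⟑ h) ⟇ g := by
  unfold dr
  simp only [Category.assoc]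
  rw [← Category.assoc, wc_nat, Category.assoc, ← Category.assoc (h ⟑ _), dd_nat, Category.assoc,
    ← dj_comp, ← dj_comp, wc_nat, Category.comp_id, Category.id_comp]

theorem ar_dR (C B A : Form P) : ar (dR C B A) = vc C B ⟑ 𝟙 A ≫ dr B C A ≫ vc (B ⋏ A) C := by
  unfold dR dr
  simp only [ar_comp, ar_cj, ar_dj, ar_id, Category.assoc]
  change wc (C ⋎ B) A ≫ 𝟙 A ⟑ vc C B ≫ dd A B C ≫ wc A B ⟇ 𝟙 C ≫ vc (B ⋏ A) C = _
  rw [← Category.assoc (wc _ _), ← wc_nat, Category.assoc]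

theorem E1 (A C B D : Form P) : dr A C (B ⋎ D) ≫ dd A B D ⟇ 𝟙 C =
    dd (A ⋎ C) B D ≫ dr A C B ⟇ 𝟙 D ≫ sw (A ⋏ B) C D := by
  have h := ar_eq (.dBDisj C A B D)
  simp only [ar_comp, ar_dj, ar_id, ar_dR, Category.assoc] at h
  change vc C A ⟑ 𝟙 (B ⋎ D) ≫ dr A C (B ⋎ D) ≫ vc (A ⋏ (B ⋎ D)) C ≫ 𝟙 C ⟇ dd A B D =
    dd (C ⋎ A) B D ≫ (vc C A ⟑ 𝟙 B ≫ dr A C B ≫ vc (A ⋏ B) C) ⟇ 𝟙 D ≫ va C (A ⋏ B) D at h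
  have e : vc (A ⋏ B) C ⟇ 𝟙 D ≫ va C (A ⋏ B) D ≫ vc _ _ = sw (A ⋏ B) C D :=
    Vs.mcoh (SS.rho (A ⋏ B) C D D D D) (.nd (.nd (.lf 0) (.lf 1)) (.lf 2))
      (.nd (.nd (.lf 0) (.lf 2)) (.lf 1)) (by decide) (.comp (.m (.c _ _) (.id _)) (.comp (.a _ _ _) (.c _ _)))
      (.comp (.a _ _ _) (.comp (.m (.id _) (.c _ _)) (.ai _ _ _)))
  have h' := congrArg (fun z => vc A C ⟑ 𝟙 (B ⋎ D) ≫ z ≫ vc _ _) h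
  simp only [Category.assoc] at h'
  rw [vc_nat, vc_vc', ← Category.assoc (vc A C ⟑ _), ← cj_comp, vc_vc, Category.comp_id, cj_id,
    Category.id_comp, ← dj_id, ← Category.assoc (vc A C ⟑ _), dd_nat, Category.assoc,
    ← Category.assoc ((vc A C ⟑ 𝟙 B) ⟇ _), ← dj_comp, ← Category.assoc (vc A C ⟑ _),
    ← cj_comp, vc_vc, Category.comp_id, cj_id, Category.id_comp, Category.comp_id, dj_comp1] at h'
  rw [h', ← e]
  simp only [Category.assoc]
end PNC

open CategoryTheory

namespace PNC
variable {P : Type}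

/-! ## Points -/

@[ext] structure Pt (F : Form P) where
  app : ∀ X : Form P, X ⟶ X ⋏ F
  nat : ∀ {X Y : Form P} (f : X ⟶ Y), f ≫ app Y = app X ≫ f ⟑ 𝟙 F
  bcomp : ∀ X Y, app (X ⋏ Y) ≫ wa X Y F = 𝟙 X ⟑ app Y
  dcomp : ∀ A C, app (A ⋎ C) ≫ dr A C F = app A ⟇ 𝟙 C

namespace Pt

def map {F G : Form P} (e : F ⟶ G) (τ : Pt F) : Pt G where
  app X := τ.app X ≫ 𝟙 X ⟑ e
  nat {X Y} f := by
    rw [Category.assoc, ← cj_exch, ← Category.assoc, τ.nat, Category.assoc]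
  bcomp X Y := by
    rw [Category.assoc, ← cj_id, wa_nat, ← Category.assoc, τ.bcomp, ← cj_comp2]
  dcomp A C := by
    rw [Category.assoc, ← dj_id, dr_nat, ← Category.assoc, τ.dcomp, ← dj_comp1]

theorem map_app {F G : Form P} (e : F ⟶ G) (τ : Pt F) (X : Form P) :
    (map e τ).app X = τ.app X ≫ 𝟙 X ⟑ e := rfl

theorem map_id {F : Form P} (τ : Pt F) : map (𝟙 F) τ = τ := by
  ext X; simp [map_app, cj_id]

theorem map_comp {F G H : Form P} (e : F ⟶ G) (e' : G ⟶ H) (τ : Pt F) :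
    map (e ≫ e') τ = map e' (map e τ) := by
  ext X; simp [map_app, cj_comp2]

theorem map_cancel {F G : Form P} (e : F ⟶ G) (e' : G ⟶ F) (h : e ≫ e' = 𝟙 F) (τ : Pt F) :
    map e' (map e τ) = τ := by rw [← map_comp, h, map_id]

def ax (p : P) : Pt (.natom p ⋎ .pos p) where
  app X := ar (.delta p X)
  nat {X Y} f := by
    induction f using ar_ind
    exact ar_eq (.symm (.deltaNat _ _))
  bcomp X Y := ar_eq (.bDelta X Y p)
  dcomp A C := by
    have h := ar_eq (.dSigmaConj p A C)
    unfold sigmaConj at h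
    simp only [ar_comp, ar_dj, ar_id, Category.assoc] at h
    change ar (.delta p (A ⋎ C)) ≫ wc _ _ ≫ dd _ _ _ = (ar (.delta p A) ≫ wc _ _) ⟇ 𝟙 C at h
    unfold dr
    rw [← Category.assoc (wc _ _), ← Category.assoc, h, ← dj_comp1, Category.assoc, wc_wc,
      Category.comp_id]

end Pt

abbrev pl (K : Option (Form P)) (y : Form P) : Form P := Vs.plug K y
abbrev plm (K : Option (Form P)) {y z : Form P} (f : y ⟶ z) : pl K y ⟶ pl K z := Vs.plugMap K f

theorem plm_comp (K : Option (Form P)) {y z w : Form P} (f : y ⟶ z) (g : z ⟶ w) :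
    plm K (f ≫ g) = plm K f ≫ plm K g := Vs.plugMap_comp K f g
theorem plm_id (K : Option (Form P)) (y : Form P) : plm K (𝟙 y) = 𝟙 _ := Vs.plugMap_id K y

def strL : ∀ (L : Option (Form P)) (X B : Form P), X ⋏ pl L B ⟶ pl L (X ⋏ B)
  | none, _, _ => 𝟙 _
  | some D, X, B => dd X B D
def strR : ∀ (K : Option (Form P)) (A Y : Form P), pl K A ⋏ Y ⟶ pl K (A ⋏ Y)
  | none, _, _ => 𝟙 _
  | some C, A, Y => dr A C Y
def sw2 : ∀ (L K : Option (Form P)) (z : Form P), pl L (pl K z) ⟶ pl K (pl L z)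
  | none, _, _ => 𝟙 _
  | some _, none, _ => 𝟙 _
  | some D, some C, z => sw z C D

theorem sw2_ac (L K : Option (Form P)) (z : Form P) : Vs.AC (sw2 L K z) := by
  cases L <;> cases K
  · exact .id _
  · exact .id _
  · exact .id _
  · exact sw_ac _ _ _

theorem sw_nat {Z Z' : Form P} (f : Z ⟶ Z') (C D : Form P) :
    (f ⟇ 𝟙 C) ⟇ 𝟙 D ≫ sw Z' C D = sw Z C D ≫ (f ⟇ 𝟙 D) ⟇ 𝟙 C := by
  unfold sw
  rw [as2 (va_nat _ _ _), as1 (dj_comp _ _ _ _).symm, vc_nat]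
  simp only [Category.assoc, Category.comp_id]
  rw [← vai_nat, as1 (dj_comp _ _ _ _).symm, Category.id_comp]

theorem sw2_nat (L K : Option (Form P)) {z z' : Form P} (f : z ⟶ z') :
    plm L (plm K f) ≫ sw2 L K z' = sw2 L K z ≫ plm K (plm L f) := by
  cases L <;> cases K <;> simp only [plm, SS.plugMap, sw2, Category.id_comp, Category.comp_id]
  exact sw_nat _ _ _

theorem sw_sw (Z C D : Form P) : sw Z C D ≫ sw Z D C = 𝟙 _ :=
  Vs.mcoh (SS.rho Z C D D D D) (.nd (.nd (.lf 0) (.lf 1)) (.lf 2)) (.nd (.nd (.lf 0) (.lf 1)) (.lf 2))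
    (by decide)
    (.comp (.comp (.a _ _ _) (.comp (.m (.id _) (.c _ _)) (.ai _ _ _)))
      (.comp (.a _ _ _) (.comp (.m (.id _) (.c _ _)) (.ai _ _ _)))) (.id _)

theorem sw2_sw2 (L K : Option (Form P)) (z : Form P) : sw2 L K z ≫ sw2 K L z = 𝟙 _ := by
  cases L <;> cases K <;> simp only [sw2, Category.id_comp]
  exact sw_sw _ _ _

theorem strL_nat (L : Option (Form P)) {X X' B B' : Form P} (f : X ⟶ X') (g : B ⟶ B') :
    f ⟑ plm L g ≫ strL L X' B' = strL L X B ≫ plm L (f ⟑ g) := by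
  cases L with
  | none => simp [strL, SS.plugMap]
  | some D => exact dd_nat _ _ _

theorem strR_nat (L : Option (Form P)) {X X' B B' : Form P} (f : X ⟶ X') (g : B ⟶ B') :
    plm L f ⟑ g ≫ strR L X' B' = strR L X B ≫ plm L (f ⟑ g) := by
  cases L with
  | none => simp [strR, SS.plugMap]
  | some D => exact dr_nat _ _ _

/-- context transformations -/
structure LK (L L' : Option (Form P)) (κ : ∀ y, pl L y ⟶ pl L' y) : Prop where
  nat : ∀ {y z : Form P} (f : y ⟶ z), plm L f ≫ κ z = κ y ≫ plm L' f
  str : ∀ X B, 𝟙 X ⟑ κ B ≫ strL L' X B = strL L X B ≫ κ (X ⋏ B)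

theorem LK.id (L : Option (Form P)) : LK L L (fun _ => 𝟙 _) :=
  ⟨fun f => by simp, fun X B => by simp [cj_id]⟩

theorem LK.some {D D' : Form P} (l : D ⟶ D') : LK (some D) (some D') (fun y => 𝟙 y ⟇ l) :=
  ⟨fun f => dj_exch _ _, fun X B => by
    have := dd_nat (𝟙 X) (𝟙 B) l
    rw [cj_id] at this
    exact this⟩

theorem LK.oac {L L' : Option (Form P)} {κ} (h : Vs.OAC L L' κ) : LK L L' κ := by
  cases h with
  | none => exact LK.id _
  | some h => exact LK.some _

def phi (L : Option (Form P)) (B : Form P) (σ : Pt (pl L B)) (X : Form P) : X ⟶ pl L (X ⋏ B) :=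
  σ.app X ≫ strL L X B

def psi (K : Option (Form P)) (A : Form P) (τ : Pt (pl K A)) (X : Form P) : X ⟶ pl K (A ⋏ X) :=
  phi K A τ X ≫ plm K (wc X A)

theorem phi_nat (L : Option (Form P)) (B : Form P) (σ : Pt (pl L B)) {X Y : Form P} (f : X ⟶ Y) :
    f ≫ phi L B σ Y = phi L B σ X ≫ plm L (f ⟑ 𝟙 B) := by
  unfold phi
  rw [← Category.assoc, σ.nat, Category.assoc, Category.assoc, ← strL_nat, plm_id]

theorem psi_nat (L : Option (Form P)) (B : Form P) (σ : Pt (pl L B)) {X Y : Form P} (f : X ⟶ Y) :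
    f ≫ psi L B σ Y = psi L B σ X ≫ plm L (𝟙 B ⟑ f) := by
  unfold psi
  rw [← Category.assoc, phi_nat, Category.assoc, Category.assoc, ← plm_comp, ← plm_comp, wc_nat]

theorem phi_map (L : Option (Form P)) {B B' : Form P} (g : B ⟶ B') (σ : Pt (pl L B)) (X : Form P) :
    phi L B' (σ.map (plm L g)) X = phi L B σ X ≫ plm L (𝟙 X ⟑ g) := by
  unfold phi
  rw [Pt.map_app, Category.assoc, strL_nat, Category.assoc]

theorem psi_map (L : Option (Form P)) {B B' : Form P} (g : B ⟶ B') (σ : Pt (pl L B)) (X : Form P) :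
    psi L B' (σ.map (plm L g)) X = psi L B σ X ≫ plm L (g ⟑ 𝟙 X) := by
  unfold psi
  rw [phi_map, Category.assoc, Category.assoc, ← plm_comp, ← plm_comp, wc_nat]

theorem phi_LK {L L' : Option (Form P)} {κ} (h : LK L L' κ) (B : Form P) (σ : Pt (pl L B)) (X : Form P) :
    phi L' B (σ.map (κ B)) X = phi L B σ X ≫ κ (X ⋏ B) := by
  unfold phi
  rw [Pt.map_app, Category.assoc, h.str, Category.assoc]

theorem psi_LK {L L' : Option (Form P)} {κ} (h : LK L L' κ) (B : Form P) (σ : Pt (pl L B)) (X : Form P) :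
    psi L' B (σ.map (κ B)) X = psi L B σ X ≫ κ (B ⋏ X) := by
  unfold psi
  rw [phi_LK h, Category.assoc, Category.assoc, h.nat]

theorem phi_or (K L : Option (Form P)) (A B : Form P) (σ : Pt (pl L B)) :
    plm K (phi L B σ A) = phi L B σ (pl K A) ≫ plm L (strR K A B) ≫ sw2 L K (A ⋏ B) := by
  cases K with
  | none => cases L <;> simp [SS.plugMap, strR, sw2]
  | some C =>
    unfold phi
    simp only [SS.plugMap, Category.assoc]
    rw [dj_comp1, ← σ.dcomp, Category.assoc]
    congr 1
    cases L with
    | none => simp [strL, strR, sw2, dj_id, SS.plugMap]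
    | some D => exact E1 _ _ _ _

theorem phi_and (L : Option (Form P)) (X Y B : Form P) (σ : Pt (pl L B)) :
    phi L B σ (X ⋏ Y) ≫ plm L (wa X Y B) = 𝟙 X ⟑ phi L B σ Y ≫ strL L X (Y ⋏ B) := by
  unfold phi
  rw [cj_comp2, ← σ.bcomp, Category.assoc, Category.assoc, Category.assoc]
  congr 1
  cases L with
  | none => simp [strL, SS.plugMap, cj_id]
  | some D => exact dd_conj _ _ _ _

theorem strR_eq (K : Option (Form P)) (A Y : Form P) :
    strR K A Y = wc _ _ ≫ strL K Y A ≫ plm K (wc Y A) := by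
  cases K with
  | none => simp [strR, strL, SS.plugMap, wc_wc]
  | some C => rfl

theorem psi_eq (K : Option (Form P)) (A : Form P) (τ : Pt (pl K A)) (X : Form P) :
    psi K A τ X = τ.app X ≫ wc _ _ ≫ strR K A X := by
  rw [strR_eq, wc_wc']; unfold psi phi; rw [Category.assoc]

def tens (K : Option (Form P)) (A : Form P) (L : Option (Form P)) (B : Form P) (τ : Pt (pl K A)) (σ : Pt (pl L B)) :
    Pt (pl K (pl L (A ⋏ B))) := τ.map (plm K (phi L B σ A))

theorem pt_side {F : Form P} (τ : Pt F) (X S : Form P) :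
    τ.app X ⟑ 𝟙 S ≫ wa X F S = 𝟙 X ⟑ (τ.app S ≫ wc S F) := by
  have h1 : τ.app X ⟑ 𝟙 S = wc X S ≫ 𝟙 S ⟑ τ.app X ≫ wc S (X ⋏ F) := by
    rw [wc_nat, wc_wc']
  have e : wc X S ⟑ 𝟙 F ≫ wa S X F ≫ wc S (X ⋏ F) ≫ wa X F S = wa X S F ≫ 𝟙 X ⟑ wc S F :=
    Ws.mcoh (SS.rho X S F F F F) (.nd (.nd (.lf 0) (.lf 1)) (.lf 2)) (.nd (.lf 0) (.nd (.lf 2) (.lf 1)))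
      (by decide) (.comp (.m (.c _ _) (.id _)) (.comp (.a _ _ _) (.comp (.c _ _) (.a _ _ _))))
      (.comp (.a _ _ _) (.m (.id _) (.c _ _)))
  rw [h1, ← τ.bcomp, cj_comp2, ← τ.bcomp]
  simp only [Category.assoc]
  rw [← e, as2 (τ.nat _)]

theorem pt_strL {F : Form P} (τ : Pt F) (L : Option (Form P)) (B : Form P) :
    τ.app (pl L B) ≫ wc _ _ ≫ strL L F B = plm L (τ.app B ≫ wc B F) := by
  cases L with
  | none => simp [strL, SS.plugMap]
  | some D =>
    simp only [strL, SS.plugMap, dj_comp1]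
    rw [← τ.dcomp]
    unfold dr
    simp only [Category.assoc]
    rw [← dj_comp1, wc_wc, dj_id, Category.comp_id]

theorem tens_symm (K L : Option (Form P)) (A B : Form P) (τ : Pt (pl K A)) (σ : Pt (pl L B)) :
    tens K A L B τ σ = (σ.map (plm L (psi K A τ B))).map (sw2 L K _) := by
  ext X
  unfold tens
  rw [Pt.map_app, phi_or, ← Pt.map_comp, Pt.map_app, psi_eq]
  rw [← Category.assoc (τ.app B), plm_comp, Category.assoc, cj_comp2, cj_comp2 (plm L (τ.app B ≫ wc _ _))]
  rw [← Category.assoc, ← Category.assoc]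
  congr 1
  unfold phi
  rw [cj_comp2, ← σ.bcomp]
  simp only [Category.assoc]
  rw [as2 (σ.nat (τ.app X)), as1 (pt_side τ X _), ← cj_comp2, Category.assoc, pt_strL]

end PNC

open CategoryTheory

namespace PNC
variable {P : Type}

/-! ## Leaves and literals -/

theorem vfree : (Vs (P := P)).Free := ⟨fun {A B A' B'} h => by
  have h' : A ⋎ B = A' ⋎ B' := h
  injection h' with h1 h2
  exact ⟨h1, h2⟩⟩

def flv : Form P → Multiset (Form P)
  | .disj A B => flv A + flv B
  | .conj A B => {.conj A B}
  | .pos p => {.pos p}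
  | .natom p => {.natom p}

def FL : (Vs (P := P)).Lv where
  lv := flv
  lv_t _ _ := rfl
  lv_atom x hx := by
    cases x with
    | disj A B => exact absurd rfl (hx A B)
    | _ => rfl
  ind Q h1 h2 x := by
    induction x with
    | disj A B ha hb => exact h2 A B ha hb
    | _ => exact h1 _ (fun A B h => by cases h)

theorem atom_conj (A B : Form P) : Vs.IsAtom (A ⋏ B) := fun _ _ h => by cases h
theorem atom_pos (p : P) : Vs.IsAtom (Form.pos p) := fun _ _ h => by cases h
theorem atom_natom (p : P) : Vs.IsAtom (Form.natom p) := fun _ _ h => by cases h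

def lits : Form P → Multiset (Bool × P)
  | .disj A B => lits A + lits B
  | .conj A B => lits A + lits B
  | .pos p => {(true, p)}
  | .natom p => {(false, p)}

theorem AC.lits {F G : Form P} {e : F ⟶ G} (h : Vs.AC e) : lits F = lits G := by
  induction h with
  | a A B D => exact add_assoc _ _ _
  | ai A B D => exact (add_assoc _ _ _).symm
  | c A B => exact add_comm _ _
  | id A => rfl
  | m _ _ h1 h2 => exact congrArg₂ (· + ·) h1 h2
  | comp _ _ h1 h2 => exact h1.trans h2

theorem plm_ac (K : Option (Form P)) {y z : Form P} {f : y ⟶ z} (h : Vs.AC f) : Vs.AC (plm K f) := by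
  cases K with
  | none => exact h
  | some M => exact .m h (.id _)

/-! ## Cut-free points -/

inductive CF : ∀ {F : Form P}, Pt F → Prop
  | ax (p : P) : CF (Pt.ax p)
  | iso {F G : Form P} {e : F ⟶ G} (h : Vs.AC e) {τ : Pt F} : CF τ → CF (τ.map e)
  | tens (K : Option (Form P)) (A : Form P) (L : Option (Form P)) (B : Form P) {a : Pt (pl K A)}
      {b : Pt (pl L B)} : CF a → CF b → CF (tens K A L B a b)

def olits : Option (Form P) → Multiset (Bool × P)
  | none => 0
  | some M => lits M

theorem lits_pl (K : Option (Form P)) (y : Form P) : lits (pl K y) = lits y + olits K := by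
  cases K <;> simp [olits, lits]

theorem CF.balance {F : Form P} {τ : Pt F} (h : CF τ) : ∀ b v, (b, v) ∈ lits F → (!b, v) ∈ lits F := by
  induction h with
  | ax p => intro b v; cases b <;> simp [lits]
  | iso h _ ih => intro b v; rw [← AC.lits h]; exact ih b v
  | tens K A L B _ _ ih1 ih2 =>
    intro b v
    have h1 := ih1 b v
    have h2 := ih2 b v
    simp only [lits_pl, lits, Multiset.mem_add] at *
    tauto

theorem tens_K {K K' : Option (Form P)} {κ} (h : LK K K' κ) (L : Option (Form P)) (A B : Form P)
    (a : Pt (pl K A)) (b : Pt (pl L B)) :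
    (tens K A L B a b).map (κ _) = tens K' A L B (a.map (κ A)) b := by
  unfold tens
  rw [← Pt.map_comp, ← Pt.map_comp, h.nat]

theorem tens_L {L L' : Option (Form P)} {κ} (h : LK L L' κ) (K : Option (Form P)) (A B : Form P)
    (a : Pt (pl K A)) (b : Pt (pl L B)) :
    (tens K A L B a b).map (plm K (κ _)) = tens K A L' B a (b.map (κ B)) := by
  unfold tens
  rw [← Pt.map_comp, ← plm_comp, phi_LK h]

theorem tens_maps (K L : Option (Form P)) {A B A' B' : Form P} (f : A ⟶ A') (g : B ⟶ B')
    (a : Pt (pl K A)) (b : Pt (pl L B)) :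
    (tens K A L B a b).map (plm K (plm L (f ⟑ g))) = tens K A' L B' (a.map (plm K f)) (b.map (plm L g)) := by
  unfold tens
  rw [← Pt.map_comp, ← Pt.map_comp, ← plm_comp, ← plm_comp, phi_nat, phi_map, Category.assoc,
    ← plm_comp, ← cj_comp, Category.id_comp, Category.comp_id]

/-! ## Localisation of a leaf -/

@[reducible] def plV : Option (Form P) → SS.VC (Form P) → SS.VC (Form P)
  | none, V => V
  | some M, V => .left V M

theorem tr1 {x F : Form P} (hx : Vs.IsAtom x) {K : Option (Form P)} {e : F ⟶ pl K x} (h : Vs.AC e) :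
    ∃ (V : SS.VC (Form P)) (hF : F = Vs.fill V x) (κ : _), Vs.OAC (Vs.del V) K κ ∧
      e = eqToHom hF ≫ Vs.ext V x ≫ κ x := by
  cases K with
  | none =>
    obtain ⟨V, hF, κ, h1, h2⟩ := SS.trace Vs vfree hx h .hole rfl
    refine ⟨V, hF, κ, h1, ?_⟩
    rw [← h2]; simp [SS.ext]
  | some M =>
    obtain ⟨V, hF, κ, h1, h2⟩ := SS.trace Vs vfree hx h (.left .hole M) rfl
    refine ⟨V, hF, κ, h1, ?_⟩
    rw [← h2]; simp [SS.ext, SS.addIso, dj_id]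

def extp : ∀ (K : Option (Form P)) (V : SS.VC (Form P)) (y : Form P),
    pl K (Vs.fill V y) ⟶ pl (Vs.del (plV K V)) y
  | none, V, y => Vs.ext V y
  | some M, V, y => Vs.ext (.left V M) y

theorem extp_nat (K : Option (Form P)) (V : SS.VC (Form P)) {y z : Form P} (h : y ⟶ z) :
    plm K (Vs.fillMap V h) ≫ extp K V z = extp K V y ≫ plm _ h := by
  cases K with
  | none => exact Vs.ext_nat V h
  | some M => exact Vs.ext_nat (.left V M) h

theorem extp_ac (K : Option (Form P)) (V : SS.VC (Form P)) (y : Form P) : Vs.AC (extp K V y) := by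
  cases K with
  | none => exact Vs.ext_ac V _
  | some M => exact Vs.ext_ac (.left V M) _

@[reducible] def jn : Option (Form P) → Option (Form P) → Option (Form P)
  | none, L => L
  | some C, none => some C
  | some C, some D => some (D ⋎ C)

def jiso : ∀ (K L : Option (Form P)) (z : Form P), pl K (pl L z) ⟶ pl (jn K L) z
  | none, _, _ => 𝟙 _
  | some _, none, _ => 𝟙 _
  | some C, some D, z => va z D C

theorem jiso_ac (K L : Option (Form P)) (z : Form P) : Vs.AC (jiso K L z) := by
  cases K <;> cases L
  · exact .id _
  · exact .id _
  · exact .id _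
  · exact .a _ _ _

theorem jiso_nat (K L : Option (Form P)) {y z : Form P} (h : y ⟶ z) :
    plm K (plm L h) ≫ jiso K L z = jiso K L y ≫ plm _ h := by
  cases K <;> cases L <;> simp only [plm, SS.plugMap, jiso, Category.id_comp, Category.comp_id]
  rw [va_nat, dj_id]

theorem phi_jiso (K L : Option (Form P)) (z : Form P) (s : Pt (pl K (pl L z))) (X : Form P) :
    phi (jn K L) z (s.map (jiso K L z)) X =
      phi K (pl L z) s X ≫ plm K (strL L X z) ≫ jiso K L (X ⋏ z) := by
  unfold phi
  rw [Pt.map_app, Category.assoc, Category.assoc]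
  congr 1
  cases K <;> cases L <;> simp only [plm, SS.plugMap, jiso, strL, Category.id_comp, Category.comp_id, cj_id, dj_id]
  exact dd_disj _ _ _ _

theorem tens_loc {x : Form P} (hx : Vs.IsAtom x)
    (Q : ∀ (x : Form P) (K1 L1 : Option (Form P)) (A B : Form P) (K : Option (Form P)),
      (pl K1 (pl L1 (A ⋏ B)) ⟶ pl K x) → Prop)
    (h1 : ∀ V1 L1 A B K κ, Vs.OAC (Vs.del (.right (pl L1 (A ⋏ B)) V1)) K κ →
      Q x (some (Vs.fill V1 x)) L1 A B K (Vs.ext (.right (pl L1 (A ⋏ B)) V1) x ≫ κ x))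
    (h2 : ∀ K1 V1 A B K κ, Vs.OAC (Vs.del (plV K1 (.right (A ⋏ B) V1))) K κ →
      Q x K1 (some (Vs.fill V1 x)) A B K (extp K1 (.right (A ⋏ B) V1) x ≫ κ x))
    (h3 : ∀ K1 L1 A B, x = A ⋏ B → ∀ K κ, Vs.OAC (jn K1 L1) K κ →
      Q (A ⋏ B) K1 L1 A B K (jiso K1 L1 (A ⋏ B) ≫ κ (A ⋏ B)))
    {K1 L1 : Option (Form P)} {A B : Form P} {K : Option (Form P)}
    {e : pl K1 (pl L1 (A ⋏ B)) ⟶ pl K x} (h : Vs.AC e) : Q x K1 L1 A B K e := by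
  obtain ⟨V, hF, κ, hκ, rfl⟩ := tr1 hx h
  have key2 : ∀ (V : SS.VC (Form P)) (hV : pl L1 (A ⋏ B) = Vs.fill V x) (K κ)
      (_ : Vs.OAC (Vs.del (plV K1 V)) K κ) (hF : pl K1 (pl L1 (A ⋏ B)) = Vs.fill (plV K1 V) x),
      Q x K1 L1 A B K (eqToHom hF ≫ Vs.ext (plV K1 V) x ≫ κ x) := by
    intro V hV K κ hκ hF
    cases V with
    | hole =>
      cases L1 with
      | none =>
        have hV' : A ⋏ B = x := hV
        subst hV'
        cases K1 with
        | none =>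
          rw [eqToHom_refl, Category.id_comp]
          exact h3 none none A B rfl K κ hκ
        | some C =>
          rw [eqToHom_refl, Category.id_comp]
          have := h3 (some C) none A B rfl K κ hκ
          simp only [SS.ext, SS.addIso, jiso, dj_id, Category.comp_id] at this ⊢
          exact this
      | some D => exact absurd hV.symm (hx _ _)
    | left V1 M =>
      cases L1 with
      | none => cases hV
      | some D =>
        injection hV with e1 e2
        subst e2
        cases V1 with
        | hole =>
          have e1' : A ⋏ B = x := e1
          subst e1'
          cases K1 with
          | none =>
            rw [eqToHom_refl, Category.id_comp]
            have := h3 none (some D) A B rfl K κ hκ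
            simp only [SS.ext, SS.addIso, jiso, dj_id, Category.comp_id] at this ⊢
            exact this
          | some C =>
            rw [eqToHom_refl, Category.id_comp]
            have := h3 (some C) (some D) A B rfl K κ hκ
            simp only [SS.ext, SS.addIso, jiso, dj_id, Category.comp_id, Category.id_comp] at this ⊢
            exact this
        | _ => cases e1
    | right M V1 =>
      cases L1 with
      | none => cases hV
      | some D =>
        injection hV with e1 e2
        subst e1 e2
        cases K1 with
        | none =>
          rw [eqToHom_refl, Category.id_comp]
          exact h2 none V1 A B K κ hκ
        | some C =>
          rw [eqToHom_refl, Category.id_comp]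
          exact h2 (some C) V1 A B K κ hκ
  cases K1 with
  | none => exact key2 V hF K κ hκ hF
  | some C =>
    cases V with
    | hole => exact absurd hF.symm (hx _ _)
    | left V1 M =>
      injection hF with e1 e2
      subst e2
      exact key2 V1 e1 K κ hκ hF
    | right M V1 =>
      injection hF with e1 e2
      subst e1 e2
      rw [eqToHom_refl, Category.id_comp]
      exact h1 V1 L1 A B K κ hκ

end PNC

open CategoryTheory

namespace PNC
variable {P : Type}

theorem CF.post {F G H : Form P} {τ : Pt F} {f : F ⟶ G} {e : G ⟶ H} (he : Vs.AC e)
    (h : CF (τ.map (f ≫ e))) : CF (τ.map f) := by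
  obtain ⟨e', h0, h1, h2⟩ := he.inv_ex
  have := CF.iso h0 h
  rwa [← Pt.map_comp, Category.assoc, h1, Category.comp_id] at this

theorem CF.post' {F G H : Form P} {τ : Pt F} {f : F ⟶ G} {e : G ⟶ H} (he : Vs.AC e)
    (h : CF (τ.map f)) : CF (τ.map (f ≫ e)) := by
  rw [Pt.map_comp]; exact .iso he h

theorem hlem {x y : Form P} (hx : Vs.IsAtom x) (h : x ⟶ y)
    (hax : ∀ q K (e : Form.natom q ⋎ Form.pos q ⟶ pl K x), Vs.AC e → CF ((Pt.ax q).map (e ≫ plm K h)))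
    (hten : ∀ A B (hh : x = A ⋏ B) K L (a : Pt (pl K A)) (b : Pt (pl L B)), CF a → CF b →
      CF ((tens K A L B a b).map (plm K (plm L (eqToHom hh.symm ≫ h)))))
    {F : Form P} {τ : Pt F} (hτ : CF τ) : ∀ (K) (e : F ⟶ pl K x), Vs.AC e → CF (τ.map (e ≫ plm K h)) := by
  induction hτ with
  | ax p => exact hax p
  | iso h0 _ ih =>
    intro K e he
    rw [← Pt.map_comp, ← Category.assoc]
    exact ih K _ (h0.comp he)
  | @tens K1 A L1 B a b ha hb iha ihb =>
    intro K e he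
    have hf : ∀ {G : Form P} {τ : Pt G} (V : SS.VC (Form P)) (hG : G = Vs.fill V x),
        (∀ (K) (e : G ⟶ pl K x), Vs.AC e → CF (τ.map (e ≫ plm K h))) →
        CF (τ.map (eqToHom hG ≫ Vs.fillMap V h)) := by
      intro G τ V hG H
      subst hG
      rw [eqToHom_refl, Category.id_comp]
      apply CF.post (Vs.ext_ac V y)
      rw [Vs.ext_nat]
      exact H _ _ (Vs.ext_ac V x)
    refine tens_loc hx (fun x K1 L1 A B K e => ∀ (h : x ⟶ y)
      (_ : ∀ A B (hh : x = A ⋏ B) K L (a : Pt (pl K A)) (b : Pt (pl L B)), CF a → CF b →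
      CF ((tens K A L B a b).map (plm K (plm L (eqToHom hh.symm ≫ h)))))
      (a : Pt (pl K1 A)) (b : Pt (pl L1 B)) (_ : CF a) (_ : CF b)
      (_ : ∀ {G : Form P} {τ : Pt G} (V : SS.VC (Form P)) (hG : G = Vs.fill V x),
        (∀ (K) (e : G ⟶ pl K x), Vs.AC e → CF (τ.map (e ≫ plm K h))) →
        CF (τ.map (eqToHom hG ≫ Vs.fillMap V h)))
      (_ : ∀ (K) (e : pl K1 A ⟶ pl K x), Vs.AC e → CF (a.map (e ≫ plm K h)))
      (_ : ∀ (K) (e : pl L1 B ⟶ pl K x), Vs.AC e → CF (b.map (e ≫ plm K h))),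
      CF ((tens K1 A L1 B a b).map (e ≫ plm K h))) ?_ ?_ ?_ he h hten a b ha hb hf iha ihb
    · intro V1 L1 A B K κ hκ h hten a b ha hb hf iha ihb
      rw [Category.assoc, ← hκ.nat, ← Category.assoc, ← Vs.ext_nat, Category.assoc]
      apply CF.post' ((Vs.ext_ac _ _).comp (hκ.ac _ _))
      have := hf (.right A V1) rfl iha
      rw [eqToHom_refl, Category.id_comp] at this
      have e := tens_K (LK.some (Vs.fillMap V1 h)) L1 A B a b
      exact e ▸ CF.tens _ _ _ _ this hb
    · intro K1 V1 A B K κ hκ h hten a b ha hb hf iha ihb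
      rw [Category.assoc, ← hκ.nat, ← Category.assoc, ← extp_nat, Category.assoc]
      apply CF.post' ((extp_ac _ _ _).comp (hκ.ac _ _))
      have := hf (.right B V1) rfl ihb
      rw [eqToHom_refl, Category.id_comp] at this
      have e := tens_L (LK.some (Vs.fillMap V1 h)) K1 A B a b
      exact e ▸ CF.tens _ _ _ _ ha this
    · intro K1 L1 A B hxx K κ hκ h hten a b ha hb hf iha ihb
      rw [Category.assoc, ← hκ.nat, ← Category.assoc, ← jiso_nat, Category.assoc]
      apply CF.post' ((jiso_ac _ _ _).comp (hκ.ac _ _))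
      have := hten A B rfl K1 L1 a b ha hb
      rwa [eqToHom_refl, Category.id_comp] at this

/-! ## Closure -/

def Cl {A B : Form P} (f : A ⟶ B) : Prop := ∀ (K) (τ : Pt (pl K A)), CF τ → CF (τ.map (plm K f))

theorem Cl.comp {A B C : Form P} {f : A ⟶ B} {g : B ⟶ C} (hf : Cl f) (hg : Cl g) : Cl (f ≫ g) := by
  intro K τ h
  rw [plm_comp, Pt.map_comp]
  exact hg K _ (hf K _ h)

theorem Cl.ac {A B : Form P} {f : A ⟶ B} (hf : Vs.AC f) : Cl f := fun K _ h => .iso (plm_ac K hf) h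

theorem Cl.dj1 {A B : Form P} {f : A ⟶ B} (hf : Cl f) (C : Form P) : Cl (f ⟇ 𝟙 C) := by
  intro K τ h
  cases K with
  | none => exact hf (some C) τ h
  | some M =>
    apply CF.post (e := va B C M) (.a _ _ _)
    show CF (τ.map ((f ⟇ 𝟙 C) ⟇ 𝟙 M ≫ _))
    rw [va_nat, dj_id, Pt.map_comp]
    exact hf (some (C ⋎ M)) _ (.iso (.a _ _ _) h)

theorem Cl.dj2 {A B : Form P} {f : A ⟶ B} (hf : Cl f) (C : Form P) : Cl (𝟙 C ⟇ f) := by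
  have : 𝟙 C ⟇ f = vc _ _ ≫ f ⟇ 𝟙 C ≫ vc _ _ := by rw [vc_nat, vc_vc']
  rw [this]
  exact (Cl.ac (.c _ _)).comp ((hf.dj1 C).comp (Cl.ac (.c _ _)))

theorem no_ax_conj {q : P} {K : Option (Form P)} {A B : Form P} {e : Form.natom q ⋎ Form.pos q ⟶ pl K (A ⋏ B)}
    (h : Vs.AC e) : False := by
  have := h.lv_eq FL
  rw [FL.lv_plug] at this
  have h2 : A ⋏ B ∈ flv (Form.natom q ⋎ Form.pos q) := by
    change A ⋏ B ∈ FL.lv (Vs.t (Form.natom q) (Form.pos q))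
    rw [this]
    simp [FL, flv]
  simp [flv] at h2

/-- reduction of closure for a conjunction -/
theorem Cl.conj {A B y : Form P} (h : A ⋏ B ⟶ y)
    (H : ∀ K L (a : Pt (pl K A)) (b : Pt (pl L B)), CF a → CF b →
      CF ((tens K A L B a b).map (plm K (plm L h)))) : Cl h := by
  intro K τ hτ
  have := hlem (atom_conj A B) h (fun q K e he => (no_ax_conj he).elim) (fun A' B' hh K L a b ha hb => by
    cases hh
    rw [eqToHom_refl, Category.id_comp]
    exact H K L a b ha hb) hτ K (𝟙 _) (.id _)
  rwa [Category.id_comp] at this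

theorem Cl.cj {A B A' B' : Form P} {f : A ⟶ A'} {g : B ⟶ B'} (hf : Cl f) (hg : Cl g) : Cl (f ⟑ g) :=
  Cl.conj _ fun K L a b ha hb => by
    rw [tens_maps]
    exact .tens _ _ _ _ (hf _ _ ha) (hg _ _ hb)

theorem tens_wc (K L : Option (Form P)) (A B : Form P) (a : Pt (pl K A)) (b : Pt (pl L B)) :
    (tens K A L B a b).map (plm K (plm L (wc A B))) = (tens L B K A b a).map (sw2 L K _) := by
  rw [tens_symm L K B A, ← Pt.map_comp, sw2_sw2, Pt.map_id]
  unfold tens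
  rw [← Pt.map_comp, ← plm_comp]
  rfl

theorem Cl.wc (A B : Form P) : Cl (wc A B) :=
  Cl.conj _ fun K L a b ha hb => by
    rw [tens_wc]
    exact .iso (sw2_ac _ _ _) (.tens _ _ _ _ hb ha)

theorem tens_jiso (K L M : Option (Form P)) (A B : Form P) (a : Pt (pl K A)) (s : Pt (pl L (pl M B))) :
    ((tens K A L (pl M B) a s).map (plm K (plm L (strL M A B)))).map (plm K (jiso L M (A ⋏ B))) =
    tens K A (jn L M) B a (s.map (jiso L M B)) := by
  unfold tens
  rw [← Pt.map_comp, ← Pt.map_comp, ← plm_comp, ← plm_comp, phi_jiso]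

theorem Cl.dd (A B C : Form P) : Cl (dd A B C) :=
  Cl.conj _ fun K L a b ha hb => by
    have := CF.tens K A (jn L (some C)) B ha (.iso (jiso_ac L (some C) B) hb)
    rw [← tens_jiso, ← Pt.map_comp] at this
    exact CF.post (plm_ac _ (jiso_ac _ _ _)) this

theorem Cl.wa (A B C : Form P) : Cl (wa A B C) :=
  Cl.conj _ fun K L a b ha hb => by
    have e : (tens K (A ⋏ B) L C a b).map (plm K (plm L (PNC.wa A B C))) =
        a.map (plm K (𝟙 A ⟑ phi L C b B ≫ strL L A (B ⋏ C))) := by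
      unfold tens
      rw [← Pt.map_comp, ← plm_comp, phi_and]
    rw [e]
    clear e
    revert K a
    change Cl _
    refine Cl.conj _ fun K' L' a1 a2 h1 h2 => ?_
    rw [plm_comp, plm_comp, Pt.map_comp]
    rw [tens_maps, plm_id, Pt.map_id]
    have h3 : CF (a2.map (plm L' (phi L C b B))) := CF.tens L' B L C h2 hb
    have := CF.tens K' A (jn L' L) (B ⋏ C) h1 (.iso (jiso_ac L' L (B ⋏ C)) h3)
    rw [← tens_jiso, ← Pt.map_comp] at this
    exact CF.post (plm_ac _ (jiso_ac _ _ _)) this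

theorem Cl.id (A : Form P) : Cl (𝟙 A) := Cl.ac (.id _)

theorem Cl.wai (A B C : Form P) : Cl (wai A B C) := by
  have e : PNC.wai A B C = PNC.wc A (B ⋏ C) ≫ PNC.wc B C ⟑ 𝟙 A ≫ PNC.wa C B A ≫ 𝟙 C ⟑ PNC.wc B A ≫ PNC.wc C (A ⋏ B) :=
    Ws.mcoh (SS.rho A B C C C C) (.nd (.lf 0) (.nd (.lf 1) (.lf 2))) (.nd (.nd (.lf 0) (.lf 1)) (.lf 2))
      (by decide) (.ai _ _ _)
      (.comp (.c _ _) (.comp (.m (.c _ _) (.id _)) (.comp (.a _ _ _) (.comp (.m (.id _) (.c _ _)) (.c _ _)))))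
  rw [e]
  exact (Cl.wc _ _).comp (((Cl.wc _ _).cj (Cl.id _)).comp ((Cl.wa _ _ _).comp
    (((Cl.id _).cj (Cl.wc _ _)).comp (Cl.wc _ _))))

theorem Cl.delta (p : P) (A : Form P) : Cl (ar (.delta p A)) := by
  intro K τ h
  have := CF.tens K A none (.natom p ⋎ .pos p) h (.ax p)
  unfold tens phi at this
  simp only [strL, Category.comp_id] at this
  exact this

/-! ### Σ -/

def sg (p : P) (M : Form P) : (Form.pos p ⋏ Form.natom p) ⋎ M ⟶ M := ar (.sigma p M)

theorem sg_nat (p : P) {M N : Form P} (k : M ⟶ N) : 𝟙 _ ⟇ k ≫ sg p N = sg p M ≫ k := by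
  induction k using ar_ind
  exact ar_eq (.symm (.sigmaNat _ _))

theorem sg_va (p : P) (B A : Form P) : va _ B A ≫ sg p (B ⋎ A) = sg p B ⟇ 𝟙 A :=
  ar_eq (.bSigma p B A)

theorem sg_dd (p : P) (C B : Form P) : dd C B _ ≫ vc _ _ ≫ sg p (C ⋏ B) = 𝟙 C ⟑ (vc _ _ ≫ sg p B) := by
  have := ar_eq (.dDeltaDisj p C B)
  unfold deltaDisj at this
  simp only [ar_comp, ar_cj, ar_id] at this
  exact this

/-- `m` deletes the hole of `V` -/
def Dl (p : P) (V : SS.VC (Form P)) {R : Form P} (m : Vs.fill V (.pos p ⋏ .natom p) ⟶ R) : Prop :=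
  ∃ M k, ∃ hM : Vs.del V = some M, Vs.AC k ∧
    m = Vs.ext V (.pos p ⋏ .natom p) ≫ eqToHom (by rw [hM]) ≫ sg p M ≫ k

theorem Dl.left {p : P} {V : SS.VC (Form P)} {R : Form P} {m : Vs.fill V (.pos p ⋏ .natom p) ⟶ R}
    (h : Dl p V m) (Q : Form P) : Dl p (.left V Q) (m ⟇ 𝟙 Q) := by
  obtain ⟨M, k, hM, hk, rfl⟩ := h
  have hM' : Vs.del (.left V Q) = some (M ⋎ Q) := by simp only [SS.del, hM]
  refine ⟨M ⋎ Q, k ⟇ 𝟙 Q, hM', .m hk (.id _), ?_⟩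
  have key : ∀ (F Z) (_ : Z = some M) (E : F ⟶ Vs.plug Z (.pos p ⋏ .natom p))
      (h1 : Vs.plug Z (.pos p ⋏ .natom p) = (.pos p ⋏ .natom p) ⋎ M)
      (h2 : Vs.t (.pos p ⋏ .natom p) (Vs.addR Z Q) = (.pos p ⋏ .natom p) ⋎ M ⋎ Q),
      (E ≫ eqToHom h1 ≫ sg p M ≫ k) ⟇ 𝟙 Q =
        (E ⟇ 𝟙 Q ≫ Vs.addIso Z Q (.pos p ⋏ .natom p)) ≫ eqToHom h2 ≫ sg p (M ⋎ Q) ≫ k ⟇ 𝟙 Q := by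
    intro F Z hZ E h1 h2
    subst hZ
    simp only [eqToHom_refl, Category.id_comp, SS.addIso, Category.assoc, dj_comp1]
    rw [as1 (sg_va _ _ _)]
  exact key _ _ hM _ _ _

theorem Dl.ac {p : P} {V : SS.VC (Form P)} {R R' : Form P} {m : Vs.fill V (.pos p ⋏ .natom p) ⟶ R}
    (h : Dl p V m) {l : R ⟶ R'} (hl : Vs.AC l) : Dl p V (m ≫ l) := by
  obtain ⟨M, k, hM, hk, rfl⟩ := h
  exact ⟨M, k ≫ l, hM, hk.comp hl, by simp only [Category.assoc]⟩

theorem Dl.right {p : P} {V : SS.VC (Form P)} {R : Form P} {m : Vs.fill V (.pos p ⋏ .natom p) ⟶ R}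
    (h : Dl p V m) (Q : Form P) : Dl p (.right Q V) (𝟙 Q ⟇ m) := by
  obtain ⟨M, k, hM, hk, e⟩ := (h.left Q).ac (.c _ _)
  refine ⟨M, k, hM, hk, ?_⟩
  have : 𝟙 Q ⟇ m = vc _ _ ≫ m ⟇ 𝟙 Q ≫ vc _ _ := by rw [vc_nat, vc_vc']
  rw [this]
  erw [e]
  simp only [SS.ext, Category.assoc]

theorem Dl.right0 (p : P) (Q : Form P) : Dl p (.right Q .hole) (vc Q _ ≫ sg p Q) :=
  ⟨Q, 𝟙 _, rfl, .id _, by simp [SS.ext, SS.addIso, dj_id]⟩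

theorem Dl.ex (p : P) (V : SS.VC (Form P)) : V = .hole ∨ ∃ M, ∃ m : _ ⟶ M, Dl p V m := by
  cases V with
  | hole => exact .inl rfl
  | left V R => exact .inr ⟨_, _, _, 𝟙 _, rfl, .id _, rfl⟩
  | right R V => exact .inr ⟨_, _, _, 𝟙 _, rfl, .id _, rfl⟩

/-- the context transformation deleting the hole -/
theorem Dl.lk (p : P) (V : SS.VC (Form P)) : ∃ L κ, LK (some (Vs.fill V (.pos p ⋏ .natom p))) L κ ∧
    ∀ y, Dl p (.right y V) (κ y) := by
  rcases Dl.ex p V with rfl | ⟨M, m, hm⟩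
  · refine ⟨none, fun y => vc y _ ≫ sg p y, ⟨fun {y z} f => ?_, fun X B => ?_⟩, fun y => Dl.right0 p y⟩
    · show f ⟇ 𝟙 _ ≫ _ = _
      rw [as2 (vc_nat _ _), sg_nat, Category.assoc]
      rfl
    · simp only [strL, Category.comp_id]
      exact (sg_dd p X B).symm
  · exact ⟨some M, fun y => 𝟙 y ⟇ m, LK.some m, fun y => hm.right y⟩

end PNC

open CategoryTheory

namespace PNC
variable {P : Type}

theorem Dl.use {p : P} {V : SS.VC (Form P)} {R : Form P} {m : Vs.fill V (.pos p ⋏ .natom p) ⟶ R}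
    (h : Dl p V m) {M : Form P} {κ} (hκ : Vs.OAC (Vs.del V) (some M) κ)
    {τ : Pt (Vs.fill V (.pos p ⋏ .natom p))} (hm : CF (τ.map m)) :
    CF (τ.map (Vs.ext V (.pos p ⋏ .natom p) ≫ κ (.pos p ⋏ .natom p) ≫ sg p M)) := by
  obtain ⟨M', k, hM, hk, rfl⟩ := h
  have key : ∀ (F Z) (_ : Z = some M') (E : F ⟶ Vs.plug Z (.pos p ⋏ .natom p))
      (h1 : Vs.plug Z (.pos p ⋏ .natom p) = (.pos p ⋏ .natom p) ⋎ M') (τ : Pt F)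
      (_ : CF (τ.map (E ≫ eqToHom h1 ≫ sg p M' ≫ k))) κ (_ : Vs.OAC Z (some M) κ),
      CF (τ.map (E ≫ κ (.pos p ⋏ .natom p) ≫ sg p M)) := by
    intro F Z hZ E h1 τ hτ κ hκ
    subst hZ
    cases hκ with
    | some hk' =>
      rw [eqToHom_refl, Category.id_comp, ← Category.assoc] at hτ
      have := CF.post' hk' (CF.post hk hτ)
      rw [Category.assoc, ← sg_nat] at this
      exact this
  exact key _ _ hM _ _ _ hm _ hκ

theorem Dl.of {p : P} {V : SS.VC (Form P)} {R : Form P} {m : Vs.fill V (.pos p ⋏ .natom p) ⟶ R}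
    (h : Dl p V m) {τ : Pt (Vs.fill V (.pos p ⋏ .natom p))}
    (H : ∀ M (e : Vs.fill V (.pos p ⋏ .natom p) ⟶ (.pos p ⋏ .natom p) ⋎ M), Vs.AC e → CF (τ.map (e ≫ sg p M))) :
    CF (τ.map m) := by
  obtain ⟨M', k, hM, hk, rfl⟩ := h
  have key : ∀ (F Z) (_ : Z = some M') (E : F ⟶ Vs.plug Z (.pos p ⋏ .natom p)) (_ : Vs.AC E)
      (h1 : Vs.plug Z (.pos p ⋏ .natom p) = (.pos p ⋏ .natom p) ⋎ M') (τ : Pt F)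
      (_ : ∀ M (e : F ⟶ (.pos p ⋏ .natom p) ⋎ M), Vs.AC e → CF (τ.map (e ≫ sg p M))),
      (CF (τ.map (E ≫ eqToHom h1 ≫ sg p M' ≫ k))) := by
    intro F Z hZ E hE h1 τ H
    subst hZ
    rw [eqToHom_refl, Category.id_comp, ← Category.assoc]
    exact CF.post' hk (H _ _ hE)
  exact key _ _ hM _ (Vs.ext_ac _ _) _ _ H

theorem psi_sg (p : P) : psi (some (.natom p)) (.pos p) ((Pt.ax p).map (vc _ _)) (.natom p) ≫ sg p _ = 𝟙 _ := by
  have h := ar_eq (.sigmaDelta' p)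
  unfold sigma' delta' at h
  simp only [ar_comp, ar_cj, ar_dj, ar_id, Category.assoc] at h
  unfold psi phi
  rw [Pt.map_app]
  simp only [Category.assoc]
  exact h

theorem cut_ax (p : P) (D : Form P) (b : Pt (.natom p ⋎ D)) :
    (Pt.ax p).map (vc _ _ ≫ (phi (some D) (.natom p) b (.pos p) ≫ sg p D) ⟇ 𝟙 (.natom p)) = b.map (vc _ _) := by
  have h := tens_symm (some (.natom p)) (some D) (.pos p) (.natom p) ((Pt.ax p).map (vc _ _)) b
  have h' := congrArg (Pt.map (sg p D ⟇ 𝟙 (.natom p))) h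
  unfold tens at h'
  simp only [← Pt.map_comp] at h'
  simp only [SS.plugMap, Category.assoc] at h'
  rw [← dj_comp1] at h'
  rw [h']
  congr 1
  show _ ≫ sw _ _ _ ≫ _ = _
  have e : sw (Form.pos p ⋏ Form.natom p) (Form.natom p) D ≫ sg p D ⟇ 𝟙 (Form.natom p) = sg p (Form.natom p) ⟇ 𝟙 D ≫ vc _ _ := by
    rw [← sg_va, ← sg_va]
    unfold sw
    simp only [Category.assoc]
    rw [vai_va', sg_nat]
  rw [e, ← Category.assoc, ← dj_comp1, psi_sg, dj_id, Category.id_comp]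

theorem not_CF_pos {p : P} {τ : Pt (Form.pos p)} (h : CF τ) : False := by
  have := h.balance true p (by simp [lits])
  simp [lits] at this
theorem not_CF_natom {p : P} {τ : Pt (Form.natom p)} (h : CF τ) : False := by
  have := h.balance false p (by simp [lits])
  simp [lits] at this

theorem ax_pos {q p : P} {K : Option (Form P)} {e : Form.natom q ⋎ Form.pos q ⟶ pl K (.pos p)} (h : Vs.AC e) :
    ∃ hq : q = p, ∃ hK : K = some (.natom p), e = eqToHom (by rw [hq]) ≫ vc (.natom p) (.pos p) ≫ eqToHom (by rw [hK]) := by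
  have hl := h.lv_eq FL
  rw [FL.lv_plug] at hl
  have hl' : ({Form.natom q} : Multiset (Form P)) + {Form.pos q} = {Form.pos p} + FL.olv K := hl
  have h2 : Form.pos p ∈ ({Form.natom q} : Multiset (Form P)) + {Form.pos q} := by rw [hl']; simp
  have h3 : q = p := by simpa [eq_comm] using h2
  subst h3
  refine ⟨rfl, ?_⟩
  rw [add_comm] at hl'
  have h4 := (add_left_cancel hl').symm
  cases K with
  | none => simp [SS.Lv.olv] at h4
  | some M =>
    have h5 : M = .natom q := by
      cases M with
      | disj A B =>
        have : flv A + flv B = {Form.natom q} := h4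
        have hc := congrArg Multiset.card this
        have h6 := FL.pos A
        have h7 := FL.pos B
        have h6' := Multiset.card_pos.2 h6
        have h7' := Multiset.card_pos.2 h7
        simp only [Multiset.card_add, Multiset.card_singleton] at hc
        change 0 < (flv A).card at h6'
        change 0 < (flv B).card at h7'
        omega
      | pos r =>
        have : ({Form.pos r} : Multiset (Form P)) = {Form.natom q} := h4
        simp at this
      | natom r =>
        have : ({Form.natom r} : Multiset (Form P)) = {Form.natom q} := h4
        simpa using this
      | conj A B =>
        have : ({A ⋏ B} : Multiset (Form P)) = {Form.natom q} := h4
        simp at this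
    subst h5
    refine ⟨rfl, ?_⟩
    simp only [eqToHom_refl, Category.id_comp, Category.comp_id]
    refine SS.AC.coh FL vfree h (.c _ _) ?_
    simp [FL, flv]

theorem cf_sg (p : P) {F : Form P} {τ : Pt F} (hτ : CF τ) :
    ∀ M (e : F ⟶ (.pos p ⋏ .natom p) ⋎ M), Vs.AC e → CF (τ.map (e ≫ sg p M)) := by
  induction hτ with
  | ax q => exact fun M e he => (no_ax_conj (K := some M) he).elim
  | iso h0 _ ih =>
    intro K e he
    rw [← Pt.map_comp, ← Category.assoc]
    exact ih K _ (h0.comp he)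
  | @tens K1 A L1 B a b ha hb iha ihb =>
    intro M e he
    have := tens_loc (atom_conj (.pos p) (.natom p)) (fun x K1 L1 A B K e => ∀ M (hh : pl K x = (.pos p ⋏ .natom p) ⋎ M)
      (_ : K = some M)
      (a : Pt (pl K1 A)) (b : Pt (pl L1 B)) (_ : CF a) (_ : CF b)
      (_ : ∀ M (e : _ ⟶ (.pos p ⋏ .natom p) ⋎ M), Vs.AC e → CF (a.map (e ≫ sg p M)))
      (_ : ∀ M (e : _ ⟶ (.pos p ⋏ .natom p) ⋎ M), Vs.AC e → CF (b.map (e ≫ sg p M))),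
      CF ((tens K1 A L1 B a b).map (e ≫ eqToHom hh ≫ sg p M))) ?_ ?_ ?_ (K := some M) he M rfl rfl a b ha hb iha ihb
    · rwa [eqToHom_refl, Category.id_comp] at this
    · intro V1 L1 A B K κ hκ M hh hK a b ha hb iha ihb
      subst hK
      rw [eqToHom_refl, Category.id_comp, Category.assoc]
      obtain ⟨L, m, h1, h2⟩ := Dl.lk p V1
      refine Dl.use (h2 _) hκ ?_
      have := tens_K h1 L1 A B a b
      exact this ▸ CF.tens _ _ _ _ ((h2 A).of iha) hb
    · intro K1 V1 A B K κ hκ M hh hK a b ha hb iha ihb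
      subst hK
      rw [eqToHom_refl, Category.id_comp, Category.assoc]
      obtain ⟨L, m, h1, h2⟩ := Dl.lk p V1
      have h3 := tens_L h1 K1 A B a b
      have h4 := h3 ▸ CF.tens _ _ _ _ ha ((h2 B).of ihb)
      cases K1 with
      | none => exact Dl.use (h2 _) hκ h4
      | some C => exact Dl.use ((h2 _).left C) hκ h4
    · intro K1 L1 A B hx K κ hκ M hh hK a b ha hb iha ihb
      cases hx
      subst hK
      rw [eqToHom_refl, Category.id_comp]
      cases K1 with
      | none => exact (not_CF_pos ha).elim
      | some C =>
        cases L1 with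
        | none => exact (not_CF_natom hb).elim
        | some D =>
          cases hκ with
          | some hk =>
            rw [Category.assoc, sg_nat, ← Category.assoc]
            apply CF.post' hk
            simp only [jiso]
            rw [sg_va]
            unfold tens
            rw [← Pt.map_comp]
            simp only [SS.plugMap]
            rw [← dj_comp1]
            have := hlem (atom_pos p) (phi (some D) (.natom p) b (.pos p) ≫ sg p D) (fun q K e he => by
              obtain ⟨hq, hK, he⟩ := ax_pos he
              subst hq hK
              simp only [eqToHom_refl, Category.id_comp, Category.comp_id] at he
              rw [he]
              have := cut_ax q D b
              exact this ▸ CF.iso (.c _ _) hb) (fun A B hh => by cases hh) ha (some C) (𝟙 _) (.id _)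
            rw [Category.id_comp] at this
            exact this

theorem Cl.sg (p : P) (M : Form P) : Cl (sg p M) := by
  intro K τ h
  cases K with
  | none =>
    have := cf_sg p h M (𝟙 _) (.id _)
    rwa [Category.id_comp] at this
  | some C =>
    have := cf_sg p h (M ⋎ C) (va _ _ _) (.a _ _ _)
    rwa [sg_va] at this

/-- Theorem A -/
theorem Cl.all {A B : Form P} (f : A ⟶ B) : Cl f := by
  induction f using ar_ind with | _ f
  induction f with
  | id A => exact Cl.id A
  | comp g f hg hf => exact hf.comp hg
  | conj f g hf hg => exact hf.cj hg
  | disj f g hf hg =>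
    rw [ar_dj, dj_split]
    exact (hf.dj1 _).comp (hg.dj2 _)
  | bConjTo A B C => exact Cl.wai A B C
  | bConjFrom A B C => exact Cl.wa A B C
  | bDisjTo A B C => exact Cl.ac (.ai _ _ _)
  | bDisjFrom A B C => exact Cl.ac (.a _ _ _)
  | cConj A B => exact Cl.wc A B
  | cDisj A B => exact Cl.ac (.c _ _)
  | d A B C => exact Cl.dd A B C
  | delta p A => exact Cl.delta p A
  | sigma p A => exact Cl.sg p A

theorem CF.map {F G : Form P} {τ : Pt F} (h : CF τ) (f : F ⟶ G) : CF (τ.map f) := Cl.all f none τ h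

end PNC

open CategoryTheory

namespace PNC
variable {P : Type}

/-! ## Copoints and dual pairs -/

structure Cp (H : Form P) where
  app : ∀ Y : Form P, H ⋎ Y ⟶ Y
  nat : ∀ {X Y : Form P} (f : X ⟶ Y), 𝟙 H ⟇ f ≫ app Y = app X ≫ f
  bcomp : ∀ B A, va H B A ≫ app (B ⋎ A) = app B ⟇ 𝟙 A
  dcomp : ∀ C B, dd C B H ≫ vc _ _ ≫ app (C ⋏ B) = 𝟙 C ⟑ (vc _ _ ≫ app B)

def Cp.comap {H H' : Form P} (e : H' ⟶ H) (ε : Cp H) : Cp H' where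
  app Y := e ⟇ 𝟙 Y ≫ ε.app Y
  nat f := by rw [as2 (dj_exch _ _).symm, ε.nat, Category.assoc]
  bcomp B A := by rw [← dj_id, as2 (va_nat _ _ _).symm, ε.bcomp, ← dj_comp1]
  dcomp C B := by
    have h := dd_nat (𝟙 C) (𝟙 B) e
    rw [cj_id] at h
    rw [as2 (vc_nat _ _).symm, as2 h.symm, ε.dcomp, ← cj_comp2, as2 (vc_nat _ _)]

def Cp.sg (p : P) : Cp (.pos p ⋏ .natom p) := ⟨PNC.sg p, sg_nat p, sg_va p, sg_dd p⟩

theorem Cp.sw {H : Form P} (ε : Cp H) (A B : Form P) :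
    PNC.sw H A B ≫ ε.app B ⟇ 𝟙 A = ε.app A ⟇ 𝟙 B ≫ vc _ _ := by
  rw [← ε.bcomp, ← ε.bcomp]
  unfold PNC.sw
  simp only [Category.assoc]
  rw [vai_va', ε.nat]

structure Du (A A' : Form P) where
  δ : Pt (A' ⋎ A)
  ε : Cp (A ⋏ A')
  cf : CF δ
  tri : phi (some A) A' δ A ≫ ε.app A = 𝟙 A

def Du.pos (p : P) : Du (.pos p) (.natom p) where
  δ := .ax p
  ε := .sg p
  cf := .ax p
  tri := by
    have h := ar_eq (.sigmaDelta p)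
    simp only [ar_comp, ar_id, Category.assoc] at h
    unfold phi
    rw [Category.assoc]
    exact h

def Du.natom (p : P) : Du (.natom p) (.pos p) where
  δ := (Pt.ax p).map (vc _ _)
  ε := (Cp.sg p).comap (wc _ _)
  cf := .iso (.c _ _) (.ax p)
  tri := by
    have h := psi_sg p
    unfold psi at h
    rw [Category.assoc] at h
    exact h

theorem phi_va (X y C D : Form P) (τ : Pt ((y ⋎ C) ⋎ D)) :
    phi (some (C ⋎ D)) y (τ.map (va y C D)) X = phi (some D) (y ⋎ C) τ X ≫ dd X y C ⟇ 𝟙 D ≫ va _ _ _ := by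
  unfold phi
  rw [Pt.map_app]
  simp only [strL, Category.assoc]
  rw [dd_disj]

def Du.disj {A1 A1' A2 A2' : Form P} (d1 : Du A1 A1') (d2 : Du A2 A2') : Du (A1 ⋎ A2) (A1' ⋏ A2') where
  δ := ((tens (some A1) A1' (some A2) A2' d1.δ d2.δ).map (va _ _ _)).map (𝟙 _ ⟇ vc A2 A1)
  ε := d2.ε.comap (wai _ _ _ ≫ (dr A1 A2 A1' ≫ d1.ε.app A2) ⟑ 𝟙 A2')
  cf := CF.map (CF.map (.tens _ _ _ _ d1.cf d2.cf) _) _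
  tri := by
    have h1 := phi_LK (LK.some (vc A2 A1)) (A1' ⋏ A2')
      ((tens (some A1) A1' (some A2) A2' d1.δ d2.δ).map (va _ _ _)) (A1 ⋎ A2)
    refine (congrArg (· ≫ _) h1).trans ?_
    rw [phi_va]
    unfold tens
    rw [phi_map]
    simp only [Cp.comap, Category.assoc, SS.plugMap]
    set n := dr A1 A2 A1' ≫ d1.ε.app A2 with hn
    have h2 := phi_and (some A2) (A1 ⋎ A2) A1' A2' d2.δ
    simp only [SS.plugMap, strL] at h2
    rw [as1 (dj_comp1 _ _).symm, ← h2]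
    rw [as2 (dj_exch _ _).symm, d2.ε.nat, ← dj_id, as2 (va_nat _ _ _).symm, as1 (d2.ε.bcomp _ _)]
    rw [as1 (dj_comp1 _ _).symm, as1 (dj_comp1 _ _).symm]
    have h3 := phi_nat (some A2) A2' d2.δ n
    simp only [SS.plugMap] at h3
    have h4 : (phi (some A2) A2' d2.δ ((A1 ⋎ A2) ⋏ A1') ≫ wa (A1 ⋎ A2) A1' A2' ⟇ 𝟙 A2) ≫
      (wai (A1 ⋎ A2) A1' A2' ≫ n ⟑ 𝟙 A2') ⟇ 𝟙 A2 = n ≫ phi (some A2) A2' d2.δ A2 := by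
      rw [h3, Category.assoc, ← dj_comp1, wa_wai']
    rw [h4]
    have h5 : (n ≫ phi (some A2) A2' d2.δ A2) ≫ d2.ε.app A2 = n := by
      rw [Category.assoc, d2.tri, Category.comp_id]
    rw [h5, hn, dj_comp1, Category.assoc]
    have h6 := phi_or (some A2) (some A1) A1 A1' d1.δ
    simp only [SS.plugMap, strR, sw2] at h6
    have h7 : phi (some A1) A1' d1.δ (A1 ⋎ A2) ≫ dr A1 A2 A1' ⟇ 𝟙 A1 =
       phi (some A1) A1' d1.δ A1 ⟇ 𝟙 A2 ≫ sw _ _ _ := by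
      rw [h6]; simp only [Category.assoc, sw_sw, Category.comp_id]
    have h8 : phi (some A1) A1' d1.δ (A1 ⋎ A2) ≫ dr A1 A2 A1' ⟇ 𝟙 A1 ≫ d1.ε.app A2 ⟇ 𝟙 A1 ≫ vc A2 A1 =
       phi (some A1) A1' d1.δ A1 ⟇ 𝟙 A2 ≫ sw _ _ _ ≫ d1.ε.app A2 ⟇ 𝟙 A1 ≫ vc A2 A1 := as2 h7 _
    refine h8.trans ?_
    rw [as2 (d1.ε.sw _ _), vc_vc, Category.comp_id, ← dj_comp1, d1.tri, dj_id]

theorem hR (X H B : Form P) : wc X (H ⋎ B) ≫ ar (dR H B X) =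
    𝟙 X ⟑ vc H B ≫ dd X B H ≫ vc _ _ ≫ 𝟙 H ⟇ wc X B := by
  rw [ar_dR]
  unfold dr
  simp only [Category.assoc]
  rw [as2 (wc_nat _ _).symm, wc_wc', vc_nat]

theorem E2 (X Y B' B : Form P) :
    wa X Y _ ≫ 𝟙 X ⟑ (dd Y B' B ≫ vc _ _) ≫ dd X B (Y ⋏ B') ≫ vc _ _ =
    wc X Y ⟑ 𝟙 _ ≫ wa Y X _ ≫ 𝟙 Y ⟑ (𝟙 X ⟑ vc B' B ≫ dd X B B' ≫ vc _ _) ≫ dd Y B' (X ⋏ B) := by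
  have h := ar_eq (.dBConj Y B' B X)
  simp only [ar_comp, ar_cj, ar_id, Category.assoc] at h
  change dd Y B' B ⟑ 𝟙 X ≫ ar (dR (Y ⋏ B') B X) = wa _ _ _ ≫ 𝟙 Y ⟑ ar (dR B' B X) ≫ dd Y B' (B ⋏ X) at h
  have r1 : 𝟙 X ⟑ vc (Y ⋏ B') B ≫ dd X B (Y ⋏ B') ≫ vc _ _ = wc _ _ ≫ ar (dR (Y ⋏ B') B X) ≫ 𝟙 _ ⟇ wc _ _ := by
    rw [← Category.assoc (wc _ _), hR]
    simp only [Category.assoc, ← dj_comp2, wc_wc, dj_id, Category.comp_id]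
  have r2 : 𝟙 X ⟑ vc B' B ≫ dd X B B' ≫ vc _ _ = wc _ _ ≫ ar (dR B' B X) ≫ 𝟙 _ ⟇ wc _ _ := by
    rw [← Category.assoc (wc _ _), hR]
    simp only [Category.assoc, ← dj_comp2, wc_wc, dj_id, Category.comp_id]
  rw [r2, cj_comp2]
  simp only [Category.assoc]
  rw [r1, as2 (wc_nat _ _), as2 h]
  simp only [cj_comp2, Category.assoc]
  have e : wa X Y (B' ⋎ B) ≫ wc X (Y ⋏ (B' ⋎ B)) ≫ wa Y (B' ⋎ B) X = wc X Y ⟑ 𝟙 _ ≫ wa Y X _ ≫ 𝟙 Y ⟑ wc _ _ :=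
    Ws.mcoh (SS.rho X Y (B' ⋎ B) Y Y Y) (.nd (.nd (.lf 0) (.lf 1)) (.lf 2)) (.nd (.lf 1) (.nd (.lf 2) (.lf 0)))
      (by decide) (.comp (.a _ _ _) (.comp (.c _ _) (.a _ _ _)))
      (.comp (.m (.c _ _) (.id _)) (.comp (.a _ _ _) (.m (.id _) (.c _ _))))
  have e' := fun {Z : Form P} (h : _ ⟶ Z) => congrArg (· ≫ h) e
  simp only [Category.assoc] at e'
  rw [e', dd_nat, cj_id]

def Du.conj {A1 A1' A2 A2' : Form P} (d1 : Du A1 A1') (d2 : Du A2 A2') : Du (A1 ⋏ A2) (A1' ⋎ A2') where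
  δ := (d1.δ.map (𝟙 A1' ⟇ (phi (some A2') A2 (d2.δ.map (vc _ _)) A1 ≫ vc _ _))).map (vai _ _ _)
  ε := d2.ε.comap (wc _ _ ⟑ 𝟙 _ ≫ wa _ _ _ ≫ 𝟙 A2 ⟑ (dd _ _ _ ≫ d1.ε.app _))
  cf := CF.map (CF.map d1.cf _) _
  tri := by
    set g := phi (some A2') A2 (d2.δ.map (vc _ _)) A1 ≫ vc _ _ with hg
    set δ := (d1.δ.map (𝟙 A1' ⟇ g)).map (vai _ _ _) with hδ
    have i1 : phi (some (A1 ⋏ A2)) (A1' ⋎ A2') δ A1 ≫ (dd A1 A1' A2') ⟇ 𝟙 _ =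
        phi (some A1) A1' d1.δ A1 ≫ 𝟙 _ ⟇ g ≫ vai _ _ _ := by
      have h1 := phi_LK (LK.some g) A1' d1.δ A1
      have h2 := phi_va A1 A1' A2' (A1 ⋏ A2) δ
      have h3 : δ.map (va _ _ _) = d1.δ.map (𝟙 A1' ⟇ g) := by
        rw [hδ]; exact Pt.map_cancel _ _ (vai_va _ _ _) _
      rw [h3] at h2
      rw [← Category.assoc, ← h1, h2]
      simp only [Category.assoc, va_vai, Category.comp_id]
    have i2 : phi (some (A1 ⋏ A2)) (A1' ⋎ A2') δ A1 ≫ (dd A1 A1' A2' ≫ d1.ε.app _) ⟇ 𝟙 _ = g := by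
      rw [dj_comp1, as2 i1, ← d1.ε.bcomp]
      simp only [Category.assoc]
      rw [vai_va', d1.ε.nat]
      rw [as1 d1.tri, Category.id_comp]
    have i3 : phi (some (A1 ⋏ A2)) (A1' ⋎ A2') δ (A1 ⋏ A2) ≫
      (wc _ _ ⟑ 𝟙 _ ≫ wa _ _ _ ≫ 𝟙 A2 ⟑ (dd _ _ _ ≫ d1.ε.app _)) ⟇ 𝟙 _ =
        wc _ _ ≫ 𝟙 A2 ⟑ g ≫ dd _ _ _ := by
      have n1 := phi_nat (some (A1 ⋏ A2)) (A1' ⋎ A2') δ (wc A1 A2)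
      have n2 := phi_and (some (A1 ⋏ A2)) A2 A1 (A1' ⋎ A2') δ
      simp only [SS.plugMap, strL] at n1 n2
      rw [dj_comp1, as2 n1.symm, dj_comp1, as2 n2, ← dd_nat, as1 (cj_comp2 _ _).symm, i2]
    simp only [Cp.comap]
    rw [as2 i3]
    have t : 𝟙 A1 ⟑ phi (some A2) A2' d2.δ A2 ≫ 𝟙 A1 ⟑ vc _ _ ≫ dd _ _ _ ≫ vc _ _ ≫ d2.ε.app (A1 ⋏ A2) = 𝟙 _ := by
      rw [d2.ε.dcomp, ← cj_comp2, ← cj_comp2, vc_vc', d2.tri, cj_id]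
    rw [← t]
    have e : wc A1 A2 ≫ 𝟙 A2 ⟑ g ≫ dd A2 A2' (A1 ⋏ A2) =
      𝟙 A1 ⟑ phi (some A2) A2' d2.δ A2 ≫ 𝟙 A1 ⟑ vc _ _ ≫ dd _ _ _ ≫ vc _ _ := by
      rw [hg]
      unfold phi
      simp only [strL, Pt.map_app]
      simp only [cj_comp2, Category.assoc]
      rw [← d2.δ.bcomp, ← d2.δ.bcomp]
      simp only [Category.assoc]
      have := E2 A1 A2 A2' A2
      simp only [cj_comp2, Category.assoc] at this
      rw [this, as2 (d2.δ.nat _)]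
    rw [as2 e]
    simp only [Category.assoc]

def neg : Form P → Form P
  | .pos p => .natom p
  | .natom p => .pos p
  | .conj A B => neg A ⋎ neg B
  | .disj A B => neg A ⋏ neg B

def du : ∀ A : Form P, Du A (neg A)
  | .pos p => .pos p
  | .natom p => .natom p
  | .conj A B => .conj (du A) (du B)
  | .disj A B => .disj (du A) (du B)

def name {A B : Form P} (f : A ⟶ B) : Pt (neg A ⋎ B) := (du A).δ.map (𝟙 _ ⟇ f)

theorem name_cf {A B : Form P} (f : A ⟶ B) : CF (name f) := (du A).cf.map _

theorem name_rec {A B : Form P} (f : A ⟶ B) : phi (some B) (neg A) (name f) A ≫ (du A).ε.app B = f := by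
  have h1 := phi_LK (LK.some f) (neg A) (du A).δ A
  unfold name
  rw [h1, Category.assoc, (du A).ε.nat, as1 (du A).tri, Category.id_comp]

theorem name_inj {A B : Form P} {f g : A ⟶ B} (h : name f = name g) : f = g := by
  rw [← name_rec f, h, name_rec]

end PNC

open CategoryTheory

namespace PNC
variable {P : Type}

/-! ## Uniqueness of diversified cut-free points -/

abbrev olv (K : Option (Form P)) : Multiset (Form P) := FL.olv K

theorem flv_pl (K : Option (Form P)) (y : Form P) : flv (pl K y) = flv y + olv K := FL.lv_plug K y

theorem flv_ne (A : Form P) : flv A ≠ 0 := FL.pos A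

theorem lits_ne (A : Form P) : ∃ l, l ∈ lits A := by
  induction A with
  | pos p => exact ⟨_, by simp [lits]; rfl⟩
  | natom p => exact ⟨_, by simp [lits]; rfl⟩
  | conj A B h _ => obtain ⟨l, h⟩ := h; exact ⟨l, by simp [lits, h]⟩
  | disj A B h _ => obtain ⟨l, h⟩ := h; exact ⟨l, by simp [lits, h]⟩

theorem mem_lits (F : Form P) (l : Bool × P) : l ∈ lits F ↔ ∃ x ∈ flv F, l ∈ lits x := by
  induction F with
  | disj A B h1 h2 =>
    simp only [lits, flv, Multiset.mem_add, h1, h2]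
    constructor
    · rintro (⟨x, h, h'⟩ | ⟨x, h, h'⟩)
      · exact ⟨x, .inl h, h'⟩
      · exact ⟨x, .inr h, h'⟩
    · rintro ⟨x, h | h, h'⟩
      · exact .inl ⟨x, h, h'⟩
      · exact .inr ⟨x, h, h'⟩
  | _ => simp [flv]

theorem flv_nodup {F : Form P} (h : (lits F).Nodup) : (flv F).Nodup := by
  induction F with
  | disj A B h1 h2 =>
    have h' : (lits A + lits B).Nodup := h
    rw [Multiset.nodup_add] at h'
    show (flv A + flv B).Nodup
    rw [Multiset.nodup_add]
    refine ⟨h1 h'.1, h2 h'.2.1, Multiset.disjoint_left.2 fun {x} hx hx' => ?_⟩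
    obtain ⟨l, hl⟩ := lits_ne x
    exact Multiset.disjoint_left.1 h'.2.2 ((mem_lits A l).2 ⟨x, hx, hl⟩) ((mem_lits B l).2 ⟨x, hx', hl⟩)
  | _ => simp [flv]

def inX (X : P → Prop) (F : Form P) : Prop := ∀ l ∈ lits F, X l.2
def outX (X : P → Prop) (F : Form P) : Prop := ∀ l ∈ lits F, ¬ X l.2
def dec (X : P → Prop) (F : Form P) : Prop := inX X F ∨ outX X F

theorem inX_flv {X : P → Prop} {F : Form P} : inX X F ↔ ∀ x ∈ flv F, inX X x := by
  unfold inX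
  simp only [mem_lits F]
  exact ⟨fun h x hx l hl => h l ⟨x, hx, hl⟩, fun h l ⟨x, hx, hl⟩ => h x hx l hl⟩
theorem outX_flv {X : P → Prop} {F : Form P} : outX X F ↔ ∀ x ∈ flv F, outX X x := by
  unfold outX
  simp only [mem_lits F]
  exact ⟨fun h x hx l hl => h l ⟨x, hx, hl⟩, fun h l ⟨x, hx, hl⟩ => h x hx l hl⟩
theorem not_in_out {X : P → Prop} {F : Form P} (h : inX X F) (h' : outX X F) : False := by
  obtain ⟨l, hl⟩ := lits_ne F
  exact h' l hl (h l hl)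
theorem inX_cj {X : P → Prop} {A B : Form P} : inX X (A ⋏ B) ↔ inX X A ∧ inX X B := by
  simp only [inX, lits, Multiset.mem_add, or_imp, forall_and]
theorem outX_cj {X : P → Prop} {A B : Form P} : outX X (A ⋏ B) ↔ outX X A ∧ outX X B := by
  simp only [outX, lits, Multiset.mem_add, or_imp, forall_and]
theorem inX_pl {X : P → Prop} {K : Option (Form P)} {B : Form P} :
    inX X (pl K B) ↔ inX X B ∧ ∀ x ∈ olv K, inX X x := by
  rw [inX_flv, flv_pl]
  simp only [Multiset.mem_add, or_imp, forall_and]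
  rw [← inX_flv]
theorem outX_pl {X : P → Prop} {K : Option (Form P)} {B : Form P} :
    outX X (pl K B) ↔ outX X B ∧ ∀ x ∈ olv K, outX X x := by
  rw [outX_flv, flv_pl]
  simp only [Multiset.mem_add, or_imp, forall_and]
  rw [← outX_flv]

theorem flv_cj (A B : Form P) : flv (A ⋏ B) = {A ⋏ B} := rfl

theorem CF.connected {F : Form P} {τ : Pt F} (h : CF τ) (X : P → Prop) :
    (∀ x ∈ flv F, dec X x) → dec X F := by
  induction h with
  | ax p =>
    intro _
    by_cases hp : X p
    · left; intro l hl; simp [lits] at hl; rcases hl with rfl | rfl <;> exact hp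
    · right; intro l hl; simp [lits] at hl; rcases hl with rfl | rfl <;> exact hp
  | iso h _ ih =>
    intro H
    have h1 := AC.lits h
    have h2 : flv _ = flv _ := h.lv_eq FL
    rw [← h2] at H
    have := ih H
    unfold dec inX outX at *
    rwa [h1] at this
  | tens K A L B _ _ ih1 ih2 =>
    intro H
    simp only [flv_pl, flv_cj, Multiset.mem_add, Multiset.mem_singleton] at H
    have hAB := H _ (.inl (.inl rfl))
    have d1 : dec X (pl K A) := ih1 (by
      intro x hx
      rw [flv_pl, Multiset.mem_add] at hx
      rcases hx with hx | hx
      · rcases hAB with h | h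
        · exact .inl (inX_flv.1 (inX_cj.1 h).1 x hx)
        · exact .inr (outX_flv.1 (outX_cj.1 h).1 x hx)
      · exact H x (.inr hx))
    have d2 : dec X (pl L B) := ih2 (by
      intro x hx
      rw [flv_pl, Multiset.mem_add] at hx
      rcases hx with hx | hx
      · rcases hAB with h | h
        · exact .inl (inX_flv.1 (inX_cj.1 h).2 x hx)
        · exact .inr (outX_flv.1 (outX_cj.1 h).2 x hx)
      · exact H x (.inl (.inr hx)))
    rcases hAB with h | h
    · left
      rw [inX_pl, inX_pl]
      rw [inX_cj] at h
      refine ⟨⟨inX_cj.2 h, ?_⟩, ?_⟩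
      · rcases d2 with d | d
        · exact (inX_pl.1 d).2
        · exact (not_in_out h.2 (outX_pl.1 d).1).elim
      · rcases d1 with d | d
        · exact (inX_pl.1 d).2
        · exact (not_in_out h.1 (outX_pl.1 d).1).elim
    · right
      rw [outX_pl, outX_pl]
      rw [outX_cj] at h
      refine ⟨⟨outX_cj.2 h, ?_⟩, ?_⟩
      · rcases d2 with d | d
        · exact (not_in_out (inX_pl.1 d).1 h.2).elim
        · exact (outX_pl.1 d).2
      · rcases d1 with d | d
        · exact (not_in_out (inX_pl.1 d).1 h.1).elim
        · exact (outX_pl.1 d).2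

theorem OAC_ex {K K' : Option (Form P)} (h : olv K = olv K') : ∃ κ, Vs.OAC K K' κ := by
  cases K with
  | none =>
    cases K' with
    | none => exact ⟨_, .none⟩
    | some M => exact absurd h.symm (FL.pos M)
  | some N =>
    cases K' with
    | none => exact absurd h (FL.pos N)
    | some M =>
      obtain ⟨e, he⟩ := SS.AC.exist FL (show FL.lv N = FL.lv M from h)
      exact ⟨_, .some he⟩

theorem ctx_nat {V : SS.VC (Form P)} {K : Option (Form P)} {y : Form P} {e : Vs.fill V y ⟶ pl K y}
    (h : Vs.AC e) (hn : (flv (pl K y)).Nodup) :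
    ∃ κ, Vs.OAC (Vs.del V) K κ ∧ e = Vs.ext V y ≫ κ y := by
  have h1 := h.lv_eq FL
  rw [FL.lv_fill, FL.lv_plug] at h1
  obtain ⟨κ, hκ⟩ := OAC_ex (add_left_cancel h1)
  refine ⟨κ, hκ, SS.AC.coh FL vfree h (.comp (Vs.ext_ac _ _) (hκ.ac _ _)) ?_⟩
  rw [h.lv_eq FL]
  exact hn

theorem ex_flv (r : Multiset (Form P)) (h : ∀ x ∈ r, Vs.IsAtom x) (h0 : r ≠ 0) : ∃ M, flv M = r := by
  induction r using Multiset.induction_on with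
  | empty => exact absurd rfl h0
  | cons a s ih =>
    by_cases hs : s = 0
    · subst hs
      exact ⟨a, FL.lv_atom a (h a (by simp))⟩
    · obtain ⟨M, hM⟩ := ih (fun x hx => h x (by simp [hx])) hs
      refine ⟨a ⋎ M, ?_⟩
      show flv a + flv M = _
      have : flv a = {a} := FL.lv_atom a (h a (by simp))
      rw [this, hM, Multiset.singleton_add]

theorem ctx_ex {K : Option (Form P)} {y : Form P} (h : flv y ≤ olv K) :
    ∃ U κ, Vs.OAC K (some (Vs.fill U y)) κ := by
  cases K with
  | none => exact absurd (Multiset.le_zero.1 h) (flv_ne y)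
  | some k =>
    obtain ⟨r, hr⟩ := Multiset.le_iff_exists_add.1 h
    have hr' : flv k = flv y + r := hr
    by_cases h0 : r = 0
    · obtain ⟨κ, hκ⟩ := OAC_ex (K := some k) (K' := some (Vs.fill .hole y)) (show flv k = flv y by simpa [h0] using hr')
      exact ⟨_, κ, hκ⟩
    · obtain ⟨M, hM⟩ := ex_flv r (fun x hx => FL.atom_of_mem (F := k) x (by
        show x ∈ flv k
        rw [hr']; simp [hx])) h0
      obtain ⟨κ, hκ⟩ := OAC_ex (K := some k) (K' := some (Vs.fill (.left .hole M) y))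
        (show flv k = flv y + flv M by rw [hM]; exact hr')
      exact ⟨_, κ, hκ⟩

theorem tens_move {K K' L L' : Option (Form P)} {κ} (hκ : Vs.OAC K' K κ) {μ} (hμ : Vs.OAC L' L μ)
    (A B : Form P) (a : Pt (pl K' A)) (b : Pt (pl L' B)) :
    ∃ e, Vs.AC e ∧ tens K' A L' B a b = (tens K A L B (a.map (κ A)) (b.map (μ B))).map e := by
  have h1 := tens_K (LK.oac hκ) L' A B a b
  have h2 := tens_L (LK.oac hμ) K A B (a.map (κ A)) b
  rw [← h1, ← Pt.map_comp] at h2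
  have hac : Vs.AC (κ (pl L' (A ⋏ B)) ≫ plm K (μ (A ⋏ B))) := .comp (hκ.ac _ _) (plm_ac _ (hμ.ac _ _))
  obtain ⟨e, he, h3, _⟩ := hac.inv_ex
  refine ⟨e, he, ?_⟩
  rw [← h2, Pt.map_cancel _ _ h3]

/-- a point that is a tensor at the conjunction `A ⋏ B` up to structural maps -/
def IsT (A B : Form P) {F : Form P} (τ : Pt F) : Prop :=
  ∃ (K L : Option (Form P)) (a : Pt (pl K A)) (b : Pt (pl L B)) (e : pl K (pl L (A ⋏ B)) ⟶ F),
    CF a ∧ CF b ∧ Vs.AC e ∧ τ = (tens K A L B a b).map e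

theorem IsT.map {A B F G : Form P} {τ : Pt F} (h : IsT A B τ) {e : F ⟶ G} (he : Vs.AC e) : IsT A B (τ.map e) := by
  obtain ⟨K, L, a, b, e', ha, hb, he', rfl⟩ := h
  exact ⟨K, L, a, b, _, ha, hb, he'.comp he, by rw [Pt.map_comp]⟩

theorem comm1 {A B : Form P} {K K2 L2 : Option (Form P)} {y y' : Form P} (θ : y ⟶ y')
    {a : Pt (pl K2 A)} {b : Pt (pl L2 B)} (ha : CF a) (hb : CF b)
    {e : pl K2 (pl L2 (A ⋏ B)) ⟶ pl K y} (he : Vs.AC e) (hn : (flv (pl K y)).Nodup)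
    (hy : flv y ≤ olv K2) : IsT A B (((tens K2 A L2 B a b).map e).map (plm K θ)) := by
  obtain ⟨U, κ, hκ⟩ := ctx_ex hy
  obtain ⟨e1, he1, h1⟩ := tens_move hκ (.id _ L2) A B a b
  rw [Pt.map_id] at h1
  rw [h1, ← Pt.map_comp (e := e1)]
  have hac := he1.comp he
  generalize e1 ≫ e = e2 at hac
  obtain ⟨ν, hν, rfl⟩ := ctx_nat (V := .right (pl L2 (A ⋏ B)) U) hac hn
  rw [← Pt.map_comp, Category.assoc, ← hν.nat, ← Category.assoc, ← Vs.ext_nat, Pt.map_comp, Pt.map_comp]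
  refine IsT.map (IsT.map ?_ (Vs.ext_ac _ _)) (hν.ac _ _)
  refine ⟨some (Vs.fill U y'), L2, (a.map (κ A)).map (𝟙 _ ⟇ Vs.fillMap U θ), b, 𝟙 _, (ha.map _).map _, hb, .id _, ?_⟩
  rw [Pt.map_id]
  exact tens_K (LK.some (Vs.fillMap U θ)) L2 A B _ _

theorem comm2 {A B : Form P} {K K2 L2 : Option (Form P)} {y y' : Form P} (θ : y ⟶ y')
    {a : Pt (pl K2 A)} {b : Pt (pl L2 B)} (ha : CF a) (hb : CF b)
    {e : pl K2 (pl L2 (A ⋏ B)) ⟶ pl K y} (he : Vs.AC e) (hn : (flv (pl K y)).Nodup)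
    (hy : flv y ≤ olv L2) : IsT A B (((tens K2 A L2 B a b).map e).map (plm K θ)) := by
  obtain ⟨U, κ, hκ⟩ := ctx_ex hy
  obtain ⟨e1, he1, h1⟩ := tens_move (.id _ K2) hκ A B a b
  rw [Pt.map_id] at h1
  rw [h1, ← Pt.map_comp (e := e1)]
  have hac := he1.comp he
  generalize e1 ≫ e = e2 at hac
  have hT := tens_L (LK.some (Vs.fillMap U θ)) K2 A B a (b.map (κ B))
  cases K2 with
  | none =>
    obtain ⟨ν, hν, rfl⟩ := ctx_nat (V := .right (A ⋏ B) U) hac hn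
    rw [← Pt.map_comp, Category.assoc, ← hν.nat, ← Category.assoc, ← Vs.ext_nat, Pt.map_comp, Pt.map_comp]
    refine IsT.map (IsT.map ?_ (Vs.ext_ac _ _)) (hν.ac _ _)
    exact ⟨none, some (Vs.fill U y'), a, (b.map (κ B)).map (𝟙 _ ⟇ Vs.fillMap U θ), 𝟙 _, ha, (hb.map _).map _, .id _, by
      rw [Pt.map_id]; exact hT⟩
  | some C =>
    obtain ⟨ν, hν, rfl⟩ := ctx_nat (V := .left (.right (A ⋏ B) U) C) hac hn
    rw [← Pt.map_comp, Category.assoc, ← hν.nat, ← Category.assoc, ← Vs.ext_nat, Pt.map_comp, Pt.map_comp]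
    refine IsT.map (IsT.map ?_ (Vs.ext_ac _ _)) (hν.ac _ _)
    exact ⟨some C, some (Vs.fill U y'), a, (b.map (κ B)).map (𝟙 _ ⟇ Vs.fillMap U θ), 𝟙 _, ha, (hb.map _).map _, .id _, by
      rw [Pt.map_id]; exact hT⟩

end PNC

open CategoryTheory

namespace PNC
variable {P : Type}

theorem tinfo {X : P → Prop} {A B F : Form P} {K L : Option (Form P)} (hA : inX X A) (hB : outX X B)
    {a : Pt (pl K A)} {b : Pt (pl L B)} (ha : CF a) (hb : CF b) {e : pl K (pl L (A ⋏ B)) ⟶ F}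
    (he : Vs.AC e) (hn : (flv F).Nodup) (hd : ∀ x ∈ flv F, x ≠ A ⋏ B → dec X x) :
    flv F = {A ⋏ B} + olv L + olv K ∧ (∀ x ∈ olv K, inX X x) ∧ (∀ x ∈ olv L, outX X x) := by
  have h1 : flv F = {A ⋏ B} + olv L + olv K := by
    have : flv _ = flv _ := he.lv_eq FL
    rw [← this, flv_pl, flv_pl, flv_cj]
  refine ⟨h1, ?_⟩
  rw [h1] at hn hd
  have hne : ∀ x, x ∈ olv L ∨ x ∈ olv K → x ≠ A ⋏ B := by
    rintro x hx rfl
    rw [add_assoc, Multiset.singleton_add, Multiset.nodup_cons, Multiset.mem_add] at hn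
    exact hn.1 hx
  have c1 : dec X (pl K A) := ha.connected X (by
    intro x hx
    rw [flv_pl, Multiset.mem_add] at hx
    rcases hx with hx | hx
    · exact .inl (inX_flv.1 hA x hx)
    · exact hd x (by simp [hx]) (hne x (.inr hx)))
  have c2 : dec X (pl L B) := hb.connected X (by
    intro x hx
    rw [flv_pl, Multiset.mem_add] at hx
    rcases hx with hx | hx
    · exact .inr (outX_flv.1 hB x hx)
    · exact hd x (by simp [hx]) (hne x (.inl hx)))
  constructor
  · rcases c1 with c | c
    · exact (inX_pl.1 c).2
    · exact (not_in_out hA (outX_pl.1 c).1).elim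
  · rcases c2 with c | c
    · exact (not_in_out (inX_pl.1 c).1 hB).elim
    · exact (outX_pl.1 c).2

theorem comm {X : P → Prop} {A B : Form P} (hA : inX X A) (hB : outX X B)
    {K : Option (Form P)} {y y' : Form P} (θ : y ⟶ y') {τ : Pt (pl K y)} (h : IsT A B τ)
    (hn : (flv (pl K y)).Nodup) (hd : ∀ x ∈ flv (pl K y), x ≠ A ⋏ B → dec X x) (hy : dec X y) :
    IsT A B (τ.map (plm K θ)) := by
  obtain ⟨K2, L2, a, b, e, ha, hb, he, rfl⟩ := h
  obtain ⟨h1, h2, h3⟩ := tinfo hA hB ha hb he hn hd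
  have hn' := hn
  rw [flv_pl, Multiset.nodup_add] at hn'
  have hsub : ∀ x ∈ flv y, x = A ⋏ B ∨ x ∈ olv L2 ∨ x ∈ olv K2 := by
    intro x hx
    have : x ∈ flv (pl K y) := by rw [flv_pl]; simp [hx]
    rw [h1] at this
    simpa [or_assoc] using this
  rcases hy with hy | hy
  · refine comm1 θ ha hb he hn ?_
    rw [Multiset.le_iff_subset hn'.1]
    intro x hx
    have hxi := inX_flv.1 hy x hx
    rcases hsub x hx with rfl | h | h
    · exact (not_in_out (inX_cj.1 hxi).2 hB).elim
    · exact (not_in_out hxi (h3 x h)).elim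
    · exact h
  · refine comm2 θ ha hb he hn ?_
    rw [Multiset.le_iff_subset hn'.1]
    intro x hx
    have hxi := outX_flv.1 hy x hx
    rcases hsub x hx with rfl | h | h
    · exact (not_in_out hA (outX_cj.1 hxi).1).elim
    · exact h
    · exact (not_in_out (h2 x h) hxi).elim

theorem lits_sub {K L : Option (Form P)} {A B : Form P} :
    lits (pl K (pl L (A ⋏ B))) = lits (pl K A) + lits (pl L B) := by
  simp only [lits_pl, lits]; abel

theorem split {X : P → Prop} {A B : Form P} (hA : inX X A) (hB : outX X B) {F : Form P} {τ : Pt F} (h : CF τ) :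
    (lits F).Nodup → A ⋏ B ∈ flv F → (∀ x ∈ flv F, x ≠ A ⋏ B → dec X x) → IsT A B τ := by
  induction h with
  | ax p =>
    intro _ hm
    have : A ⋏ B ∈ ({Form.natom p} + {Form.pos p} : Multiset (Form P)) := hm
    simp at this
  | iso h _ ih =>
    intro hn hm hd
    have h2 : flv _ = flv _ := h.lv_eq FL
    rw [← AC.lits h] at hn
    rw [← h2] at hm hd
    exact (ih hn hm hd).map h
  | tens K1 A1 L1 B1 ha hb ih1 ih2 =>
    rename_i a b
    intro hn hm hd
    by_cases heq : A ⋏ B = A1 ⋏ B1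
    · injection heq with e1 e2
      subst e1 e2
      exact ⟨K1, L1, a, b, 𝟙 _, ha, hb, .id _, by rw [Pt.map_id]⟩
    · have hF : flv (pl K1 (pl L1 (A1 ⋏ B1))) = {A1 ⋏ B1} + olv L1 + olv K1 := by
        rw [flv_pl, flv_pl, flv_cj]
      rw [hF] at hm hd
      rw [lits_sub, Multiset.nodup_add] at hn
      have hAB : dec X (A1 ⋏ B1) := hd _ (by simp) (fun h => heq h.symm)
      have hdA : dec X A1 := hAB.imp (fun h => (inX_cj.1 h).1) (fun h => (outX_cj.1 h).1)
      have hdB : dec X B1 := hAB.imp (fun h => (inX_cj.1 h).2) (fun h => (outX_cj.1 h).2)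
      have hdA' : ∀ x ∈ flv (pl K1 A1), x ≠ A ⋏ B → dec X x := by
        intro x hx hne
        rw [flv_pl, Multiset.mem_add] at hx
        rcases hx with hx | hx
        · exact hdA.imp (fun h => inX_flv.1 h x hx) (fun h => outX_flv.1 h x hx)
        · exact hd x (by simp [hx]) hne
      have hdB' : ∀ x ∈ flv (pl L1 B1), x ≠ A ⋏ B → dec X x := by
        intro x hx hne
        rw [flv_pl, Multiset.mem_add] at hx
        rcases hx with hx | hx
        · exact hdB.imp (fun h => inX_flv.1 h x hx) (fun h => outX_flv.1 h x hx)
        · exact hd x (by simp [hx]) hne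
      simp only [Multiset.mem_add, Multiset.mem_singleton, heq, false_or] at hm
      rcases hm with hm | hm
      · rw [tens_symm]
        refine IsT.map ?_ (sw2_ac _ _ _)
        exact comm hA hB _ (ih2 hn.2.1 (by rw [flv_pl]; simp [hm]) hdB') (flv_nodup hn.2.1) hdB' hdB
      · exact comm hA hB _ (ih1 hn.1 (by rw [flv_pl]; simp [hm]) hdA') (flv_nodup hn.1) hdA' hdA

theorem ax_uniq (p : P) {F : Form P} {τ : Pt F} (h : CF τ) :
    ∀ e : Form.natom p ⋎ Form.pos p ⟶ F, Vs.AC e → τ = (Pt.ax p).map e := by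
  induction h with
  | ax q =>
    intro e he
    have h1 : ({Form.natom p} + {Form.pos p} : Multiset (Form P)) = {Form.natom q} + {Form.pos q} := he.lv_eq FL
    have h2 : Form.natom p ∈ ({Form.natom q} + {Form.pos q} : Multiset (Form P)) := by rw [← h1]; simp
    have h3 : p = q := by simpa using h2
    subst h3
    have : e = 𝟙 _ := SS.AC.coh FL vfree he (.id _) (by simp [FL, flv])
    rw [this, Pt.map_id]
  | iso h _ ih =>
    intro e he
    obtain ⟨g, hg, _, h2⟩ := h.inv_ex
    rw [ih _ (he.comp hg), ← Pt.map_comp, Category.assoc, h2, Category.comp_id]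
  | tens K A L B _ _ _ _ =>
    intro e he
    have h1 : ({Form.natom p} + {Form.pos p} : Multiset (Form P)) = flv _ := he.lv_eq FL
    have h2 : A ⋏ B ∈ ({Form.natom p} + {Form.pos p} : Multiset (Form P)) := by
      rw [h1, flv_pl, flv_pl, flv_cj]; simp
    simp at h2

open Classical in
theorem filter_eq {X : P → Prop} {s t s' t' : Multiset (Form P)} (h : s + t = s' + t')
    (hs : ∀ x ∈ s, inX X x) (hs' : ∀ x ∈ s', inX X x) (ht : ∀ x ∈ t, outX X x) (ht' : ∀ x ∈ t', outX X x) :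
    s = s' ∧ t = t' := by
  have h1 : ∀ s t : Multiset (Form P), (∀ x ∈ s, inX X x) → (∀ x ∈ t, outX X x) →
      (s + t).filter (inX X) = s := by
    intro s t hs ht
    rw [Multiset.filter_add, Multiset.filter_eq_self.2 hs,
      Multiset.filter_eq_nil.2 (fun x hx h => not_in_out h (ht x hx)), add_zero]
  have h2 : s = s' := by rw [← h1 s t hs ht, h, h1 s' t' hs' ht']
  subst h2
  exact ⟨rfl, add_left_cancel h⟩

theorem CF.unique {F : Form P} {τ : Pt F} (h : CF τ) : (lits F).Nodup → ∀ {τ' : Pt F}, CF τ' → τ = τ' := by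
  induction h with
  | ax p =>
    intro _ τ' h'
    rw [ax_uniq p h' (𝟙 _) (.id _), Pt.map_id]
  | iso h _ ih =>
    intro hn τ' h'
    obtain ⟨g, hg, _, h2⟩ := h.inv_ex
    rw [← AC.lits h] at hn
    rw [ih hn (.iso hg h'), ← Pt.map_comp, h2, Pt.map_id]
  | tens K A L B ha hb ih1 ih2 =>
    intro hn τ' h'
    have hn0 := flv_nodup hn
    rw [lits_sub, Multiset.nodup_add] at hn
    let X : P → Prop := fun v => ∃ s, (s, v) ∈ lits (pl K A)
    have hi : inX X (pl K A) := fun l hl => ⟨l.1, hl⟩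
    have ho : outX X (pl L B) := by
      rintro ⟨s, v⟩ hl ⟨s', hs'⟩
      have : (s, v) ∈ lits (pl K A) := by
        by_cases hh : s = s'
        · rwa [hh]
        · have := ha.balance s' v hs'
          have h3 : s = !s' := by cases s <;> cases s' <;> simp_all
          rwa [h3]
      exact Multiset.disjoint_left.1 hn.2.2 this hl
    rw [inX_pl] at hi
    rw [outX_pl] at ho
    have hF : flv (pl K (pl L (A ⋏ B))) = {A ⋏ B} + olv L + olv K := by
        rw [flv_pl, flv_pl, flv_cj]
    have hd : ∀ x ∈ flv (pl K (pl L (A ⋏ B))), x ≠ A ⋏ B → dec X x := by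
      rw [hF]
      intro x hx hne
      simp only [Multiset.mem_add, Multiset.mem_singleton, hne, false_or] at hx
      exact hx.elim (fun h => .inr (ho.2 x h)) (fun h => .inl (hi.2 x h))
    obtain ⟨K', L', a', b', e, ha', hb', he, rfl⟩ := split hi.1 ho.1 h' (by
      rw [lits_sub, Multiset.nodup_add]; exact hn) (by rw [hF]; simp) hd
    obtain ⟨h1, h2, h3⟩ := tinfo hi.1 ho.1 ha' hb' he hn0 hd
    rw [hF, add_assoc, add_assoc] at h1
    have h4 := add_left_cancel h1
    rw [add_comm, add_comm (olv L')] at h4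
    obtain ⟨h5, h6⟩ := filter_eq h4 hi.2 h2 ho.2 h3
    obtain ⟨κ, hκ⟩ := OAC_ex h5.symm
    obtain ⟨μ, hμ⟩ := OAC_ex h6.symm
    obtain ⟨e1, he1, h7⟩ := tens_move hκ hμ A B a' b'
    rw [h7, ← Pt.map_comp, ih1 hn.1 (ha'.map (κ A)), ih2 hn.2.1 (hb'.map (μ B))]
    have : e1 ≫ e = 𝟙 _ := SS.AC.coh FL vfree (he1.comp he) (.id _) hn0
    rw [this, Pt.map_id]

end PNC

open CategoryTheory

namespace PNC
variable {P : Type}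

/-! ## Relational semantics: labelings -/

def Val : Form P → Type
  | .pos _ => ℕ
  | .natom _ => ℕ
  | .conj A B => Val A × Val B
  | .disj A B => Val A × Val B

def tS : ∀ {A B : Form P}, Term P A B → Val A → Val B → Prop
  | _, _, .id _, a, b => b = a
  | _, _, .comp g f, a, c => ∃ b, tS f a b ∧ tS g b c
  | _, _, .conj f g, (a1, a2), (b1, b2) => tS f a1 b1 ∧ tS g a2 b2
  | _, _, .disj f g, (a1, a2), (b1, b2) => tS f a1 b1 ∧ tS g a2 b2
  | _, _, .bConjTo _ _ _, (a, (b, c)), ((a', b'), c') => a' = a ∧ b' = b ∧ c' = c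
  | _, _, .bConjFrom _ _ _, ((a, b), c), (a', (b', c')) => a' = a ∧ b' = b ∧ c' = c
  | _, _, .bDisjTo _ _ _, (a, (b, c)), ((a', b'), c') => a' = a ∧ b' = b ∧ c' = c
  | _, _, .bDisjFrom _ _ _, ((a, b), c), (a', (b', c')) => a' = a ∧ b' = b ∧ c' = c
  | _, _, .cConj _ _, (a, b), (b', a') => b' = b ∧ a' = a
  | _, _, .cDisj _ _, (a, b), (b', a') => b' = b ∧ a' = a
  | _, _, .d _ _ _, (a, (b, c)), ((a', b'), c') => a' = a ∧ b' = b ∧ c' = c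
  | _, _, .delta _ _, a, (a', (m, n)) => a' = a ∧ (n : ℕ) = m
  | _, _, .sigma _ _, ((m, n), a), a' => a' = a ∧ (n : ℕ) = m

theorem ex_conj {A B : Form P} {q : Val (A ⋏ B) → Prop} : (∃ x, q x) ↔ ∃ (a : Val A) (b : Val B), q (a, b) :=
  Prod.exists
theorem ex_disj {A B : Form P} {q : Val (A ⋎ B) → Prop} : (∃ x, q x) ↔ ∃ (a : Val A) (b : Val B), q (a, b) :=
  Prod.exists
theorem ex_pos {p : P} {q : Val (.pos p) → Prop} : (∃ x, q x) ↔ ∃ (a : ℕ), q a := Iff.rfl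
theorem ex_nat {p : P} {q : Val (.natom p) → Prop} : (∃ x, q x) ↔ ∃ (a : ℕ), q a := Iff.rfl
theorem all_conj {A B : Form P} {q : Val (A ⋏ B) → Prop} : (∀ x, q x) ↔ ∀ (a : Val A) (b : Val B), q (a, b) :=
  Prod.forall
theorem all_disj {A B : Form P} {q : Val (A ⋎ B) → Prop} : (∀ x, q x) ↔ ∀ (a : Val A) (b : Val B), q (a, b) :=
  Prod.forall
theorem eq_conj {A B : Form P} {a a' : Val A} {b b' : Val B} :
    @Eq (Val (A ⋏ B)) (a, b) (a', b') ↔ a = a' ∧ b = b' := Prod.mk_inj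
theorem eq_disj {A B : Form P} {a a' : Val A} {b b' : Val B} :
    @Eq (Val (A ⋎ B)) (a, b) (a', b') ↔ a = a' ∧ b = b' := Prod.mk_inj

set_option linter.unusedSimpArgs false in
theorem tS_sound {A B : Form P} {f g : Term P A B} (h : Eqv f g) : ∀ a b, tS f a b ↔ tS g a b := by
  induction h with
  | refl f => intros; rfl
  | symm _ ih => intro a b; exact (ih a b).symm
  | trans _ _ h1 h2 => intro a b; exact (h1 a b).trans (h2 a b)
  | congComp _ _ h1 h2 => intro a b; simp only [tS, h1, h2]
  | congConj _ _ h1 h2 => simp only [all_conj, tS, h1, h2, implies_true]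
  | congDisj _ _ h1 h2 => simp only [all_disj, tS, h1, h2, implies_true]
  | sigmaDelta p =>
    simp only [tS, ex_conj, ex_disj, ex_pos, ex_nat, all_conj, all_disj, eq_conj, eq_disj]
    intro a b
    constructor
    · rintro ⟨_, _, _, ⟨_, _, _, ⟨rfl, rfl⟩, rfl, rfl, rfl⟩, rfl, h⟩; exact h
    · rintro rfl; exact ⟨b, b, b, ⟨b, b, b, ⟨rfl, rfl⟩, rfl, rfl, rfl⟩, rfl, rfl⟩
  | sigmaDelta' p =>
    simp only [tS, delta', sigma', ex_conj, ex_disj, ex_pos, ex_nat, all_conj, all_disj, eq_conj, eq_disj]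
    intro a b
    constructor
    · rintro ⟨_, _, _, ⟨_, _, _, ⟨_, _, _, ⟨rfl, rfl⟩, rfl, rfl, rfl⟩, rfl, rfl, rfl⟩, _, _, _, ⟨⟨rfl, rfl⟩, rfl⟩, rfl, h⟩
      exact h.symm
    · rintro rfl
      exact ⟨b, b, b, ⟨b, b, b, ⟨b, b, b, ⟨rfl, rfl⟩, rfl, rfl, rfl⟩, rfl, rfl, rfl⟩, b, b, b, ⟨⟨rfl, rfl⟩, rfl⟩, rfl, rfl⟩
  | _ =>
    simp only [tS, dR, sigmaConj, deltaDisj, ex_conj, ex_disj, all_conj, all_disj, eq_conj, eq_disj]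
    intros
    grind

end PNC

open CategoryTheory

namespace PNC
variable {P : Type}

/-- semantics of arrows -/
def aS {A B : Form P} (f : A ⟶ B) (a : Val A) (b : Val B) : Prop :=
  Quotient.lift (s := setd A B) (fun t => tS t a b) (fun _ _ h => propext (tS_sound h a b)) f

theorem aS_ar {A B : Form P} (f : Term P A B) (a : Val A) (b : Val B) : aS (ar f) a b = tS f a b := rfl

theorem aS_id {A : Form P} (a : Val A) : aS (𝟙 A) a a := rfl
theorem aS_comp {A B C : Form P} {f : A ⟶ B} {g : B ⟶ C} {a : Val A} {b : Val B} {c : Val C}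
    (h1 : aS f a b) (h2 : aS g b c) : aS (f ≫ g) a c := by
  induction f using ar_ind; induction g using ar_ind
  exact ⟨b, h1, h2⟩
theorem aS_cj {A B C D : Form P} {f : A ⟶ B} {g : C ⟶ D} {a : Val A} {b : Val B} {c : Val C} {d : Val D}
    (h1 : aS f a b) (h2 : aS g c d) : aS (f ⟑ g) (a, c) (b, d) := by
  induction f using ar_ind; induction g using ar_ind
  exact ⟨h1, h2⟩
theorem aS_dj {A B C D : Form P} {f : A ⟶ B} {g : C ⟶ D} {a : Val A} {b : Val B} {c : Val C} {d : Val D}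
    (h1 : aS f a b) (h2 : aS g c d) : aS (f ⟇ g) (a, c) (b, d) := by
  induction f using ar_ind; induction g using ar_ind
  exact ⟨h1, h2⟩
theorem aS_wa {A B C : Form P} (a : Val A) (b : Val B) (c : Val C) : aS (wa A B C) ((a, b), c) (a, (b, c)) :=
  ⟨rfl, rfl, rfl⟩
theorem aS_wai {A B C : Form P} (a : Val A) (b : Val B) (c : Val C) : aS (wai A B C) (a, (b, c)) ((a, b), c) :=
  ⟨rfl, rfl, rfl⟩
theorem aS_va {A B C : Form P} (a : Val A) (b : Val B) (c : Val C) : aS (va A B C) ((a, b), c) (a, (b, c)) :=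
  ⟨rfl, rfl, rfl⟩
theorem aS_vai {A B C : Form P} (a : Val A) (b : Val B) (c : Val C) : aS (vai A B C) (a, (b, c)) ((a, b), c) :=
  ⟨rfl, rfl, rfl⟩
theorem aS_dd {A B C : Form P} (a : Val A) (b : Val B) (c : Val C) : aS (dd A B C) (a, (b, c)) ((a, b), c) :=
  ⟨rfl, rfl, rfl⟩
theorem aS_wc {A B : Form P} (a : Val A) (b : Val B) : aS (wc A B) (a, b) (b, a) := ⟨rfl, rfl⟩
theorem aS_vc {A B : Form P} (a : Val A) (b : Val B) : aS (vc A B) (a, b) (b, a) := ⟨rfl, rfl⟩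
theorem aS_dr {A B C : Form P} (a : Val A) (b : Val B) (c : Val C) : aS (dr A B C) ((a, b), c) ((a, c), b) := by
  unfold dr
  exact aS_comp (aS_wc _ _) (aS_comp (aS_dd _ _ _) (aS_dj (aS_wc _ _) (aS_id _)))

/-! ## Lifting formulae along labelings -/

def lift : ∀ A : Form P, Val A → Form (P × ℕ)
  | .pos p, n => .pos (p, n)
  | .natom p, n => .natom (p, n)
  | .conj A B, (a, b) => lift A a ⋏ lift B b
  | .disj A B, (a, b) => lift A a ⋎ lift B b

def ren (r : ℕ → ℕ) : ∀ A : Form P, Val A → Val A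
  | .pos _, n => r n
  | .natom _, n => r n
  | .conj A B, (a, b) => (ren r A a, ren r B b)
  | .disj A B, (a, b) => (ren r A a, ren r B b)

theorem ren_ren (r s : ℕ → ℕ) : ∀ (A : Form P) (a : Val A), ren r A (ren s A a) = ren (r ∘ s) A a
  | .pos _, _ => rfl
  | .natom _, _ => rfl
  | .conj A B, (a, b) => Prod.ext (ren_ren r s A a) (ren_ren r s B b)
  | .disj A B, (a, b) => Prod.ext (ren_ren r s A a) (ren_ren r s B b)

theorem ren_id : ∀ (A : Form P) (a : Val A), ren id A a = a
  | .pos _, _ => rfl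
  | .natom _, _ => rfl
  | .conj A B, (a, b) => Prod.ext (ren_id A a) (ren_id B b)
  | .disj A B, (a, b) => Prod.ext (ren_id A a) (ren_id B b)

def rl (r : ℕ → ℕ) (x : Bool × P × ℕ) : Bool × P × ℕ := (x.1, x.2.1, r x.2.2)

theorem lits_ren (r : ℕ → ℕ) : ∀ (A : Form P) (a : Val A), lits (lift A (ren r A a)) = (lits (lift A a)).map (rl r)
  | .pos _, _ => rfl
  | .natom _, _ => rfl
  | .conj A B, (a, b) => by
    simp only [ren, lift, lits, Multiset.map_add]; rw [lits_ren r A a, lits_ren r B b]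
  | .disj A B, (a, b) => by
    simp only [ren, lift, lits, Multiset.map_add]; rw [lits_ren r A a, lits_ren r B b]

theorem AC_val {F G : Form P} {e : F ⟶ G} (h : Vs.AC e) : ∀ v : Val F, ∃ w : Val G,
    lits (lift F v) = lits (lift G w) ∧ ∀ r, aS e (ren r F v) (ren r G w) := by
  induction h with
  | a A B D =>
    rintro ⟨⟨a, b⟩, d⟩
    exact ⟨(a, (b, d)), add_assoc _ _ _, fun r => aS_va _ _ _⟩
  | ai A B D =>
    rintro ⟨a, b, d⟩
    exact ⟨((a, b), d), (add_assoc _ _ _).symm, fun r => aS_vai _ _ _⟩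
  | c A B =>
    rintro ⟨a, b⟩
    exact ⟨(b, a), add_comm _ _, fun r => aS_vc _ _⟩
  | id A => exact fun v => ⟨v, rfl, fun r => aS_id _⟩
  | m _ _ h1 h2 =>
    rintro ⟨a, b⟩
    obtain ⟨a', ha, ha'⟩ := h1 a
    obtain ⟨b', hb, hb'⟩ := h2 b
    exact ⟨(a', b'), congrArg₂ _ ha hb, fun r => aS_dj (ha' r) (hb' r)⟩
  | comp _ _ h1 h2 =>
    intro v
    obtain ⟨a', ha, ha'⟩ := h1 v
    obtain ⟨b', hb, hb'⟩ := h2 a'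
    exact ⟨b', ha.trans hb, fun r => aS_comp (ha' r) (hb' r)⟩

theorem nodup_par {m n : Multiset (Bool × P × ℕ)} (hm : m.Nodup) (hn : n.Nodup) :
    (m.map (rl (fun i => 2 * i)) + n.map (rl (fun i => 2 * i + 1))).Nodup := by
  rw [Multiset.nodup_add]
  refine ⟨hm.map ?_, hn.map ?_, ?_⟩
  · rintro ⟨a, b, c⟩ ⟨a', b', c'⟩ h
    simp only [rl, Prod.mk.injEq] at h ⊢
    exact ⟨h.1, h.2.1, by omega⟩
  · rintro ⟨a, b, c⟩ ⟨a', b', c'⟩ h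
    simp only [rl, Prod.mk.injEq] at h ⊢
    exact ⟨h.1, h.2.1, by omega⟩
  · rw [Multiset.disjoint_left]
    intro x h1 h2
    obtain ⟨⟨a, b, c⟩, -, h1⟩ := Multiset.mem_map.1 h1
    obtain ⟨⟨a', b', c'⟩, -, h2⟩ := Multiset.mem_map.1 h2
    rw [← h1] at h2
    simp only [rl, Prod.mk.injEq] at h2
    omega

theorem nd_of {α : Type} {m n : Multiset α} (h : m = n) (k : m.Nodup) : n.Nodup := h ▸ k

theorem CF_val {F : Form P} {τ : Pt F} (h : CF τ) : ∃ v : Val F, (lits (lift F v)).Nodup ∧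
    ∀ r X (x : Val X), aS (τ.app X) x (x, ren r F v) := by
  induction h with
  | ax p =>
    refine ⟨((0 : ℕ), (0 : ℕ)), ?_, fun r X x => ⟨rfl, rfl⟩⟩
    simp [lift, lits]
  | iso h _ ih =>
    obtain ⟨v, hv, hv'⟩ := ih
    obtain ⟨w, hw, hw'⟩ := AC_val h v
    exact ⟨w, hw ▸ hv, fun r X x => aS_comp (hv' r X x) (aS_cj (aS_id _) (hw' r))⟩
  | tens K A L B _ _ h1 h2 =>
    obtain ⟨v, hv, hv'⟩ := h1
    obtain ⟨w, hw, hw'⟩ := h2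
    have key := nodup_par hv hw
    have hv2 := fun r X x => hv' (r ∘ fun i => 2 * i) X x
    have hw2 := fun r X x => hw' (r ∘ fun i => 2 * i + 1) X x
    simp only [← ren_ren] at hv2 hw2
    rw [← lits_ren, ← lits_ren] at key
    generalize ren (fun i => 2 * i) _ v = v at *
    generalize ren (fun i => 2 * i + 1) _ w = w at *
    clear hv' hw' hv hw
    cases K with
    | none =>
      cases L with
      | none =>
        refine ⟨(v, w), key, fun r X x => ?_⟩
        exact aS_comp (hv2 r X x) (aS_cj (aS_id _) (aS_comp (hw2 r A _) (aS_id _)))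
      | some D =>
        obtain ⟨w, d⟩ := w
        refine ⟨((v, w), d), nd_of (add_assoc (lits (lift A v)) (lits (lift B w)) (lits (lift D d))).symm key, fun r X x => ?_⟩
        exact aS_comp (hv2 r X x) (aS_cj (aS_id _) (aS_comp (hw2 r A _) (aS_dd _ _ _)))
    | some E =>
      obtain ⟨v, e⟩ := v
      cases L with
      | none =>
        refine ⟨((v, w), e), nd_of (add_right_comm (lits (lift A v)) (lits (lift E e)) (lits (lift B w))) key, fun r X x => ?_⟩
        exact aS_comp (hv2 r X x) (aS_cj (aS_id _) (aS_dj (aS_comp (hw2 r A _) (aS_id _)) (aS_id _)))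
      | some D =>
        obtain ⟨w, d⟩ := w
        refine ⟨(((v, w), d), e), ?_, fun r X x => ?_⟩
        · have : lits (lift A v) + lits (lift E e) + (lits (lift B w) + lits (lift D d)) =
            lits (lift A v) + lits (lift B w) + lits (lift D d) + lits (lift E e) := by abel
          exact nd_of this key
        · exact aS_comp (hv2 r X x) (aS_cj (aS_id _) (aS_dj (aS_comp (hw2 r A _) (aS_dd _ _ _)) (aS_id _)))

/-! ## Semantics of the counits -/

def ngV : ∀ A : Form P, Val (neg A) → Val A
  | .pos _, n => n
  | .natom _, n => n
  | .conj A B, (a, b) => (ngV A a, ngV B b)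
  | .disj A B, (a, b) => (ngV A a, ngV B b)

theorem lift_neg : ∀ (A : Form P) (n : Val (neg A)), lift (neg A) n = neg (lift A (ngV A n))
  | .pos _, _ => rfl
  | .natom _, _ => rfl
  | .conj A B, (a, b) => congrArg₂ Form.disj (lift_neg A a) (lift_neg B b)
  | .disj A B, (a, b) => congrArg₂ Form.conj (lift_neg A a) (lift_neg B b)

theorem eps_val : ∀ (A : Form P) (n : Val (neg A)) Y (y : Val Y), aS ((du A).ε.app Y) ((ngV A n, n), y) y
  | .pos _, n, Y, y => ⟨rfl, rfl⟩
  | .natom _, n, Y, y => aS_comp (aS_dj (aS_wc _ _) (aS_id _)) ⟨rfl, rfl⟩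
  | .conj A B, (a, b), Y, y => by
    refine aS_comp (aS_dj ?_ (aS_id _)) (eps_val B b Y y)
    exact aS_comp (aS_cj (aS_wc _ _) (aS_id _)) (aS_comp (aS_wa _ _ _) (aS_cj (aS_id _)
      (aS_comp (aS_dd _ _ _) (eps_val A a _ _))))
  | .disj A B, (a, b), Y, y => by
    refine aS_comp (aS_dj ?_ (aS_id _)) (eps_val B b Y y)
    exact aS_comp (aS_wai _ _ _) (aS_cj (aS_comp (aS_dr _ _ _) (eps_val A a _ _)) (aS_id _))

theorem arrow_val {A B : Form P} (f : A ⟶ B) : ∃ (a : Val A) (b : Val B), aS f a b ∧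
    (lits (neg (lift A a) ⋎ lift B b)).Nodup := by
  obtain ⟨v, h1, h2⟩ := CF_val (name_cf f)
  have h2 : ∀ X (x : Val X), aS ((name f).app X) x (x, v) := by
    intro X x
    have := h2 id X x
    rw [ren_id] at this
    exact this
  obtain ⟨n, b⟩ := v
  refine ⟨ngV A n, b, ?_, ?_⟩
  · have := name_rec f
    rw [← this]
    exact aS_comp (aS_comp (h2 _ _) (aS_dd _ _ _)) (eps_val A n B b)
  · rw [← lift_neg]; exact h1

end PNC

open CategoryTheory

namespace PNC
variable {P Q : Type}

/-! ## Renaming letters -/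

def mF (π : Q → P) : Form Q → Form P
  | .pos p => .pos (π p)
  | .natom p => .natom (π p)
  | .conj A B => mF π A ⋏ mF π B
  | .disj A B => mF π A ⋎ mF π B

def mT (π : Q → P) : ∀ {A B : Form Q}, Term Q A B → Term P (mF π A) (mF π B)
  | _, _, .id A => .id (mF π A)
  | _, _, .comp g f => .comp (mT π g) (mT π f)
  | _, _, .conj f g => .conj (mT π f) (mT π g)
  | _, _, .disj f g => .disj (mT π f) (mT π g)
  | _, _, .bConjTo A B C => .bConjTo (mF π A) (mF π B) (mF π C)
  | _, _, .bConjFrom A B C => .bConjFrom (mF π A) (mF π B) (mF π C)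
  | _, _, .bDisjTo A B C => .bDisjTo (mF π A) (mF π B) (mF π C)
  | _, _, .bDisjFrom A B C => .bDisjFrom (mF π A) (mF π B) (mF π C)
  | _, _, .cConj A B => .cConj (mF π A) (mF π B)
  | _, _, .cDisj A B => .cDisj (mF π A) (mF π B)
  | _, _, .d A B C => .d (mF π A) (mF π B) (mF π C)
  | _, _, .delta p A => .delta (π p) (mF π A)
  | _, _, .sigma p A => .sigma (π p) (mF π A)

theorem mE (π : Q → P) {A B : Form Q} {f g : Term Q A B} (h : Eqv f g) : Eqv (mT π f) (mT π g) := by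
  induction h with
  | refl f => exact .refl _
  | symm _ h => exact .symm h
  | trans _ _ h1 h2 => exact .trans h1 h2
  | congComp _ _ h1 h2 => exact .congComp h1 h2
  | congConj _ _ h1 h2 => exact .congConj h1 h2
  | congDisj _ _ h1 h2 => exact .congDisj h1 h2
  | catIdR => exact .catIdR ..
  | catIdL => exact .catIdL ..
  | catAssoc => exact .catAssoc ..
  | conjOne => exact .conjOne ..
  | disjOne => exact .disjOne ..
  | conjTwo => exact .conjTwo ..
  | disjTwo => exact .disjTwo ..
  | bConjNat => exact .bConjNat ..
  | bDisjNat => exact .bDisjNat ..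
  | cConjNat => exact .cConjNat ..
  | cDisjNat => exact .cDisjNat ..
  | dNat => exact .dNat ..
  | bConjIso₁ => exact .bConjIso₁ ..
  | bConjIso₂ => exact .bConjIso₂ ..
  | bDisjIso₁ => exact .bDisjIso₁ ..
  | bDisjIso₂ => exact .bDisjIso₂ ..
  | bConjPent => exact .bConjPent ..
  | bDisjPent => exact .bDisjPent ..
  | cConjIso => exact .cConjIso ..
  | cDisjIso => exact .cDisjIso ..
  | bcConj => exact .bcConj ..
  | bcDisj => exact .bcDisj ..
  | dConj => exact .dConj ..
  | dDisj => exact .dDisj ..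
  | dBConj => exact .dBConj ..
  | dBDisj => exact .dBDisj ..
  | deltaNat => exact .deltaNat ..
  | sigmaNat => exact .sigmaNat ..
  | bDelta => exact .bDelta ..
  | bSigma => exact .bSigma ..
  | dSigmaConj => exact .dSigmaConj ..
  | dDeltaDisj => exact .dDeltaDisj ..
  | sigmaDelta => exact .sigmaDelta ..
  | sigmaDelta' => exact .sigmaDelta' ..

def cst {A A' B B' : Form P} (hA : A = A') (hB : B = B') (f : Term P A B) : Term P A' B' := hA ▸ hB ▸ f

theorem cst_eqv {A A' B B' : Form P} (hA : A = A') (hB : B = B') {f g : Term P A B} (h : Eqv f g) :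
    Eqv (cst hA hB f) (cst hA hB g) := by
  subst hA; subst hB; exact h

theorem mF_lift : ∀ (A : Form P) (a : Val A), mF Prod.fst (lift A a) = A
  | .pos _, _ => rfl
  | .natom _, _ => rfl
  | .conj A B, (a, b) => congrArg₂ Form.conj (mF_lift A a) (mF_lift B b)
  | .disj A B, (a, b) => congrArg₂ Form.disj (mF_lift A a) (mF_lift B b)

theorem aux_comp {A A' B B' C C' : Form P} (hA : A = A') (hB : B = B') (hC : C = C') (g : Term P B C)
    (f : Term P A B) : cst hA hC (g ⬝ f) = cst hB hC g ⬝ cst hA hB f := by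
  subst hA; subst hB; subst hC; rfl
theorem aux_conj {A A' B B' C C' D D' : Form P} (hA : A = A') (hB : B = B') (hC : C = C') (hD : D = D')
    (f : Term P A B) (g : Term P C D) :
    cst (congrArg₂ Form.conj hA hC) (congrArg₂ Form.conj hB hD) (f ⊼ g) = cst hA hB f ⊼ cst hC hD g := by
  subst hA; subst hB; subst hC; subst hD; rfl
theorem aux_disj {A A' B B' C C' D D' : Form P} (hA : A = A') (hB : B = B') (hC : C = C') (hD : D = D')
    (f : Term P A B) (g : Term P C D) :
    cst (congrArg₂ Form.disj hA hC) (congrArg₂ Form.disj hB hD) (f ⊽ g) = cst hA hB f ⊽ cst hC hD g := by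
  subst hA; subst hB; subst hC; subst hD; rfl
theorem aux3 {s t : Form P → Form P → Form P → Form P} (c : ∀ A B C, Term P (s A B C) (t A B C))
    {A A' B B' C C' : Form P} (hA : A = A') (hB : B = B') (hC : C = C')
    (h1 : s A B C = s A' B' C') (h2 : t A B C = t A' B' C') : cst h1 h2 (c A B C) = c A' B' C' := by
  subst hA; subst hB; subst hC; rfl
theorem aux2 {s t : Form P → Form P → Form P} (c : ∀ A B, Term P (s A B) (t A B))
    {A A' B B' : Form P} (hA : A = A') (hB : B = B')
    (h1 : s A B = s A' B') (h2 : t A B = t A' B') : cst h1 h2 (c A B) = c A' B' := by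
  subst hA; subst hB; rfl
theorem aux1 {s t : Form P → Form P} (c : ∀ A, Term P (s A) (t A))
    {A A' : Form P} (hA : A = A')
    (h1 : s A = s A') (h2 : t A = t A') : cst h1 h2 (c A) = c A' := by
  subst hA; rfl

theorem tS_lift {A B : Form P} (f : Term P A B) : ∀ a b, tS f a b →
    ∃ f' : Term (P × ℕ) (lift A a) (lift B b), cst (mF_lift A a) (mF_lift B b) (mT Prod.fst f') = f := by
  induction f with
  | id A =>
    rintro a b h
    obtain rfl : b = a := h
    refine ⟨.id _, ?_⟩
    show cst _ _ (Term.id (mF Prod.fst (lift A b))) = _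
    generalize_proofs h1
    revert h1
    generalize mF Prod.fst (lift A b) = X
    rintro rfl; rfl
  | comp g f hg hf =>
    rintro a c ⟨b, h1, h2⟩
    obtain ⟨f', h1⟩ := hf _ _ h1
    obtain ⟨g', h2⟩ := hg _ _ h2
    refine ⟨.comp g' f', ?_⟩
    rw [← h1, ← h2]
    exact aux_comp _ _ _ _ _
  | conj f g hf hg =>
    rintro ⟨a1, a2⟩ ⟨b1, b2⟩ ⟨h1, h2⟩
    obtain ⟨f', h1⟩ := hf _ _ h1
    obtain ⟨g', h2⟩ := hg _ _ h2
    refine ⟨.conj f' g', ?_⟩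
    rw [← h1, ← h2]
    exact aux_conj _ _ _ _ _ _
  | disj f g hf hg =>
    rintro ⟨a1, a2⟩ ⟨b1, b2⟩ ⟨h1, h2⟩
    obtain ⟨f', h1⟩ := hf _ _ h1
    obtain ⟨g', h2⟩ := hg _ _ h2
    refine ⟨.disj f' g', ?_⟩
    rw [← h1, ← h2]
    exact aux_disj _ _ _ _ _ _
  | bConjTo A B C =>
    rintro ⟨a, b, c⟩ ⟨⟨a2, b2⟩, c2⟩ ⟨h1, h2, h3⟩
    subst h1; subst h2; subst h3
    exact ⟨.bConjTo _ _ _, aux3 (fun A B C => Term.bConjTo A B C) (mF_lift _ _) (mF_lift _ _) (mF_lift _ _) _ _⟩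
  | bDisjTo A B C =>
    rintro ⟨a, b, c⟩ ⟨⟨a2, b2⟩, c2⟩ ⟨h1, h2, h3⟩
    subst h1; subst h2; subst h3
    exact ⟨.bDisjTo _ _ _, aux3 (fun A B C => Term.bDisjTo A B C) (mF_lift _ _) (mF_lift _ _) (mF_lift _ _) _ _⟩
  | d A B C =>
    rintro ⟨a, b, c⟩ ⟨⟨a2, b2⟩, c2⟩ ⟨h1, h2, h3⟩
    subst h1; subst h2; subst h3
    exact ⟨.d _ _ _, aux3 (fun A B C => Term.d A B C) (mF_lift _ _) (mF_lift _ _) (mF_lift _ _) _ _⟩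
  | bConjFrom A B C =>
    rintro ⟨⟨a, b⟩, c⟩ ⟨a2, b2, c2⟩ ⟨h1, h2, h3⟩
    subst h1; subst h2; subst h3
    exact ⟨.bConjFrom _ _ _, aux3 (fun A B C => Term.bConjFrom A B C) (mF_lift _ _) (mF_lift _ _) (mF_lift _ _) _ _⟩
  | bDisjFrom A B C =>
    rintro ⟨⟨a, b⟩, c⟩ ⟨a2, b2, c2⟩ ⟨h1, h2, h3⟩
    subst h1; subst h2; subst h3
    exact ⟨.bDisjFrom _ _ _, aux3 (fun A B C => Term.bDisjFrom A B C) (mF_lift _ _) (mF_lift _ _) (mF_lift _ _) _ _⟩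
  | cConj A B =>
    rintro ⟨a, b⟩ ⟨b2, a2⟩ ⟨h1, h2⟩
    subst h1; subst h2
    exact ⟨.cConj _ _, aux2 (fun A B => Term.cConj A B) (mF_lift _ _) (mF_lift _ _) _ _⟩
  | cDisj A B =>
    rintro ⟨a, b⟩ ⟨b2, a2⟩ ⟨h1, h2⟩
    subst h1; subst h2
    exact ⟨.cDisj _ _, aux2 (fun A B => Term.cDisj A B) (mF_lift _ _) (mF_lift _ _) _ _⟩
  | delta p A =>
    rintro a ⟨a2, m, n⟩ ⟨h1, h2⟩
    subst h1
    obtain rfl : n = m := h2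
    exact ⟨.delta (p, n) _, aux1 (fun A => Term.delta p A) (mF_lift _ _) _ _⟩
  | sigma p A =>
    rintro ⟨⟨m, n⟩, a⟩ a2 ⟨h1, h2⟩
    subst h1
    obtain rfl : n = m := h2
    exact ⟨.sigma (p, n) _, aux1 (fun A => Term.sigma p A) (mF_lift _ _) _ _⟩

end PNC

open CategoryTheory

namespace PNC
variable {P : Type}

/-! ## Labelings and the functor G -/

def fl : ∀ A : Form P, Val A → ℕ → ℕ
  | .pos _, n, _ => n
  | .natom _, n, _ => n
  | .conj A B, (a, b), i => if i < A.size then fl A a i else fl B b (i - A.size)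
  | .disj A B, (a, b), i => if i < A.size then fl A a i else fl B b (i - A.size)

def ufl : ∀ A : Form P, (ℕ → ℕ) → Val A
  | .pos _, l => l 0
  | .natom _, l => l 0
  | .conj A B, l => (ufl A l, ufl B (fun i => l (i + A.size)))
  | .disj A B, l => (ufl A l, ufl B (fun i => l (i + A.size)))

theorem fl_ufl : ∀ (A : Form P) (l : ℕ → ℕ) (i : ℕ), i < A.size → fl A (ufl A l) i = l i
  | .pos _, l, i, h => by simp [Form.size] at h; subst h; rfl
  | .natom _, l, i, h => by simp [Form.size] at h; subst h; rfl
  | .conj A B, l, i, h => by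
    simp only [Form.size] at h
    simp only [ufl, fl]
    split
    · exact fl_ufl A l i ‹_›
    · rw [fl_ufl B _ _ (by omega)]; congr 1; omega
  | .disj A B, l, i, h => by
    simp only [Form.size] at h
    simp only [ufl, fl]
    split
    · exact fl_ufl A l i ‹_›
    · rw [fl_ufl B _ _ (by omega)]; congr 1; omega

theorem fl_pair {A B : Form P} (a : Val A) (b : Val B) (q : ℕ → ℕ → Prop) :
    (∀ i < A.size + B.size, q i (if i < A.size then fl A a i else fl B b (i - A.size))) ↔
    (∀ i < A.size, q i (fl A a i)) ∧ (∀ i < B.size, q (i + A.size) (fl B b i)) := by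
  constructor
  · intro h
    refine ⟨fun i hi => ?_, fun i hi => ?_⟩
    · have := h i (by omega); rwa [if_pos hi] at this
    · have := h (i + A.size) (by omega)
      rwa [if_neg (by omega), Nat.add_sub_cancel] at this
  · rintro ⟨h1, h2⟩ i hi
    split
    · exact h1 i ‹_›
    · have := h2 (i - A.size) (by omega)
      rwa [Nat.sub_add_cancel (by omega)] at this

theorem fl_inj : ∀ (A : Form P) (a b : Val A), (∀ i < A.size, fl A a i = fl A b i) → a = b
  | .pos _, a, b, h => h 0 (by simp [Form.size])
  | .natom _, a, b, h => h 0 (by simp [Form.size])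
  | .conj A B, (a, a'), (b, b'), h => by
    have h1 : ∀ i < A.size, fl A a i = fl A b i := fun i hi => by
      have := h i (by simp only [Form.size]; omega)
      simpa only [fl, if_pos hi] using this
    have h2 : ∀ i < B.size, fl B a' i = fl B b' i := fun i hi => by
      have := h (i + A.size) (by simp only [Form.size]; omega)
      simpa only [fl, if_neg (show ¬ i + A.size < A.size by omega), Nat.add_sub_cancel] using this
    rw [fl_inj A a b h1, fl_inj B a' b' h2]
  | .disj A B, (a, a'), (b, b'), h => by
    have h1 : ∀ i < A.size, fl A a i = fl A b i := fun i hi => by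
      have := h i (by simp only [Form.size]; omega)
      simpa only [fl, if_pos hi] using this
    have h2 : ∀ i < B.size, fl B a' i = fl B b' i := fun i hi => by
      have := h (i + A.size) (by simp only [Form.size]; omega)
      simpa only [fl, if_neg (show ¬ i + A.size < A.size by omega), Nat.add_sub_cancel] using this
    rw [fl_inj A a b h1, fl_inj B a' b' h2]

def Rsp (R : GRel) (l l' : ℕ → ℕ) : Prop := ∀ u v, R u v → Sum.elim l l' u = Sum.elim l l' v

def Ok (m n : ℕ) : ℕ ⊕ ℕ → Prop := Sum.elim (· < m) (· < n)

structure Good (R : GRel) (m n : ℕ) : Prop where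
  sym : ∀ u v, R u v → R v u
  ok : ∀ u v, R u v → Ok m n u

theorem Good.ok' {R : GRel} {m n : ℕ} (h : Good R m n) {u v} (k : R u v) : Ok m n v := h.ok _ _ (h.sym _ _ k)

theorem good_fun (m : ℕ) (φ : ℕ → ℕ) (h : ∀ i < m, φ i < m) : Good (gFun m φ) m m where
  sym := by rintro u v ⟨i, h, h1, h2⟩; exact ⟨i, h, h2, h1⟩
  ok := by
    rintro u v ⟨i, hi, rfl | rfl, -⟩
    · exact hi
    · exact h i hi

theorem good_id (m : ℕ) : Good (gId m) m m := good_fun m (fun i => i) (fun _ h => h)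

theorem good_swap (a b : ℕ) : Good (gSwap a b) (a + b) (b + a) := by
  rw [add_comm b a]
  refine good_fun _ _ fun i h => ?_
  split <;> omega

theorem good_par {R S : GRel} {a b d e : ℕ} (h1 : Good R a d) (h2 : Good S b e) :
    Good (gPar a d R S) (a + b) (d + e) where
  sym := by
    rintro u v (h | ⟨u', v', h, rfl, rfl⟩)
    · exact .inl (h1.sym _ _ h)
    · exact .inr ⟨_, _, h2.sym _ _ h, rfl, rfl⟩
  ok := by
    rintro u v (h | ⟨u', v', h, rfl, rfl⟩)
    · have := h1.ok _ _ h
      cases u <;> simp only [Ok, Sum.elim_inl, Sum.elim_inr] at this ⊢ <;> omega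
    · have := h2.ok _ _ h
      cases u' <;> simp only [Ok, Sum.elim_inl, Sum.elim_inr, Sum.map_inl, Sum.map_inr] at this ⊢ <;> omega

theorem tg_symm {α : Type} {r : α → α → Prop} (hr : ∀ x y, r x y → r y x) {x y : α}
    (h : Relation.TransGen r x y) : Relation.TransGen r y x := by
  induction h with
  | single h => exact .single (hr _ _ h)
  | tail _ h ih => exact .head (hr _ _ h) ih

/-- one step of a composition -/
def stp (Pr R : GRel) : ℕ ⊕ ℕ ⊕ ℕ → ℕ ⊕ ℕ ⊕ ℕ → Prop := fun x y =>
  (∃ x' y', Sum.map id Sum.inl x' = x ∧ Sum.map id Sum.inl y' = y ∧ R x' y') ∨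
  (∃ x' y', Sum.inr x' = x ∧ Sum.inr y' = y ∧ Pr x' y')

theorem good_comp {Pr R : GRel} {a b c : ℕ} (h1 : Good Pr b c) (h2 : Good R a b) :
    Good (gComp Pr R) a c where
  sym := by
    intro u v h
    refine tg_symm ?_ h
    rintro x y (⟨x', y', rfl, rfl, h⟩ | ⟨x', y', rfl, rfl, h⟩)
    · exact .inl ⟨_, _, rfl, rfl, h2.sym _ _ h⟩
    · exact .inr ⟨_, _, rfl, rfl, h1.sym _ _ h⟩
  ok := by
    intro u v h
    obtain ⟨y, h, -⟩ := (Relation.TransGen.head'_iff).1 h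
    rcases h with ⟨x', y', h, rfl, k⟩ | ⟨x', y', h, rfl, k⟩
    · have := h2.ok _ _ k
      cases u <;> cases x' <;> simp at h
      subst h; exact this
    · have := h1.ok _ _ k
      cases u <;> cases x' <;> simp at h
      subst h; exact this

theorem good_delta (a : ℕ) : Good (gDelta a 1) a (a + (1 + 1)) where
  sym := by
    rintro u v (⟨i, h, h1, h2⟩ | ⟨i, h, h1, h2⟩)
    · exact .inl ⟨i, h, h2, h1⟩
    · exact .inr ⟨i, h, h2, h1⟩
  ok := by
    rintro u v (⟨i, h, rfl | rfl, h2⟩ | ⟨i, h, rfl | rfl, h2⟩) <;>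
      simp only [Ok, Sum.elim_inl, Sum.elim_inr] <;> omega

theorem good_sigma (a : ℕ) : Good (gSigma a 1) (1 + 1 + a) a where
  sym := by
    rintro u v (⟨i, h, h1, h2⟩ | ⟨i, h, h1, h2⟩)
    · exact .inl ⟨i, h, h2, h1⟩
    · exact .inr ⟨i, h, h2, h1⟩
  ok := by
    rintro u v (⟨i, h, rfl | rfl, h2⟩ | ⟨i, h, rfl | rfl, h2⟩) <;>
      simp only [Ok, Sum.elim_inl, Sum.elim_inr] <;> omega

theorem good {A B : Form P} (f : Term P A B) : Good f.G A.size B.size := by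
  induction f with
  | id A => exact good_id _
  | comp g f hg hf => exact good_comp hg hf
  | conj f g hf hg => exact good_par hf hg
  | disj f g hf hg => exact good_par hf hg
  | bConjTo A B C => simp only [Term.G, Form.size, add_assoc]; exact good_id _
  | bConjFrom A B C => simp only [Term.G, Form.size, add_assoc]; exact good_id _
  | bDisjTo A B C => simp only [Term.G, Form.size, add_assoc]; exact good_id _
  | bDisjFrom A B C => simp only [Term.G, Form.size, add_assoc]; exact good_id _
  | cConj A B => exact good_swap _ _
  | cDisj A B => exact good_swap _ _
  | d A B C => simp only [Term.G, Form.size, add_assoc]; exact good_id _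
  | delta p A => exact good_delta _
  | sigma p A => exact good_sigma _

theorem rsp_fun (m : ℕ) (φ : ℕ → ℕ) (l l' : ℕ → ℕ) : Rsp (gFun m φ) l l' ↔ ∀ i < m, l i = l' (φ i) := by
  constructor
  · intro h i hi
    exact h (.inl i) (.inr (φ i)) ⟨i, hi, .inl rfl, .inr rfl⟩
  · rintro h u v ⟨i, hi, rfl | rfl, rfl | rfl⟩
    · rfl
    · exact h i hi
    · exact (h i hi).symm
    · rfl

theorem rsp_id (m : ℕ) (l l' : ℕ → ℕ) : Rsp (gId m) l l' ↔ ∀ i < m, l i = l' i := rsp_fun m (fun i => i) l l'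

theorem rsp_par {R S : GRel} {a d b e : ℕ} (h1 : Good R a d) (h2 : Good S b e) (l l' m m' : ℕ → ℕ) :
    Rsp (gPar a d R S) (fun i => if i < a then l i else m (i - a)) (fun i => if i < d then l' i else m' (i - d)) ↔
      Rsp R l l' ∧ Rsp S m m' := by
  have e1 : ∀ u, Ok a d u → Sum.elim (fun i => if i < a then l i else m (i - a))
      (fun i => if i < d then l' i else m' (i - d)) u = Sum.elim l l' u := by
    rintro (u | u) h
    · exact if_pos h
    · exact if_pos h
  have e2 : ∀ u, Sum.elim (fun i => if i < a then l i else m (i - a))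
      (fun i => if i < d then l' i else m' (i - d)) (Sum.map (· + a) (· + d) u) = Sum.elim m m' u := by
    rintro (u | u) <;> simp
  constructor
  · intro h
    refine ⟨fun u v k => ?_, fun u v k => ?_⟩
    · rw [← e1 u (h1.ok _ _ k), ← e1 v (h1.ok' k)]
      exact h _ _ (.inl k)
    · rw [← e2, ← e2 v]
      exact h _ _ (.inr ⟨_, _, k, rfl, rfl⟩)
  · rintro ⟨k1, k2⟩ u v (h | ⟨u', v', h, rfl, rfl⟩)
    · rw [e1 u (h1.ok _ _ h), e1 v (h1.ok' h)]; exact k1 _ _ h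
    · rw [e2, e2]; exact k2 _ _ h

theorem rsp_comp {Pr R : GRel} {a b c : ℕ} (h1 : Good Pr b c) (h2 : Good R a b) (l l' : ℕ → ℕ) :
    Rsp (gComp Pr R) l l' ↔ ∃ m, Rsp R l m ∧ Rsp Pr m l' := by
  constructor
  · intro h
    let T := Relation.TransGen (stp Pr R)
    have Tsym : ∀ {x y}, T x y → T y x := by
      intro x y h
      refine tg_symm ?_ h
      rintro x y (⟨x', y', rfl, rfl, h⟩ | ⟨x', y', rfl, rfl, h⟩)
      · exact .inl ⟨_, _, rfl, rfl, h2.sym _ _ h⟩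
      · exact .inr ⟨_, _, rfl, rfl, h1.sym _ _ h⟩
    let o : ℕ ⊕ ℕ → ℕ ⊕ ℕ ⊕ ℕ := Sum.map id Sum.inr
    have H : ∀ u v, T (o u) (o v) → Sum.elim l l' u = Sum.elim l l' v := h
    classical
    let m : ℕ → ℕ := fun j => if k : ∃ u, T (.inr (.inl j)) (o u) then Sum.elim l l' k.choose else 0
    have m1 : ∀ j u, T (.inr (.inl j)) (o u) → m j = Sum.elim l l' u := by
      intro j u k
      have k' : ∃ u, T (.inr (.inl j)) (o u) := ⟨u, k⟩
      simp only [m, dif_pos k']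
      exact H _ _ ((Tsym k'.choose_spec).trans k)
    have m2 : ∀ i j, T (.inr (.inl i)) (.inr (.inl j)) → m i = m j := by
      intro i j k
      by_cases k' : ∃ u, T (.inr (.inl j)) (o u)
      · obtain ⟨u, hu⟩ := k'
        rw [m1 j u hu, m1 i u (k.trans hu)]
      · have k2 : ¬ ∃ u, T (.inr (.inl i)) (o u) := fun ⟨u, hu⟩ => k' ⟨u, (Tsym k).trans hu⟩
        simp only [m, dif_neg k', dif_neg k2]
    refine ⟨m, ?_, ?_⟩
    · intro u v k
      have t : T (Sum.map id Sum.inl u) (Sum.map id Sum.inl v) := .single (.inl ⟨_, _, rfl, rfl, k⟩)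
      rcases u with u | u <;> rcases v with v | v
      · exact H (.inl u) (.inl v) t
      · exact (m1 v (.inl u) (Tsym t)).symm
      · exact m1 u (.inl v) t
      · exact m2 _ _ t
    · intro u v k
      have t : T (.inr u) (.inr v) := .single (.inr ⟨_, _, rfl, rfl, k⟩)
      rcases u with u | u <;> rcases v with v | v
      · exact m2 _ _ t
      · exact m1 u (.inr v) t
      · exact (m1 v (.inr u) (Tsym t)).symm
      · exact H (.inr u) (.inr v) t
  · rintro ⟨m, k1, k2⟩ u v h
    have key : ∀ x y, Relation.TransGen (stp Pr R) x y →
        Sum.elim l (Sum.elim m l') x = Sum.elim l (Sum.elim m l') y := by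
      intro x y h
      have st : ∀ x y, stp Pr R x y → Sum.elim l (Sum.elim m l') x = Sum.elim l (Sum.elim m l') y := by
        rintro x y (⟨x', y', rfl, rfl, h⟩ | ⟨x', y', rfl, rfl, h⟩)
        · have := k1 _ _ h
          cases x' <;> cases y' <;> exact this
        · exact k2 _ _ h
      induction h with
      | single h => exact st _ _ h
      | tail _ h ih => exact ih.trans (st _ _ h)
    have := key _ _ h
    cases u <;> cases v <;> exact this

theorem rsp_congr {R : GRel} {a b : ℕ} (h : Good R a b) {l l' m m' : ℕ → ℕ} (h1 : ∀ i < a, l i = m i)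
    (h2 : ∀ i < b, l' i = m' i) (k : Rsp R l l') : Rsp R m m' := by
  have e : ∀ u, Ok a b u → Sum.elim l l' u = Sum.elim m m' u := by
    rintro (u | u) hu
    · exact h1 _ hu
    · exact h2 _ hu
  intro u v r
  rw [← e u (h.ok _ _ r), ← e v (h.ok' r)]
  exact k _ _ r

theorem fl_as {A B C : Form P} (a : Val A) (b : Val B) (c : Val C) (i : ℕ) :
    (if i < A.size then fl A a i else (if i - A.size < B.size then fl B b (i - A.size)
      else fl C c (i - A.size - B.size))) =
    if i < A.size + B.size then (if i < A.size then fl A a i else fl B b (i - A.size))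
      else fl C c (i - (A.size + B.size)) := by
  by_cases h1 : i < A.size
  · rw [if_pos h1, if_pos (by omega)]; rw [if_pos h1]
  · rw [if_neg h1]
    by_cases h2 : i - A.size < B.size
    · rw [if_pos h2, if_pos (by omega), if_neg h1]
    · rw [if_neg h2, if_neg (by omega)]; congr 1; omega

theorem eq3 {A B C : Form P} (a a' : Val A) (b b' : Val B) (c c' : Val C) (n : ℕ)
    (hn : n = A.size + (B.size + C.size)) :
    (∀ i < n, fl (A ⋏ (B ⋏ C)) (a, (b, c)) i = fl (A ⋏ (B ⋏ C)) (a', (b', c')) i) ↔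
    (a' = a ∧ b' = b ∧ c' = c) := by
  subst hn
  constructor
  · intro h
    have := fl_inj (A ⋏ (B ⋏ C)) _ _ h
    cases this; exact ⟨rfl, rfl, rfl⟩
  · rintro ⟨rfl, rfl, rfl⟩ i _; rfl

theorem swp {A B : Form P} (a a' : Val A) (b b' : Val B) : (b' = b ∧ a' = a) ↔
    Rsp (gSwap A.size B.size) (fl (A ⋏ B) (a, b)) (fl (B ⋏ A) (b', a')) := by
  unfold gSwap
  rw [rsp_fun]
  constructor
  · rintro ⟨rfl, rfl⟩ i hi
    simp only [fl]
    by_cases h : i < A.size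
    · rw [if_pos h, if_pos h, if_neg (by omega), Nat.add_sub_cancel]
    · rw [if_neg h, if_neg h, if_pos (by omega)]
  · intro h
    constructor
    · refine fl_inj _ _ _ fun i hi => ?_
      have := h (i + A.size) (by omega)
      simp only [fl] at this
      rw [if_neg (show ¬ i + A.size < A.size by omega)] at this
      rw [if_neg (show ¬ i + A.size < A.size by omega), Nat.add_sub_cancel, if_pos hi] at this
      exact this.symm
    · refine fl_inj _ _ _ fun i hi => ?_
      have := h i (by omega)
      simp only [fl] at this
      rw [if_pos hi, if_pos hi, if_neg (by omega), Nat.add_sub_cancel] at this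
      exact this.symm

theorem bridge {A B : Form P} (f : Term P A B) : ∀ a b, tS f a b ↔ Rsp f.G (fl A a) (fl B b) := by
  induction f with
  | id A =>
    intro a b
    simp only [tS, Term.G]
    rw [rsp_id]
    exact ⟨fun h _ _ => by rw [h], fun h => (fl_inj _ _ _ h).symm⟩
  | @comp A B C g f hg hf =>
    intro a c
    simp only [tS, Term.G, hg, hf]
    rw [rsp_comp (good g) (good f)]
    constructor
    · rintro ⟨b, h⟩; exact ⟨_, h⟩
    · rintro ⟨m, h1, h2⟩
      refine ⟨ufl B m, rsp_congr (good f) (fun _ _ => rfl) (fun i hi => (fl_ufl _ _ _ hi).symm) h1,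
        rsp_congr (good g) (fun i hi => (fl_ufl _ _ _ hi).symm) (fun _ _ => rfl) h2⟩
  | conj f g hf hg =>
    rintro ⟨a, a'⟩ ⟨b, b'⟩
    exact (and_congr (hf a b) (hg a' b')).trans (rsp_par (good f) (good g) _ _ _ _).symm
  | disj f g hf hg =>
    rintro ⟨a, a'⟩ ⟨b, b'⟩
    exact (and_congr (hf a b) (hg a' b')).trans (rsp_par (good f) (good g) _ _ _ _).symm
  | bConjTo A B C =>
    rintro ⟨a, b, c⟩ ⟨⟨a', b'⟩, c'⟩
    simp only [tS, Term.G]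
    rw [rsp_id, ← eq3 _ _ _ _ _ _ _ rfl]
    exact forall₂_congr fun i _ => iff_of_eq (congrArg (_ = ·) (fl_as a' b' c' i))
  | bConjFrom A B C =>
    rintro ⟨⟨a, b⟩, c⟩ ⟨a', b', c'⟩
    simp only [tS, Term.G]
    rw [rsp_id, ← eq3 _ _ _ _ _ _ _ (add_assoc _ _ _)]
    exact forall₂_congr fun i _ => iff_of_eq (congrArg (· = _) (fl_as a b c i))
  | bDisjTo A B C =>
    rintro ⟨a, b, c⟩ ⟨⟨a', b'⟩, c'⟩
    simp only [tS, Term.G]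
    rw [rsp_id, ← eq3 _ _ _ _ _ _ _ rfl]
    exact forall₂_congr fun i _ => iff_of_eq (congrArg (_ = ·) (fl_as a' b' c' i))
  | bDisjFrom A B C =>
    rintro ⟨⟨a, b⟩, c⟩ ⟨a', b', c'⟩
    simp only [tS, Term.G]
    rw [rsp_id, ← eq3 _ _ _ _ _ _ _ (add_assoc _ _ _)]
    exact forall₂_congr fun i _ => iff_of_eq (congrArg (· = _) (fl_as a b c i))
  | d A B C =>
    rintro ⟨a, b, c⟩ ⟨⟨a', b'⟩, c'⟩
    simp only [tS, Term.G]
    rw [rsp_id, ← eq3 _ _ _ _ _ _ _ rfl]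
    exact forall₂_congr fun i _ => iff_of_eq (congrArg (_ = ·) (fl_as a' b' c' i))
  | cConj A B => rintro ⟨a, b⟩ ⟨b', a'⟩; exact swp _ _ _ _
  | cDisj A B => rintro ⟨a, b⟩ ⟨b', a'⟩; exact swp _ _ _ _
  | delta p A =>
    rintro a ⟨a', m, n⟩
    simp only [tS, Term.G]
    constructor
    · rintro ⟨rfl, rfl⟩ u v (⟨i, h, rfl | rfl, rfl | rfl⟩ | ⟨i, h, rfl | rfl, rfl | rfl⟩)
      · rfl
      · simp [fl, h]
      · simp [fl, h]
      · rfl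
      · rfl
      · obtain rfl : i = 0 := by omega
        simp [fl, Form.size]
        try rfl
      · obtain rfl : i = 0 := by omega
        simp [fl, Form.size]
        try rfl
      · rfl
    · intro h
      constructor
      · refine fl_inj _ _ _ fun i hi => ?_
        have := h (.inl i) (.inr i) (.inl ⟨i, hi, .inl rfl, .inr rfl⟩)
        simp only [Sum.elim_inl, Sum.elim_inr, fl, if_pos hi] at this
        exact this.symm
      · have := h (.inr (A.size + 1 + 0)) (.inr (A.size + 0)) (.inr ⟨0, by omega, .inr rfl, .inl rfl⟩)
        simp [fl, Form.size] at this
        exact this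
  | sigma p A =>
    rintro ⟨⟨m, n⟩, a⟩ a'
    simp only [tS, Term.G]
    have e : ∀ i, fl ((Form.pos p ⋏ Form.natom p) ⋎ A) ((m, n), a) (2 * 1 + i) = fl A a i := by
      intro i
      refine (if_neg (show ¬ 2 * 1 + i < 1 + 1 by omega)).trans ?_
      show fl A a (2 * 1 + i - (1 + 1)) = _
      congr 1; omega
    constructor
    · rintro ⟨rfl, rfl⟩ u v (⟨i, h, rfl | rfl, rfl | rfl⟩ | ⟨i, h, rfl | rfl, rfl | rfl⟩)
      · rfl
      · exact e i
      · exact (e i).symm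
      · rfl
      · rfl
      · obtain rfl : i = 0 := by omega
        rfl
      · obtain rfl : i = 0 := by omega
        rfl
      · rfl
    · intro h
      constructor
      · refine fl_inj _ _ _ fun i hi => ?_
        have := h (.inl (2 * 1 + i)) (.inr i) (.inl ⟨i, hi, .inl rfl, .inr rfl⟩)
        simp only [Sum.elim_inl, Sum.elim_inr, e] at this
        exact this.symm
      · have := h (.inl (1 + 0)) (.inl 0) (.inr ⟨0, by omega, .inr rfl, .inl rfl⟩)
        simp [fl, Form.size] at this
        exact this

theorem coherence {A B : Form P} (f g : Term P A B) (h : f.G = g.G) : Eqv f g := by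
  obtain ⟨a, b, hf, hn⟩ := arrow_val (ar f)
  have hf : tS f a b := hf
  have hg : tS g a b := by rw [bridge, ← h, ← bridge]; exact hf
  obtain ⟨f', rfl⟩ := tS_lift f a b hf
  obtain ⟨g', rfl⟩ := tS_lift g a b hg
  have e : name (ar f') = name (ar g') := CF.unique (name_cf _) hn (name_cf _)
  exact cst_eqv _ _ (mE _ (eqv_of_mk (name_inj e)))

end PNC

/-- **PN Coherence**: the functor `G` from PN to Br is faithful; that is, for all
arrow terms `f, g : A ⊢ B` of PN, if `Gf = Gg` in Br then `f = g` in PN. -/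
theorem PN_coherence {P : Type} {A B : Form P} (f g : Term P A B) :
    Term.G f = Term.G g → Eqv f g := by
  exact PNC.coherence f g
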